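/- arXiv:1710.09493 — 3 statements merged into one kernel-verified Lean document; each statement's English description precedes it below -/
import Mathlib

section
/- For all integers d ≥ 1 and p ≥ q ≥ d+1, there exists a constant c = c(d,p,q) (a natural number depending only on d, p, q) such that every finite family of at least p convex sets in ℝ^d satisfying the (p,q)-property has a piercing set of at most c points. -/
open Finset

theorem ak_avg {S : Type*} [Fintype S] (p g : S → ℝ) (hp : ∀ s, 0 ≤ p s) (h1 : ∑ s, p s = 1)
    (C : ℝ) (h : C ≤ ∑ s, p s * g s) : ∃ s, C ≤ g s := by
  by_contra! hc
  have h2 : ∑ s, p s * (C - g s) ≤ 0 := by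
    have : ∑ s, p s * (C - g s) = C - ∑ s, p s * g s := by
      simp only [mul_sub, Finset.sum_sub_distrib, ← Finset.sum_mul, h1, one_mul]
    linarith
  have h3 : ∀ s ∈ Finset.univ, 0 ≤ p s * (C - g s) := fun s _ =>
    mul_nonneg (hp s) (by linarith [hc s])
  have h4 := (Finset.sum_eq_zero_iff_of_nonneg h3).1 (le_antisymm h2 (Finset.sum_nonneg h3))
  have h5 : ∀ s, p s = 0 := by
    intro s
    have := h4 s (Finset.mem_univ s)
    rcases mul_eq_zero.1 this with h | h
    · exact h
    · linarith [hc s]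
  simp [h5] at h1

theorem ak_sum_one {A ι : Type*} [Fintype A] [DecidableEq A] [Fintype ι] (w : ι → ℝ)
    (h1 : ∑ i, w i = 1) : ∑ t : A → ι, ∏ a, w (t a) = 1 := by
  have := (Finset.prod_univ_sum (fun _ : A => (Finset.univ : Finset ι)) (fun _ i => w i)).symm
  simpa [h1] using this

theorem ak_marg_sum {A C ι : Type*} [Fintype A] [DecidableEq A] [Fintype C] [DecidableEq C]
    [Fintype ι] (w : ι → ℝ)
    (h1 : ∑ i, w i = 1) (g : (A → ι) → ℝ) :
    ∑ t : A ⊕ C → ι, (∏ b, w (t b)) * g (t ∘ Sum.inl) = ∑ s : A → ι, (∏ a, w (s a)) * g s := by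
  rw [← (Equiv.sumArrowEquivProdArrow A C ι).symm.sum_comp, Fintype.sum_prod_type]
  refine Finset.sum_congr rfl fun s _ => ?_
  have : ∀ u : C → ι, (Equiv.sumArrowEquivProdArrow A C ι).symm (s, u) ∘ Sum.inl = s := by
    intro u; ext a; rfl
  simp only [this, Fintype.prod_sum_type, Equiv.sumArrowEquivProdArrow_symm_apply_inl,
    Equiv.sumArrowEquivProdArrow_symm_apply_inr]
  rw [← Finset.sum_mul, ← Finset.mul_sum, ak_sum_one w h1, mul_one]

theorem ak_marg {A B ι : Type*} [Fintype A] [DecidableEq A] [Fintype B] [DecidableEq B]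
    [Fintype ι] (w : ι → ℝ)
    (h1 : ∑ i, w i = 1) (e : A ↪ B) (g : (A → ι) → ℝ) :
    ∑ t : B → ι, (∏ b, w (t b)) * g (t ∘ e) = ∑ s : A → ι, (∏ a, w (s a)) * g s := by
  classical
  let E : A ⊕ ((Set.range e)ᶜ : Set B) ≃ B :=
    ((Equiv.ofInjective e e.injective).sumCongr (Equiv.refl _)).trans (Equiv.Set.sumCompl _)
  have hE : ∀ a, E (Sum.inl a) = e a := by intro a; simp [E]
  rw [← ak_marg_sum (C := ((Set.range e)ᶜ : Set B)) w h1 g, ← (E.arrowCongr (Equiv.refl ι)).sum_comp]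
  refine Finset.sum_congr rfl fun t _ => ?_
  congr 1
  · rw [← E.prod_comp]
    simp [Equiv.arrowCongr]
  · congr 1
    ext a
    simp [Equiv.arrowCongr, ← hE]

theorem ak_sample {A B ι : Type*} [Fintype A] [DecidableEq A] [Fintype B] [DecidableEq B]
    [Fintype ι] (w : ι → ℝ) (h0 : ∀ i, 0 ≤ w i)
    (h1 : ∑ i, w i = 1) (R : (A → ι) → Prop) [DecidablePred R]
    (h : ∀ t : B → ι, ∃ e : A ↪ B, R (t ∘ e)) :
    1 / (Fintype.card (A ↪ B) : ℝ) ≤ ∑ s : A → ι, (∏ a, w (s a)) * (if R s then 1 else 0) := by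
  have hle : (1 : ℝ) ≤ ∑ e : A ↪ B, ∑ t : B → ι, (∏ b, w (t b)) * (if R (t ∘ e) then 1 else 0) := by
    rw [Finset.sum_comm]
    refine (ak_sum_one (A := B) w h1).symm.le.trans (Finset.sum_le_sum fun t _ => ?_)
    have hnn : 0 ≤ ∏ b, w (t b) := Finset.prod_nonneg fun b _ => h0 _
    obtain ⟨e, he⟩ := h t
    rw [← Finset.mul_sum]
    refine le_mul_of_one_le_right hnn ?_
    have := Finset.single_le_sum (f := fun e : A ↪ B => if R (t ∘ e) then (1 : ℝ) else 0)
      (fun i _ => by split_ifs <;> norm_num) (Finset.mem_univ e)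
    simpa [he] using this
  simp only [ak_marg w h1 _ (fun s => if R s then (1 : ℝ) else 0), Finset.sum_const,
    Finset.card_univ, nsmul_eq_mul] at hle
  have hpos : (0 : ℝ) < Fintype.card (A ↪ B) := by
    rcases Nat.eq_zero_or_pos (Fintype.card (A ↪ B)) with h | h
    · rw [h] at hle; norm_num at hle
    · exact_mod_cast h
  rw [div_le_iff₀ hpos]
  linarith

/-- matrix minimax -/
theorem ak_minimax {ι X : Type*} [Fintype ι] [Fintype X] [Nonempty X]
    (A : ι → X → ℝ) (β : ℝ)
    (h : ∀ w : ι → ℝ, (∀ i, 0 ≤ w i) → ∑ i, w i = 1 → ∃ x, β ≤ ∑ i, w i * A i x) :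
    ∃ v : X → ℝ, (∀ x, 0 ≤ v x) ∧ ∑ x, v x = 1 ∧ ∀ i, β ≤ ∑ x, v x * A i x := by
  classical
  let L : (X → ℝ) →ₗ[ℝ] (ι → ℝ) :=
    { toFun := fun v i => ∑ x, v x * A i x
      map_add' := by intro u v; ext i; simp [add_mul, Finset.sum_add_distrib]
      map_smul' := by intro c v; ext i; simp [Finset.mul_sum, mul_assoc] }
  have hL : ∀ v i, L v i = ∑ x, v x * A i x := fun _ _ => rfl
  by_cases hne : Disjoint (L '' stdSimplex ℝ X) {y : ι → ℝ | ∀ i, β ≤ y i}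
  swap
  · obtain ⟨y, ⟨v, hv, rfl⟩, hy⟩ := Set.not_disjoint_iff.1 hne
    exact ⟨v, hv.1, hv.2, hy⟩
  exfalso
  have hTc : IsClosed {y : ι → ℝ | ∀ i, β ≤ y i} := by
    simp only [Set.ofPred_forall]
    exact isClosed_iInter fun i => isClosed_le continuous_const (continuous_apply i)
  have hTv : Convex ℝ {y : ι → ℝ | ∀ i, β ≤ y i} := by
    intro x hx y hy a b ha hb hab i
    have := hx i
    have := hy i
    simp only [Pi.add_apply, Pi.smul_apply, smul_eq_mul]
    have h3 := mul_le_mul_of_nonneg_left (hx i) ha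
    have h4 := mul_le_mul_of_nonneg_left (hy i) hb
    have h5 : β = a * β + b * β := by rw [← add_mul, hab, one_mul]
    linarith
  obtain ⟨f, u, v, hf1, huv, hf2⟩ := geometric_hahn_banach_compact_closed
    ((convex_stdSimplex ℝ X).linear_image L)
    ((isCompact_stdSimplex ℝ X).image (LinearMap.continuous_of_finiteDimensional L)) hTv hTc hne
  have hf : ∀ y : ι → ℝ, f y = ∑ i, f (Pi.single i 1) * y i := by
    intro y
    conv_lhs => rw [pi_eq_sum_univ' y]
    simp [mul_comm]
  set c : ι → ℝ := fun i => f (Pi.single i 1) with hc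
  have hβ : v < ∑ i, c i * β := by
    have := hf2 (fun _ => β) (fun i => le_rfl)
    rwa [hf] at this
  have hcn : ∀ i, 0 ≤ c i := by
    intro i
    by_contra! hneg
    have key : ∀ s : ℝ, 0 ≤ s → v < ∑ i, c i * β + s * c i := by
      intro s hs
      have := hf2 ((fun _ => β) + s • Pi.single i 1) (by
        intro j
        simp only [Pi.add_apply, Pi.smul_apply, smul_eq_mul]
        have : 0 ≤ (Pi.single i 1 : ι → ℝ) j := by
          by_cases hj : j = i
          · subst hj; simp
          · simp [hj]
        nlinarith [mul_nonneg hs this])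
      rw [map_add, map_smul, hf (fun _ => β)] at this
      simpa using this
    have := key ((∑ i, c i * β - v) / (- c i)) (div_nonneg (by linarith) (by linarith))
    rw [div_mul_eq_mul_div, div_neg, mul_div_assoc, div_self hneg.ne] at this
    linarith
  obtain ⟨x0⟩ := ‹Nonempty X›
  have hcol : ∀ x, ∑ i, c i * A i x < u := by
    intro x
    have := hf1 (L (Pi.single x 1)) ⟨_, single_mem_stdSimplex ℝ x, rfl⟩
    rw [hf] at this
    simpa [hL, Pi.single_apply] using this
  have hC : 0 < ∑ i, c i := by
    rcases (Finset.sum_nonneg fun i (_ : i ∈ Finset.univ) => hcn i).lt_or_eq with h | h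
    · exact h
    · exfalso
      have h0 := (Finset.sum_eq_zero_iff_of_nonneg fun i _ => hcn i).1 h.symm
      have := hcol x0
      rw [Finset.sum_congr rfl (fun i hi => by rw [h0 i hi])] at this
      rw [Finset.sum_congr rfl (fun i hi => by rw [h0 i hi])] at hβ
      simp at this hβ
      linarith
  obtain ⟨x, hx⟩ := h (fun i => c i / ∑ i, c i) (fun i => div_nonneg (hcn i) hC.le)
    (by rw [← Finset.sum_div, div_self hC.ne'])
  have h7 := hcol x
  simp only [div_mul_eq_mul_div] at hx
  rw [← Finset.sum_div, le_div_iff₀ hC] at hx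
  rw [← Finset.sum_mul] at hβ
  linarith

/-- the Euclidean norm on `Fin d → ℝ` -/
noncomputable def akNorm {d : ℕ} (y : Fin d → ℝ) : ℝ := ‖(WithLp.toLp 2 y : EuclideanSpace ℝ (Fin d))‖

theorem akNorm_cont {d : ℕ} : Continuous (akNorm (d := d)) := by
  unfold akNorm
  fun_prop

theorem akNorm_convex {d : ℕ} (r : ℝ) : Convex ℝ {y : Fin d → ℝ | akNorm y < r} := by
  have := (convex_ball (0 : EuclideanSpace ℝ (Fin d)) r).linear_preimage
    (WithLp.linearEquiv 2 ℝ (Fin d → ℝ)).symm.toLinearMap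
  have he : {y : Fin d → ℝ | akNorm y < r} =
      (WithLp.linearEquiv 2 ℝ (Fin d → ℝ)).symm.toLinearMap ⁻¹' Metric.ball 0 r := by
    ext y
    simp [akNorm]
  rw [he]
  exact this

theorem akNorm_unique {d : ℕ} {K : Set (Fin d → ℝ)} (hK : Convex ℝ K) {x y : Fin d → ℝ}
    (hx : x ∈ K) (hy : y ∈ K) (hxm : ∀ z ∈ K, akNorm x ≤ akNorm z)
    (hym : ∀ z ∈ K, akNorm y ≤ akNorm z) : x = y := by
  by_contra hne
  have h := norm_combo_lt_of_ne (x := (WithLp.toLp 2 x : EuclideanSpace ℝ (Fin d)))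
    (y := WithLp.toLp 2 y) (r := akNorm x) (a := 1/2) (b := 1/2) le_rfl (hym x hx)
    (fun h => hne (by simpa using h)) (by norm_num) (by norm_num) (by norm_num)
  have hm : (1/2 : ℝ) • x + (1/2 : ℝ) • y ∈ K :=
    hK hx hy (by norm_num) (by norm_num) (by norm_num)
  have := hxm _ hm
  unfold akNorm at this h
  rw [WithLp.toLp_add, WithLp.toLp_smul, WithLp.toLp_smul] at this
  linarith

open Classical in
/-- a point of minimal Euclidean norm -/
noncomputable def akMin {d : ℕ} (K : Set (Fin d → ℝ)) : Fin d → ℝ :=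
  if h : ∃ x ∈ K, ∀ z ∈ K, akNorm x ≤ akNorm z then h.choose else 0

theorem akMin_eq {d : ℕ} {K : Set (Fin d → ℝ)} (hK : Convex ℝ K) {x : Fin d → ℝ}
    (hx : x ∈ K) (hxm : ∀ z ∈ K, akNorm x ≤ akNorm z) : akMin K = x := by
  have h : ∃ x ∈ K, ∀ z ∈ K, akNorm x ≤ akNorm z := ⟨x, hx, hxm⟩
  unfold akMin
  rw [dif_pos h]
  exact akNorm_unique hK h.choose_spec.1 hx h.choose_spec.2 hxm

theorem ak_key {d : ℕ} (G : Fin (d + 1) → Set (Fin d → ℝ)) (hc : ∀ i, Convex ℝ (G i))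
    (hk : ∀ i, IsCompact (G i)) (hn : (⋂ i, G i).Nonempty) :
    ∃ j, akMin (⋂ k, G (j.succAbove k)) ∈ G j := by
  have hcomp : IsCompact (⋂ i, G i) :=
    (hk 0).of_isClosed_subset (isClosed_iInter fun i => (hk i).isClosed) (Set.iInter_subset _ 0)
  obtain ⟨x, hx, hxm⟩ := hcomp.exists_isMinOn hn akNorm_cont.continuousOn
  have hxG : ∀ i, x ∈ G i := by simpa using hx
  suffices h : ∃ j : Fin (d + 1), ∀ y ∈ ⋂ k, G (j.succAbove k), akNorm x ≤ akNorm y by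
    obtain ⟨j, hj⟩ := h
    refine ⟨j, ?_⟩
    rw [akMin_eq (convex_iInter fun k => hc _) (Set.mem_iInter.2 fun k => hxG _) hj]
    exact hxG j
  by_contra! hcon
  choose y hy hlt using hcon
  let H : Option (Fin (d + 1)) → Set (Fin d → ℝ) := fun o =>
    o.elim {y | akNorm y < akNorm x} G
  have hH : (⋂ o ∈ (Finset.univ : Finset (Option (Fin (d + 1)))), H o).Nonempty := by
    apply Convex.helly_theorem' (𝕜 := ℝ)
    · rintro (_ | i) -
      · exact akNorm_convex _
      · exact hc i
    · intro I _ hI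
      have : ∃ o, o ∉ I := by
        by_contra! hall
        have : I = Finset.univ := Finset.eq_univ_iff_forall.2 hall
        subst this
        simp at hI
      obtain ⟨o, ho⟩ := this
      rcases o with _ | j
      · refine ⟨x, Set.mem_iInter₂.2 ?_⟩
        rintro (_ | i) hi
        · exact absurd hi ho
        · exact hxG i
      · refine ⟨y j, Set.mem_iInter₂.2 ?_⟩
        rintro (_ | i) hi
        · exact hlt j
        · have hij : i ≠ j := by rintro rfl; exact ho hi
          obtain ⟨k, rfl⟩ := Fin.exists_succAbove_eq hij
          exact Set.mem_iInter.1 (hy j) k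
  obtain ⟨z, hz⟩ := hH
  have hz' : ∀ o, z ∈ H o := by simpa using hz
  have h1 : akNorm z < akNorm x := hz' none
  have h2 : akNorm x ≤ akNorm z := hxm (Set.mem_iInter.2 fun i => hz' (some i))
  linarith

open Classical in
/-- Weighted fractional Helly. -/
theorem ak_fracHelly {d : ℕ} {ι : Type*} [Fintype ι] (w : ι → ℝ) (h0 : ∀ i, 0 ≤ w i)
    (h1 : ∑ i, w i = 1) (G : ι → Set (Fin d → ℝ)) (hc : ∀ i, Convex ℝ (G i))
    (hk : ∀ i, IsCompact (G i)) (α : ℝ)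
    (hα : α ≤ ∑ t : Fin (d + 1) → ι, (∏ k, w (t k)) *
      (if (⋂ k, G (t k)).Nonempty then 1 else 0)) :
    ∃ x, α / (d + 1) ≤ ∑ i, w i * (if x ∈ G i then 1 else 0) := by
  have hle : α ≤ ∑ j : Fin (d + 1), ∑ t : Fin (d + 1) → ι, (∏ k, w (t k)) *
      (if akMin (⋂ k, G (t (j.succAbove k))) ∈ G (t j) then 1 else 0) := by
    refine hα.trans ?_
    rw [Finset.sum_comm]
    refine Finset.sum_le_sum fun t _ => ?_
    rw [← Finset.mul_sum]
    refine mul_le_mul_of_nonneg_left ?_ (Finset.prod_nonneg fun k _ => h0 _)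
    split_ifs with hne
    · obtain ⟨j, hj⟩ := ak_key (fun k => G (t k)) (fun _ => hc _) (fun _ => hk _) hne
      have := Finset.single_le_sum (f := fun j : Fin (d + 1) =>
        if akMin (⋂ k, G (t (j.succAbove k))) ∈ G (t j) then (1 : ℝ) else 0)
        (fun i _ => by split_ifs <;> norm_num) (Finset.mem_univ j)
      simp only [hj, if_true] at this
      exact this
    · exact Finset.sum_nonneg fun i _ => by split_ifs <;> norm_num
  obtain ⟨j, hj⟩ := ak_avg (fun _ : Fin (d + 1) => 1 / ((d : ℝ) + 1))
    (fun j => ∑ t : Fin (d + 1) → ι, (∏ k, w (t k)) *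
      (if akMin (⋂ k, G (t (j.succAbove k))) ∈ G (t j) then 1 else 0))
    (fun _ => by positivity) (by simp; field_simp) (α / (d + 1)) (by
      rw [← Finset.mul_sum, div_eq_mul_one_div, mul_comm]
      exact mul_le_mul_of_nonneg_left hle (by positivity))
  rw [← (Fin.insertNthEquiv (fun _ => ι) j).sum_comp, Fintype.sum_prod_type,
    Finset.sum_comm] at hj
  obtain ⟨s, hs⟩ := ak_avg (fun s : Fin d → ι => ∏ k, w (s k))
    (fun s => ∑ i, w i * (if akMin (⋂ k, G (s k)) ∈ G i then 1 else 0))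
    (fun s => Finset.prod_nonneg fun k _ => h0 _) (ak_sum_one w h1) (α / (d + 1)) (by
      refine hj.trans (le_of_eq ?_)
      refine Finset.sum_congr rfl fun s _ => ?_
      rw [Finset.mul_sum]
      refine Finset.sum_congr rfl fun i _ => ?_
      rw [Fin.prod_univ_succAbove _ j]
      simp only [Fin.insertNthEquiv_apply, Fin.insertNth_apply_same,
        Fin.insertNth_apply_succAbove]
      ring)
  exact ⟨_, hs⟩

theorem ak_carath {d N : ℕ} (a : Fin N → Fin d → ℝ) (S : Finset (Fin N)) (hS : d + 1 ≤ S.card)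
    (x : Fin d → ℝ) (hx : x ∈ convexHull ℝ (a '' S)) :
    ∃ T ⊆ S, T.card = d + 1 ∧ x ∈ convexHull ℝ (a '' T) := by
  classical
  rw [convexHull_eq_union] at hx
  simp only [Set.mem_iUnion] at hx
  obtain ⟨t, htS, hti, hxt⟩ := hx
  have hcard : t.card ≤ d + 1 := by
    have := hti.card_le_finrank_succ
    have h2 := Submodule.finrank_le (vectorSpan ℝ (Set.range ((↑) : t → Fin d → ℝ)))
    simp at this h2
    omega
  obtain ⟨V, hV, hVi, hVinj⟩ := Finset.exists_subset_injOn_image_eq_of_surjOn (f := a)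
    (S : Set (Fin N)) t (show Set.SurjOn a (S : Set (Fin N)) (t : Set (Fin d → ℝ)) from htS)
  have hVc : V.card = t.card := by rw [← hVinj, Finset.card_image_of_injOn hVi]
  obtain ⟨T, hVT, hTS, hT⟩ := Finset.exists_subsuperset_card_eq (show V ⊆ S by exact_mod_cast hV) (by omega) hS
  refine ⟨T, hTS, hT, convexHull_mono ?_ hxt⟩
  rw [← hVinj, Finset.coe_image]
  exact Set.image_mono (by exact_mod_cast hVT)

theorem ak_center {d N : ℕ} (hN : 0 < N) (a : Fin N → Fin d → ℝ) :
    ∃ x : Fin d → ℝ, ∀ S : Finset (Fin N), d * N < (d + 1) * S.card →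
      x ∈ convexHull ℝ (a '' S) := by
  classical
  have := Convex.helly_theorem' (𝕜 := ℝ) (F := fun S : Finset (Fin N) => convexHull ℝ (a '' S))
    (s := Finset.univ.filter fun S => d * N < (d + 1) * S.card)
    (fun S _ => convex_convexHull _ _) (by
      intro I hI hcard
      simp only [Module.finrank_fintype_fun_eq_card, Fintype.card_fin] at hcard
      suffices h : ∃ b, ∀ S ∈ I, b ∈ S by
        obtain ⟨b, hb⟩ := h
        exact ⟨a b, Set.mem_iInter₂.2 fun S hS =>
          subset_convexHull _ _ ⟨b, hb S hS, rfl⟩⟩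
      by_contra! hcon
      have hcov : (Finset.univ : Finset (Fin N)) ⊆ I.biUnion fun S => Sᶜ := by
        intro b _
        obtain ⟨S, hS, hb⟩ := hcon b
        simp only [Finset.mem_biUnion, Finset.mem_compl]
        exact ⟨S, hS, hb⟩
      have h1 := (Finset.card_le_card hcov).trans Finset.card_biUnion_le
      simp only [Finset.card_univ, Fintype.card_fin] at h1
      have h2 : ∀ S ∈ I, (d + 1) * (Sᶜ).card + 1 ≤ N := by
        intro S hS
        have := (Finset.mem_filter.1 (hI hS)).2
        have h3 := Finset.card_compl_add_card S
        simp only [Fintype.card_fin] at h3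
        nlinarith
      have h3 := Finset.sum_le_sum h2
      rw [Finset.sum_add_distrib, ← Finset.mul_sum] at h3
      simp only [Finset.sum_const, smul_eq_mul, mul_one] at h3
      have h4 : (d + 1) * N ≤ (d + 1) * ∑ S ∈ I, (Sᶜ).card := Nat.mul_le_mul_left _ h1
      have h5 : I.card * N ≤ (d + 1) * N := Nat.mul_le_mul_right _ hcard
      have h6 : I.card = 0 := by omega
      have h7 : 0 < (d + 1) * N := by positivity
      simp only [h6] at h3
      omega)
  obtain ⟨x, hx⟩ := this
  refine ⟨x, fun S hS => ?_⟩
  exact Set.mem_iInter₂.1 hx S (by simpa using hS)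

theorem ak_tverberg {d : ℕ} (a : Fin ((d + 1) ^ 3) → Fin d → ℝ) :
    ∃ e : Fin (d + 1) × Fin (d + 1) ↪ Fin ((d + 1) ^ 3),
      (⋂ k, convexHull ℝ (Set.range fun l => a (e (k, l)))).Nonempty := by
  classical
  obtain ⟨x, hx⟩ := ak_center (by positivity) a
  have main : ∀ k ≤ d + 1, ∃ 𝒯 : Finset (Finset (Fin ((d + 1) ^ 3))), 𝒯.card = k ∧
      (∀ T ∈ 𝒯, T.card = d + 1 ∧ x ∈ convexHull ℝ (a '' T)) ∧
      ∀ T ∈ 𝒯, ∀ T' ∈ 𝒯, T ≠ T' → Disjoint T T' := by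
    intro k
    induction k with
    | zero => intro _; exact ⟨∅, by simp⟩
    | succ k ih =>
      intro hk
      obtain ⟨𝒯, hc, h1, h2⟩ := ih (by omega)
      set S : Finset (Fin ((d + 1) ^ 3)) := (𝒯.biUnion id)ᶜ with hS
      have hU : (𝒯.biUnion id).card ≤ k * (d + 1) := by
        refine Finset.card_biUnion_le.trans ?_
        simp only [id]
        rw [Finset.sum_congr rfl (g := fun _ => d + 1) (fun T hT => (h1 T hT).1), Finset.sum_const, hc, smul_eq_mul]
      have hcs := Finset.card_compl_add_card (𝒯.biUnion id)
      rw [← hS, Fintype.card_fin] at hcs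
      have hkd : k * (d + 1) ≤ d * (d + 1) := Nat.mul_le_mul_right _ (by omega)
      have hSc : (d + 1) ^ 3 ≤ S.card + d * (d + 1) := by omega
      obtain ⟨T, hTS, hT, hxT⟩ := ak_carath a S (by nlinarith) x (hx S (by nlinarith))
      have hdis : ∀ T' ∈ 𝒯, Disjoint T T' := by
        intro T' hT'
        rw [Finset.disjoint_left]
        intro b hb hb'
        have := hTS hb
        rw [hS, Finset.mem_compl] at this
        exact this (Finset.mem_biUnion.2 ⟨T', hT', hb'⟩)
      have hnot : T ∉ 𝒯 := by
        intro hmem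
        have := hdis T hmem
        rw [disjoint_self] at this
        rw [this] at hT
        simp at hT
      refine ⟨insert T 𝒯, by rw [Finset.card_insert_of_notMem hnot, hc], ?_, ?_⟩
      · intro T' hT'
        rcases Finset.mem_insert.1 hT' with rfl | h
        · exact ⟨hT, hxT⟩
        · exact h1 T' h
      · intro A hA B hB hne
        rcases Finset.mem_insert.1 hA with rfl | hA'
        · rcases Finset.mem_insert.1 hB with rfl | hB'
          · exact absurd rfl hne
          · exact hdis B hB'
        · rcases Finset.mem_insert.1 hB with rfl | hB'
          · exact (hdis A hA').symm
          · exact h2 A hA' B hB' hne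
  obtain ⟨𝒯, hc, h1, h2⟩ := main (d + 1) le_rfl
  let E : Fin (d + 1) ≃ 𝒯 := (𝒯.equivFinOfCardEq hc).symm
  let f : Fin (d + 1) × Fin (d + 1) → Fin ((d + 1) ^ 3) := fun p =>
    (E p.1).1.orderEmbOfFin (h1 _ (E p.1).2).1 p.2
  have hf : ∀ p, f p ∈ (E p.1).1 := fun p => Finset.orderEmbOfFin_mem _ _ _
  have hinj : Function.Injective f := by
    rintro ⟨k, l⟩ ⟨k', l'⟩ h
    have hkk : k = k' := by
      by_contra hne
      have hne' : (E k).1 ≠ (E k').1 := fun h => hne (E.injective (Subtype.ext h))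
      have := Finset.disjoint_left.1 (h2 _ (E k).2 _ (E k').2 hne') (hf (k, l))
      rw [h] at this
      exact this (hf (k', l'))
    subst hkk
    have : l = l' := ((E k).1.orderEmbOfFin (h1 _ (E k).2).1).injective h
    rw [this]
  refine ⟨⟨f, hinj⟩, x, Set.mem_iInter.2 fun k => ?_⟩
  refine convexHull_mono ?_ (h1 _ (E k).2).2
  rintro _ ⟨b, hb, rfl⟩
  rw [← Finset.range_orderEmbOfFin (E k).1 (h1 _ (E k).2).1] at hb
  obtain ⟨l, rfl⟩ := hb
  exact ⟨l, rfl⟩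

open Classical in
/-- First selection lemma, weighted. -/
theorem ak_selection (d : ℕ) : ∃ γ : ℝ, 0 < γ ∧ ∀ (κ : Type) [Fintype κ] (u : κ → ℝ)
    (a : κ → Fin d → ℝ), (∀ i, 0 ≤ u i) → ∑ i, u i = 1 →
    ∃ x, γ ≤ ∑ t : Fin (d + 1) → κ, (∏ l, u (t l)) *
      (if x ∈ convexHull ℝ (Set.range fun l => a (t l)) then 1 else 0) := by
  refine ⟨1 / (Fintype.card (Fin (d + 1) × Fin (d + 1) ↪ Fin ((d + 1) ^ 3)) : ℝ) / (d + 1), ?_, ?_⟩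
  · have : 0 < Fintype.card (Fin (d + 1) × Fin (d + 1) ↪ Fin ((d + 1) ^ 3)) := by
      obtain ⟨e, -⟩ := ak_tverberg (d := d) (fun _ => 0)
      exact Fintype.card_pos_iff.2 ⟨e⟩
    positivity
  intro κ _ u a h0 h1
  have hs := ak_sample (A := Fin (d + 1) × Fin (d + 1)) (B := Fin ((d + 1) ^ 3)) u h0 h1
    (fun s => (⋂ k, convexHull ℝ (Set.range fun l => a (s (k, l)))).Nonempty)
    (fun t => ak_tverberg (fun b => a (t b)))
  refine ak_fracHelly (fun t : Fin (d + 1) → κ => ∏ l, u (t l))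
    (fun t => Finset.prod_nonneg fun _ _ => h0 _) (ak_sum_one u h1)
    (fun t => convexHull ℝ (Set.range fun l => a (t l))) (fun t => convex_convexHull _ _)
    (fun t => (Set.finite_range _).isCompact_convexHull ℝ) _ (hs.trans (le_of_eq ?_))
  rw [← (Equiv.curry (Fin (d + 1)) (Fin (d + 1)) κ).sum_comp]
  refine Finset.sum_congr rfl fun s _ => ?_
  rw [Fintype.prod_prod_type]
  rfl

open Classical in
theorem ak_net (d : ℕ) (ε : ℝ) (hε : 0 < ε) : ∃ N : ℕ, ∀ (κ : Type) [Fintype κ] (v : κ → ℝ)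
    (a : κ → Fin d → ℝ), (∀ i, 0 ≤ v i) → ∑ i, v i = 1 →
    ∃ C : Finset (Fin d → ℝ), C.card ≤ N ∧ ∀ S : Set (Fin d → ℝ), Convex ℝ S →
      ε ≤ ∑ i, v i * (if a i ∈ S then 1 else 0) → ∃ c ∈ C, c ∈ S := by
  obtain ⟨γ, hγ, hsel⟩ := ak_selection d
  have hδ : 0 < γ * ε ^ (d + 1) := by positivity
  obtain ⟨N, hN⟩ := exists_nat_gt (1 / (γ * ε ^ (d + 1)))
  rw [div_lt_iff₀ hδ] at hN
  refine ⟨N, fun κ _ v a h0 h1 => ?_⟩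
  by_contra! hcon
  let Φ : Finset (Fin d → ℝ) → ℝ := fun C => ∑ t : Fin (d + 1) → κ, (∏ l, v (t l)) *
    (if ∀ c ∈ C, c ∉ convexHull ℝ (Set.range fun l => a (t l)) then 1 else 0)
  have main : ∀ k ≤ N, ∃ C : Finset (Fin d → ℝ), C.card ≤ k ∧
      Φ C + k * (γ * ε ^ (d + 1)) ≤ 1 := by
    intro k
    induction k with
    | zero =>
      intro _
      refine ⟨∅, by simp, ?_⟩
      simp [Φ, ak_sum_one v h1]
    | succ k ih =>
      intro hk
      obtain ⟨C, hCc, hC⟩ := ih (by omega)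
      obtain ⟨S, hS, hSε, hSC⟩ := hcon C (by omega)
      set m := ∑ i, v i * (if a i ∈ S then (1 : ℝ) else 0) with hm
      have hmpos : 0 < m := by linarith
      obtain ⟨x, hx⟩ := hsel κ (fun i => v i * (if a i ∈ S then (1 : ℝ) else 0) / m) a
        (fun i => div_nonneg (mul_nonneg (h0 i) (by split_ifs <;> norm_num)) hmpos.le)
        (by rw [← Finset.sum_div, ← hm, div_self hmpos.ne'])
      simp only [Finset.prod_div_distrib, Finset.prod_const, Finset.card_univ, Fintype.card_fin,
        div_mul_eq_mul_div] at hx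
      rw [← Finset.sum_div, le_div_iff₀ (by positivity)] at hx
      have hx2 : γ * ε ^ (d + 1) ≤ γ * m ^ (d + 1) := by gcongr
      refine ⟨insert x C, (Finset.card_insert_le _ _).trans (by omega), ?_⟩
      suffices h : Φ (insert x C) + γ * m ^ (d + 1) ≤ Φ C by
        push_cast
        linarith
      refine (add_le_add_right hx _).trans ?_
      simp only [Φ]
      rw [← Finset.sum_add_distrib]
      refine Finset.sum_le_sum fun t _ => ?_
      rw [Finset.prod_mul_distrib, mul_assoc, ← mul_add]
      refine mul_le_mul_of_nonneg_left ?_ (Finset.prod_nonneg fun _ _ => h0 _)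
      by_cases hall : ∀ l, a (t l) ∈ S
      · have hsub : convexHull ℝ (Set.range fun l => a (t l)) ⊆ S :=
          convexHull_min (by rintro _ ⟨l, rfl⟩; exact hall l) hS
        have hno : ∀ c ∈ C, c ∉ convexHull ℝ (Set.range fun l => a (t l)) :=
          fun c hc h => hSC c hc (hsub h)
        rw [if_pos hno]
        simp only [hall, if_true, Finset.prod_const_one, one_mul]
        by_cases hxh : x ∈ convexHull ℝ (Set.range fun l => a (t l))
        · rw [if_neg (fun h => h x (Finset.mem_insert_self _ _) hxh), if_pos hxh]
          norm_num
        · rw [if_neg hxh]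
          split_ifs <;> norm_num
      · obtain ⟨l, hl⟩ := not_forall.1 hall
        rw [Finset.prod_eq_zero (Finset.mem_univ l) (by rw [if_neg hl]), zero_mul, add_zero]
        by_cases hno : ∀ c ∈ C, c ∉ convexHull ℝ (Set.range fun l => a (t l))
        · rw [if_pos hno]
          split_ifs <;> norm_num
        · rw [if_neg hno, if_neg]
          exact fun h => hno fun c hc => h c (Finset.mem_insert_of_mem hc)
  obtain ⟨C, -, hC⟩ := main N le_rfl
  have : 0 ≤ Φ C := Finset.sum_nonneg fun t _ =>
    mul_nonneg (Finset.prod_nonneg fun _ _ => h0 _) (by split_ifs <;> norm_num)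
  linarith

theorem ak_pq {d p q : ℕ} (hq : d + 1 ≤ q) {ι : Type} [Fintype ι] (F : ι → Set (Fin d → ℝ))
    (hne : ∀ i, (F i).Nonempty)
    (h : ∀ P : Finset ι, P.card = p → ∃ Q ⊆ P, Q.card = q ∧ (⋂ i ∈ Q, F i).Nonempty)
    (t : Fin (p * (d + 1)) → ι) (hp : 0 < p) :
    ∃ e : Fin (d + 1) ↪ Fin (p * (d + 1)), (⋂ k, F (t (e k))).Nonempty := by
  classical
  by_cases hc : p ≤ (Finset.univ.image t).card
  · obtain ⟨P, hP, hPc⟩ := Finset.exists_subset_card_eq hc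
    obtain ⟨Q, hQP, hQc, y, hy⟩ := h P hPc
    obtain ⟨Q', hQ', hQ'c⟩ := Finset.exists_subset_card_eq (hq.trans hQc.ge)
    have hpre : ∀ k : Fin (d + 1), ∃ b, t b = ((Q'.equivFinOfCardEq hQ'c).symm k : ι) := by
      intro k
      have := hP (hQP (hQ' ((Q'.equivFinOfCardEq hQ'c).symm k).2))
      simpa using this
    choose g hg using hpre
    refine ⟨⟨g, fun k k' hkk => ?_⟩, y, Set.mem_iInter.2 fun k => ?_⟩
    · have := hg k
      rw [hkk, hg k'] at this
      exact ((Q'.equivFinOfCardEq hQ'c).symm.injective (Subtype.ext this)).symm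
    · change y ∈ F (t (g k))
      rw [hg k]
      exact Set.mem_iInter₂.1 hy _ (hQ' ((Q'.equivFinOfCardEq hQ'c).symm k).2)
  · push Not at hc
    obtain ⟨i, hi, hic⟩ := Finset.exists_lt_card_fiber_of_mul_lt_card_of_maps_to
      (s := (Finset.univ : Finset (Fin (p * (d + 1))))) (t := Finset.univ.image t) (f := t) (n := d)
      (fun b hb => Finset.mem_image_of_mem _ hb) (by
        simp only [Finset.card_univ, Fintype.card_fin]
        nlinarith)
    obtain ⟨U, hU, hUc⟩ := Finset.exists_subset_card_eq (Nat.succ_le_of_lt hic)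
    obtain ⟨y, hy⟩ := hne i
    refine ⟨(U.orderEmbOfFin hUc).toEmbedding, y, Set.mem_iInter.2 fun k => ?_⟩
    have := hU (Finset.orderEmbOfFin_mem U hUc k)
    simp only [Finset.mem_filter, Finset.mem_univ, true_and] at this
    simp only [RelEmbedding.coe_toEmbedding, this]
    exact hy

/-- Alon–Kleitman `(p,q)` theorem: for all `d ≥ 1` and `p ≥ q ≥ d+1` there is a constant
`c = c(d,p,q)` such that every finite family of at least `p` convex sets in `ℝ^d`
with the `(p,q)`-property can be pierced by at most `c` points. -/
theorem alon_kleitman (d p q : ℕ) (hd : 1 ≤ d) (hq : d + 1 ≤ q) (hpq : q ≤ p) :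
    ∃ c : ℕ, ∀ (ι : Type) [Fintype ι], p ≤ Fintype.card ι →
      ∀ F : ι → Set (Fin d → ℝ), (∀ i, Convex ℝ (F i)) → (∀ i, (F i).Nonempty) →
      (∀ P : Finset ι, P.card = p →
        ∃ Q ⊆ P, Q.card = q ∧ (⋂ i ∈ Q, F i).Nonempty) →
      ∃ C : Finset (Fin d → ℝ), C.card ≤ c ∧ ∀ i, ∃ x ∈ C, x ∈ F i := by
  classical
  have hp : 0 < p := by omega
  set α : ℝ := 1 / (Fintype.card (Fin (d + 1) ↪ Fin (p * (d + 1))) : ℝ) with hα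
  have hαpos : 0 < α := by
    have : 0 < Fintype.card (Fin (d + 1) ↪ Fin (p * (d + 1))) :=
      Fintype.card_pos_iff.2 ⟨Fin.castLEEmb (Nat.le_mul_of_pos_left _ hp)⟩
    positivity
  obtain ⟨N, hN⟩ := ak_net d (α / (d + 1)) (by positivity)
  refine ⟨N, fun ι _ hcard F hconv hne hpqp => ?_⟩
  have hpt : ∀ S : Finset ι, ∃ x : Fin d → ℝ, (⋂ i ∈ S, F i).Nonempty → x ∈ ⋂ i ∈ S, F i := by
    intro S
    by_cases h : (⋂ i ∈ S, F i).Nonempty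
    · exact ⟨h.some, fun _ => h.some_mem⟩
    · exact ⟨0, fun h' => absurd h' h⟩
  choose pt hpt using hpt
  have hpt' : ∀ (S : Finset ι) (x : Fin d → ℝ), (∀ i ∈ S, x ∈ F i) → ∀ i ∈ S, pt S ∈ F i :=
    fun S x hx i hi => Set.mem_iInter₂.1 (hpt S ⟨x, Set.mem_iInter₂.2 hx⟩) i hi
  let G : ι → Set (Fin d → ℝ) := fun i => convexHull ℝ {y | y ∈ Set.range pt ∧ y ∈ F i}
  have hGF : ∀ i, G i ⊆ F i := fun i => convexHull_min (fun y hy => hy.2) (hconv i)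
  have hGk : ∀ i, IsCompact (G i) := fun i =>
    ((Set.finite_range pt).subset fun y hy => hy.1).isCompact_convexHull ℝ
  obtain ⟨v, hv0, hv1, hv⟩ := ak_minimax (fun (i : ι) (S : Finset ι) =>
    if pt S ∈ F i then (1 : ℝ) else 0) (α / (d + 1)) (by
      intro w h0 h1
      have hs := ak_sample (A := Fin (d + 1)) (B := Fin (p * (d + 1))) w h0 h1
        (fun s => (⋂ k, F (s k)).Nonempty) (fun t => ak_pq hq F hne hpqp t hp)
      obtain ⟨x, hx⟩ := ak_fracHelly w h0 h1 G (fun i => convex_convexHull _ _) hGk α (by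
        refine hs.trans (Finset.sum_le_sum fun s _ => ?_)
        refine mul_le_mul_of_nonneg_left ?_ (Finset.prod_nonneg fun _ _ => h0 _)
        by_cases h : (⋂ k, F (s k)).Nonempty
        · have hG : (⋂ k, G (s k)).Nonempty := by
            obtain ⟨x, hx⟩ := h
            refine ⟨pt (Finset.univ.image s), Set.mem_iInter.2 fun k => ?_⟩
            refine subset_convexHull _ _ ⟨⟨_, rfl⟩, ?_⟩
            refine hpt' _ x ?_ _ (Finset.mem_image_of_mem _ (Finset.mem_univ k))
            intro i hi
            obtain ⟨k, -, rfl⟩ := Finset.mem_image.1 hi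
            exact Set.mem_iInter.1 hx k
          rw [if_pos h, if_pos hG]
        · rw [if_neg h]
          split_ifs <;> norm_num)
      refine ⟨Finset.univ.filter fun i => x ∈ F i, hx.trans (Finset.sum_le_sum fun i _ => ?_)⟩
      refine mul_le_mul_of_nonneg_left ?_ (h0 i)
      by_cases hxi : x ∈ G i
      · rw [if_pos hxi, if_pos]
        exact hpt' _ x (fun j hj => (Finset.mem_filter.1 hj).2) i
          (Finset.mem_filter.2 ⟨Finset.mem_univ i, hGF i hxi⟩)
      · rw [if_neg hxi]
        split_ifs <;> norm_num)
  obtain ⟨C, hCc, hC⟩ := hN (Finset ι) v pt hv0 hv1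
  exact ⟨C, hCc, fun i => hC (F i) (hconv i) (hv i)⟩
end

section
/- Let F be a finite family of at least 4 convex sets in ℝ² satisfying the (4,3)-property (among every 4 sets of F there exist 3 with a common point). Then F has a piercing set of at most 13 points. -/
/-! ### Part 1: interval combinatorics -/

/-- two closed intervals meet -/
def Mt {ι : Type*} (l r : ι → ℝ) (i j : ι) : Prop := l i ≤ r j ∧ l j ≤ r i

theorem two_track {ι : Type*} (A : Finset ι) (cat : ι → Bool) (l1 r1 l2 r2 : ι → ℝ)
    (h1 : ∀ i, l1 i ≤ r1 i) (h2 : ∀ i, l2 i ≤ r2 i)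
    (H : ∀ i ∈ A, ∀ j ∈ A, Mt l1 r1 i j ∨ (cat i = cat j ∧ Mt l2 r2 i j)) :
    ∃ (x y : ℝ) (c : Bool), ∀ i ∈ A,
      (l1 i ≤ x ∧ x ≤ r1 i) ∨ (cat i = c ∧ l2 i ≤ y ∧ y ≤ r2 i) := by
  classical
  -- it is enough to find x such that the unhit sets pairwise meet on the second track
  suffices h : ∃ x : ℝ, ∀ a ∈ A, ∀ b ∈ A, ¬ (l1 a ≤ x ∧ x ≤ r1 a) → ¬ (l1 b ≤ x ∧ x ≤ r1 b) →
      (cat a = cat b ∧ Mt l2 r2 a b) by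
    obtain ⟨x, hx⟩ := h
    set U := A.filter (fun a => ¬ (l1 a ≤ x ∧ x ≤ r1 a)) with hU
    rcases U.eq_empty_or_nonempty with he | hne
    · refine ⟨x, 0, true, fun i hi => Or.inl ?_⟩
      by_contra hc
      have : i ∈ U := by simp only [hU, Finset.mem_filter]; exact ⟨hi, hc⟩
      rw [he] at this
      simp at this
    · obtain ⟨m, hm, hmax⟩ := Finset.exists_max_image U l2 hne
      have hm' := (Finset.mem_filter.1 hm)
      refine ⟨x, l2 m, cat m, fun i hi => ?_⟩
      by_cases hc : l1 i ≤ x ∧ x ≤ r1 i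
      · exact Or.inl hc
      · right
        have hiU : i ∈ U := by simp only [hU, Finset.mem_filter]; exact ⟨hi, hc⟩
        obtain ⟨e, e1, e2⟩ := hx i hi m hm'.1 hc hm'.2
        exact ⟨e, hmax i hiU, e2⟩
  set S : ι → ι → Prop := fun a b => cat a = cat b ∧ Mt l2 r2 a b with hS
  set B := (A ×ˢ A).filter (fun p => ¬ S p.1 p.2) with hB
  rcases B.eq_empty_or_nonempty with he | hne
  · refine ⟨0, fun a ha b hb _ _ => ?_⟩
    by_contra hc
    have : (a, b) ∈ B := by
      simp only [hB, Finset.mem_filter, Finset.mem_product]; exact ⟨⟨ha, hb⟩, hc⟩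
    rw [he] at this
    simp at this
  · obtain ⟨⟨i, j⟩, hm, hmin⟩ := Finset.exists_min_image B (fun p => max (r1 p.1) (r1 p.2)) hne
    simp only [hB, Finset.mem_filter, Finset.mem_product] at hm hmin
    obtain ⟨⟨hi, hj⟩, hnS⟩ := hm
    set x := max (r1 i) (r1 j) with hx
    have hix : r1 i ≤ x := le_max_left _ _
    have hjx : r1 j ≤ x := le_max_right _ _
    have hsep : ∀ a ∈ A, ∀ b ∈ A, r1 a ≤ x → x < l1 b → S a b := by
      intro a ha b hb h h'
      rcases H a ha b hb with h'' | h''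
      · exact absurd (h''.2) (by linarith)
      · exact h''
    have hSsymm : ∀ a b, S a b → S b a := fun a b h => ⟨h.1.symm, h.2.2, h.2.1⟩
    refine ⟨x, fun a ha b hb hax hbx => ?_⟩
    have ha' : r1 a < x ∨ x < l1 a := by
      by_contra hc; push Not at hc; exact hax ⟨hc.2, hc.1⟩
    have hb' : r1 b < x ∨ x < l1 b := by
      by_contra hc; push Not at hc; exact hbx ⟨hc.2, hc.1⟩
    rcases ha' with ha' | ha' <;> rcases hb' with hb' | hb'
    · by_contra hc
      have := hmin (a, b) ⟨⟨ha, hb⟩, hc⟩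
      exact absurd this (not_le.2 (max_lt ha' hb'))
    · exact hsep a ha b hb ha'.le hb'
    · exact hSsymm _ _ (hsep b hb a ha hb'.le ha')
    · obtain ⟨c1, d1, e1⟩ := hsep i hi a ha hix ha'
      obtain ⟨c2, d2, e2⟩ := hsep j hj a ha hjx ha'
      obtain ⟨c3, d3, e3⟩ := hsep i hi b hb hix hb'
      obtain ⟨c4, d4, e4⟩ := hsep j hj b hb hjx hb'
      have hij : ¬ Mt l2 r2 i j := fun h => hnS ⟨c1.trans c2.symm, h⟩
      refine ⟨c1.symm.trans c3, ?_⟩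
      unfold Mt at hij ⊢
      rw [not_and_or, not_le, not_le] at hij
      rcases hij with hij | hij <;> constructor <;> linarith

theorem sweep {ι : Type*} (Q : Finset ι → Prop) (r : ι → ℝ) (A : Finset ι)
    (hA : Q A) (h0 : ¬ Q ∅) :
    ∃ x : ℝ, Q (A.filter (fun i => r i ≤ x)) ∧ ¬ Q (A.filter (fun i => r i < x)) := by
  classical
  have hAne : A.Nonempty := by
    rcases A.eq_empty_or_nonempty with h | h
    · rw [h] at hA; exact absurd hA h0
    · exact h
  set B := A.filter (fun i => Q (A.filter (fun j => r j ≤ r i))) with hB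
  have hBne : B.Nonempty := by
    obtain ⟨m, hm, hmax⟩ := Finset.exists_max_image A r hAne
    refine ⟨m, ?_⟩
    simp only [hB, Finset.mem_filter]
    refine ⟨hm, ?_⟩
    rwa [Finset.filter_true_of_mem hmax]
  obtain ⟨m, hm, hmin⟩ := Finset.exists_min_image B r hBne
  have hm' := Finset.mem_filter.1 hm
  refine ⟨r m, hm'.2, fun hQ => ?_⟩
  rcases (A.filter (fun i => r i < r m)).eq_empty_or_nonempty with h | h
  · rw [h] at hQ; exact h0 hQ
  · obtain ⟨n, hn, hmax⟩ := Finset.exists_max_image _ r h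
    have hn' := Finset.mem_filter.1 hn
    have e : A.filter (fun i => r i < r m) = A.filter (fun i => r i ≤ r n) := by
      ext i
      simp only [Finset.mem_filter]
      constructor
      · intro hi
        exact ⟨hi.1, hmax i (Finset.mem_filter.2 hi)⟩
      · intro hi
        exact ⟨hi.1, lt_of_le_of_lt hi.2 hn'.2⟩
    rw [e] at hQ
    have := hmin n (Finset.mem_filter.2 ⟨hn'.1, hQ⟩)
    linarith [hn'.2]

theorem eleven {ι : Type*} [Fintype ι] (l1 r1 l2 r2 : ι → ℝ)
    (h1 : ∀ i, l1 i ≤ r1 i) (h2 : ∀ i, l2 i ≤ r2 i)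
    (H : ∀ i j k m : ι, i ≠ j → i ≠ k → i ≠ m → j ≠ k → j ≠ m → k ≠ m →
      ∃ a ∈ ({i, j, k, m} : Set ι), ∃ b ∈ ({i, j, k, m} : Set ι), a ≠ b ∧
        (Mt l1 r1 a b ∨ Mt l2 r2 a b)) :
    ∃ X Y : Finset ℝ, X.card + Y.card ≤ 11 ∧
      ∀ i, (∃ x ∈ X, l1 i ≤ x ∧ x ≤ r1 i) ∨ (∃ y ∈ Y, l2 i ≤ y ∧ y ≤ r2 i) := by
  classical
  set T : Finset ι → Prop := fun A => ∃ i ∈ A, ∃ j ∈ A, ¬ Mt l1 r1 i j ∧ ¬ Mt l2 r2 i j with hT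
  have hT0 : ¬ T ∅ := by simp [hT]
  have hTmono : ∀ A B : Finset ι, A ⊆ B → T A → T B := by
    rintro A B hAB ⟨i, hi, j, hj, h⟩
    exact ⟨i, hAB hi, j, hAB hj, h⟩
  have key1 : ∀ A : Finset ι, ¬ T A → ∃ x y : ℝ, ∀ i ∈ A,
      (l1 i ≤ x ∧ x ≤ r1 i) ∨ (l2 i ≤ y ∧ y ≤ r2 i) := by
    intro A hA
    obtain ⟨x, y, c, h⟩ := two_track A (fun _ => true) l1 r1 l2 r2 h1 h2 (by
      intro i hi j hj
      by_contra hc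
      rw [not_or, not_and] at hc
      exact hA ⟨i, hi, j, hj, hc.1, hc.2 rfl⟩)
    exact ⟨x, y, fun i hi => (h i hi).imp id (fun h => h.2)⟩
  set S : Finset ι → Prop := fun A => ∃ y : ℝ, T (A.filter (fun i => r2 i ≤ y)) ∧
    T (A.filter (fun i => y < l2 i)) with hS
  have hS0 : ¬ S ∅ := by simp [hS, hT]
  have key2 : ∀ A : Finset ι, ¬ S A → ∃ X Y : Finset ℝ, X.card ≤ 2 ∧ Y.card ≤ 3 ∧
      ∀ i ∈ A, (∃ x ∈ X, l1 i ≤ x ∧ x ≤ r1 i) ∨ (∃ y ∈ Y, l2 i ≤ y ∧ y ≤ r2 i) := by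
    intro A hA
    have : ∃ y, ¬ T (A.filter (fun i => r2 i < y)) ∧ ¬ T (A.filter (fun i => y < l2 i)) := by
      by_cases hTA : T A
      · obtain ⟨y, hy1, hy2⟩ := sweep T r2 A hTA hT0
        exact ⟨y, hy2, fun h => hA ⟨y, hy1, h⟩⟩
      · exact ⟨0, fun h => hTA (hTmono _ _ (Finset.filter_subset _ _) h),
          fun h => hTA (hTmono _ _ (Finset.filter_subset _ _) h)⟩
    obtain ⟨y, hy1, hy2⟩ := this
    obtain ⟨x', y', h'⟩ := key1 _ hy1
    obtain ⟨x'', y'', h''⟩ := key1 _ hy2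
    refine ⟨{x', x''}, {y, y', y''}, Finset.card_le_two, Finset.card_le_three, fun i hi => ?_⟩
    simp only [Finset.mem_insert, Finset.mem_singleton, exists_eq_or_imp, exists_eq_left]
    simp only [Finset.mem_filter] at h' h''
    rcases lt_or_ge (r2 i) y with h | h
    · have := h' i ⟨hi, h⟩
      tauto
    · rcases lt_or_ge y (l2 i) with g | g
      · have := h'' i ⟨hi, g⟩
        tauto
      · tauto
  have : ∃ x, ¬ S (Finset.univ.filter (fun i => r1 i < x)) ∧
      ¬ S (Finset.univ.filter (fun i => x < l1 i)) := by
    by_cases hSA : S Finset.univ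
    · obtain ⟨x, hx1, hx2⟩ := sweep S r1 _ hSA hS0
      refine ⟨x, hx2, ?_⟩
      rintro ⟨yR, ⟨a, ha, b, hb, hab⟩, ⟨c, hc, d, hd, hcd⟩⟩
      obtain ⟨yL, ⟨a', ha', b', hb', hab'⟩, ⟨c', hc', d', hd', hcd'⟩⟩ := hx1
      simp only [Finset.mem_filter, Finset.mem_univ, true_and] at ha hb hc hd ha' hb' hc' hd'
      have self1 : ∀ i, Mt l1 r1 i i := fun i => ⟨h1 i, h1 i⟩
      have ne : ∀ {i j : ι}, ¬ Mt l1 r1 i j → i ≠ j := by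
        rintro i j h rfl; exact h (self1 i)
      have fin : ∀ p q s t : ι, (¬ Mt l1 r1 p q ∧ ¬ Mt l2 r2 p q) →
          (¬ Mt l1 r1 s t ∧ ¬ Mt l2 r2 s t) → (r1 p ≤ x) → (r1 q ≤ x) →
          x < l1 s → x < l1 t →
          ((r2 p < l2 s ∧ r2 p < l2 t ∧ r2 q < l2 s ∧ r2 q < l2 t) ∨
           (r2 s < l2 p ∧ r2 t < l2 p ∧ r2 s < l2 q ∧ r2 t < l2 q)) → False := by
        intro p q s t hpq hst hp hq hs ht hh
        have n1 : ¬ Mt l1 r1 p s := fun h => by have := h.2; linarith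
        have n2 : ¬ Mt l1 r1 p t := fun h => by have := h.2; linarith
        have n3 : ¬ Mt l1 r1 q s := fun h => by have := h.2; linarith
        have n4 : ¬ Mt l1 r1 q t := fun h => by have := h.2; linarith
        have m1 : ¬ Mt l2 r2 p s := fun h => by
          have := h.2; have := h.1; rcases hh with hh | hh <;> linarith
        have m2 : ¬ Mt l2 r2 p t := fun h => by
          have := h.2; have := h.1; rcases hh with hh | hh <;> linarith
        have m3 : ¬ Mt l2 r2 q s := fun h => by
          have := h.2; have := h.1; rcases hh with hh | hh <;> linarith
        have m4 : ¬ Mt l2 r2 q t := fun h => by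
          have := h.2; have := h.1; rcases hh with hh | hh <;> linarith
        obtain ⟨u, hu, v, hv, huv, hM⟩ := H p q s t (ne hpq.1) (ne n1) (ne n2) (ne n3) (ne n4)
          (ne hst.1)
        have sy : ∀ (l r : ι → ℝ) i j, Mt l r i j → Mt l r j i := fun l r i j h => ⟨h.2, h.1⟩
        have s1 := sy l1 r1
        have s2 := sy l2 r2
        simp only [Set.mem_insert_iff, Set.mem_singleton_iff] at hu hv
        rcases hu with rfl | rfl | rfl | rfl <;> rcases hv with rfl | rfl | rfl | rfl <;>
          first
          | exact huv rfl
          | (rcases hM with hM | hM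
             · have := s1 _ _ hM; tauto
             · have := s2 _ _ hM; tauto)
      rcases le_total yL yR with hy | hy
      · exact fin a' b' c d hab' hcd ha'.1 hb'.1 hc.1 hd.1
          (Or.inl ⟨by linarith [ha'.2, hc.2], by linarith [ha'.2, hd.2],
            by linarith [hb'.2, hc.2], by linarith [hb'.2, hd.2]⟩)
      · exact fin c' d' a b hcd' hab hc'.1 hd'.1 ha.1 hb.1
          (Or.inr ⟨by linarith [hc'.2, ha.2], by linarith [hc'.2, hb.2],
            by linarith [hd'.2, ha.2], by linarith [hd'.2, hb.2]⟩)
    · have hmono : ∀ A : Finset ι, S A → S Finset.univ := by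
        rintro A ⟨y, a, b⟩
        exact ⟨y, hTmono _ _ (Finset.filter_subset_filter _ (Finset.subset_univ _)) a,
          hTmono _ _ (Finset.filter_subset_filter _ (Finset.subset_univ _)) b⟩
      exact ⟨0, fun h => hSA (hmono _ h), fun h => hSA (hmono _ h)⟩
  obtain ⟨x, hx1, hx2⟩ := this
  obtain ⟨X', Y', cX', cY', h'⟩ := key2 _ hx1
  obtain ⟨X'', Y'', cX'', cY'', h''⟩ := key2 _ hx2
  refine ⟨insert x (X' ∪ X''), Y' ∪ Y'', ?_, fun i => ?_⟩
  · have a1 := Finset.card_insert_le x (X' ∪ X'')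
    have a2 := Finset.card_union_le X' X''
    have a3 := Finset.card_union_le Y' Y''
    omega
  · simp only [Finset.mem_filter, Finset.mem_univ, true_and] at h' h''
    rcases lt_or_ge (r1 i) x with h | h
    · rcases h' i h with ⟨z, hz, hz'⟩ | ⟨z, hz, hz'⟩
      · exact Or.inl ⟨z, by simp [hz], hz'⟩
      · exact Or.inr ⟨z, by simp [hz], hz'⟩
    · rcases lt_or_ge x (l1 i) with g | g
      · rcases h'' i g with ⟨z, hz, hz'⟩ | ⟨z, hz, hz'⟩
        · exact Or.inl ⟨z, by simp [hz], hz'⟩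
        · exact Or.inr ⟨z, by simp [hz], hz'⟩
      · exact Or.inl ⟨x, by simp, g, h⟩


/-! ### Part 2: a cubical Sperner lemma -/

def rr3 (a b c d : Fin 4) : ZMod 2 :=
  if a ≠ b ∧ a ≠ c ∧ a ≠ d ∧ b ≠ c ∧ b ≠ d ∧ c ≠ d then 1 else 0
def rr2 (a b c : Fin 4) : ZMod 2 :=
  if a ≠ b ∧ a ≠ c ∧ b ≠ c ∧ a ≠ 3 ∧ b ≠ 3 ∧ c ≠ 3 then 1 else 0
def rr1 (a b : Fin 4) : ZMod 2 :=
  if (a = 0 ∧ b = 1) ∨ (a = 1 ∧ b = 0) then 1 else 0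
def rr0 (a : Fin 4) : ZMod 2 := if a = 0 then 1 else 0

theorem rr3_eq : ∀ a b c d : Fin 4,
    rr3 a b c d = rr2 b c d + rr2 a c d + rr2 a b d + rr2 a b c := by decide
theorem rr2_eq : ∀ a b c : Fin 4, a ≠ 3 → b ≠ 3 → c ≠ 3 →
    rr2 a b c = rr1 b c + rr1 a c + rr1 a b := by decide
theorem rr1_eq : ∀ a b : Fin 4, a ≠ 2 → a ≠ 3 → b ≠ 2 → b ≠ 3 →
    rr1 a b = rr0 b + rr0 a := by decide
theorem rr2_zero0 : ∀ a b c : Fin 4, a ≠ 0 → b ≠ 0 → c ≠ 0 → rr2 a b c = 0 := by decide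
theorem rr2_zero1 : ∀ a b c : Fin 4, a ≠ 1 → b ≠ 1 → c ≠ 1 → rr2 a b c = 0 := by decide
theorem rr2_zero2 : ∀ a b c : Fin 4, a ≠ 2 → b ≠ 2 → c ≠ 2 → rr2 a b c = 0 := by decide
theorem rr1_zero0 : ∀ a b : Fin 4, a ≠ 0 → b ≠ 0 → rr1 a b = 0 := by decide
theorem rr1_zero1 : ∀ a b : Fin 4, a ≠ 1 → b ≠ 1 → rr1 a b = 0 := by decide
theorem rr3_ne : ∀ a b c d : Fin 4, rr3 a b c d ≠ 0 →
    ∀ l : Fin 4, a = l ∨ b = l ∨ c = l ∨ d = l := by decide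

theorem tel (N : ℕ) (f : ℕ → ZMod 2) :
    ∑ i ∈ Finset.range N, (f (i + 1) + f i) = f N + f 0 := by
  have h2 : ∀ x : ZMod 2, x + x = 0 := by decide
  induction N with
  | zero => simp [h2]
  | succ n ih => rw [Finset.sum_range_succ, ih]; linear_combination h2 (f n)

def sqX (L : ℕ → ℕ → ℕ → Fin 4) (i j k : ℕ) : ZMod 2 :=
  rr2 (L i j k) (L i (j+1) k) (L i (j+1) (k+1)) + rr2 (L i j k) (L i j (k+1)) (L i (j+1) (k+1))
def sqY (L : ℕ → ℕ → ℕ → Fin 4) (i j k : ℕ) : ZMod 2 :=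
  rr2 (L i j k) (L (i+1) j k) (L (i+1) j (k+1)) + rr2 (L i j k) (L i j (k+1)) (L (i+1) j (k+1))
def sqZ (L : ℕ → ℕ → ℕ → Fin 4) (i j k : ℕ) : ZMod 2 :=
  rr2 (L i j k) (L (i+1) j k) (L (i+1) (j+1) k) + rr2 (L i j k) (L i (j+1) k) (L (i+1) (j+1) k)

def cubeS (L : ℕ → ℕ → ℕ → Fin 4) (i j k : ℕ) : ZMod 2 :=
  rr3 (L i j k) (L (i+1) j k) (L (i+1) (j+1) k) (L (i+1) (j+1) (k+1)) +
  rr3 (L i j k) (L (i+1) j k) (L (i+1) j (k+1)) (L (i+1) (j+1) (k+1)) +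
  rr3 (L i j k) (L i (j+1) k) (L (i+1) (j+1) k) (L (i+1) (j+1) (k+1)) +
  rr3 (L i j k) (L i (j+1) k) (L i (j+1) (k+1)) (L (i+1) (j+1) (k+1)) +
  rr3 (L i j k) (L i j (k+1)) (L (i+1) j (k+1)) (L (i+1) (j+1) (k+1)) +
  rr3 (L i j k) (L i j (k+1)) (L i (j+1) (k+1)) (L (i+1) (j+1) (k+1))

theorem cubeS_eq (L : ℕ → ℕ → ℕ → Fin 4) (i j k : ℕ) :
    cubeS L i j k = (sqX L (i+1) j k + sqX L i j k) + (sqY L i (j+1) k + sqY L i j k) +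
      (sqZ L i j (k+1) + sqZ L i j k) := by
  have h2 : ∀ x : ZMod 2, x + x = 0 := by decide
  unfold cubeS sqX sqY sqZ
  simp only [rr3_eq]
  linear_combination h2 (rr2 (L i j k) (L (i+1) j k) (L (i+1) (j+1) (k+1))) +
    h2 (rr2 (L i j k) (L i (j+1) k) (L (i+1) (j+1) (k+1))) +
    h2 (rr2 (L i j k) (L i j (k+1)) (L (i+1) (j+1) (k+1))) +
    h2 (rr2 (L i j k) (L (i+1) (j+1) k) (L (i+1) (j+1) (k+1))) +
    h2 (rr2 (L i j k) (L (i+1) j (k+1)) (L (i+1) (j+1) (k+1))) +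
    h2 (rr2 (L i j k) (L i (j+1) (k+1)) (L (i+1) (j+1) (k+1)))

theorem sperner (N : ℕ) (L : ℕ → ℕ → ℕ → Fin 4)
    (hu0 : ∀ j ≤ N, ∀ k ≤ N, L 0 j k ≠ 0 ∧ L 0 j k ≠ 1)
    (hu1 : ∀ j ≤ N, ∀ k ≤ N, L N j k ≠ 2 ∧ L N j k ≠ 3)
    (hv0 : ∀ i ≤ N, ∀ k ≤ N, L i 0 k ≠ 0)
    (hv1 : ∀ i ≤ N, ∀ k ≤ N, L i N k ≠ 1)
    (hw0 : ∀ i ≤ N, ∀ j ≤ N, L i j 0 ≠ 2)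
    (hw1 : ∀ i ≤ N, ∀ j ≤ N, L i j N ≠ 3) :
    ∃ i j k, i < N ∧ j < N ∧ k < N ∧ ∀ l : Fin 4, ∃ a b c : ℕ,
      (a = i ∨ a = i + 1) ∧ (b = j ∨ b = j + 1) ∧ (c = k ∨ c = k + 1) ∧ L a b c = l := by
  have h2 : ∀ x : ZMod 2, x + x = 0 := by decide
  by_contra hcon
  have hz : ∀ i < N, ∀ j < N, ∀ k < N, cubeS L i j k = 0 := by
    intro i hi j hj k hk
    by_contra hne
    apply hcon
    refine ⟨i, j, k, hi, hj, hk, fun l => ?_⟩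
    have : ∃ p q r s t u : ℕ, (p = i ∨ p = i + 1) ∧ (q = j ∨ q = j + 1) ∧ (r = k ∨ r = k + 1) ∧
       (s = i ∨ s = i + 1) ∧ (t = j ∨ t = j + 1) ∧ (u = k ∨ u = k + 1) ∧
       rr3 (L i j k) (L p q r) (L s t u) (L (i+1) (j+1) (k+1)) ≠ 0 := by
      by_contra hc
      push Not at hc
      apply hne
      unfold cubeS
      rw [hc, hc, hc, hc, hc, hc] <;> simp
    obtain ⟨p, q, r, s, t, u, hp, hq, hr, hs, ht, hu, h⟩ := this
    rcases rr3_ne _ _ _ _ h l with h | h | h | h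
    · exact ⟨i, j, k, by simp, by simp, by simp, h⟩
    · exact ⟨p, q, r, hp, hq, hr, h⟩
    · exact ⟨s, t, u, hs, ht, hu, h⟩
    · exact ⟨i+1, j+1, k+1, by simp, by simp, by simp, h⟩
  have hsum : ∑ i ∈ Finset.range N, ∑ j ∈ Finset.range N, ∑ k ∈ Finset.range N,
      cubeS L i j k = 0 := by
    refine Finset.sum_eq_zero fun i hi => Finset.sum_eq_zero fun j hj =>
      Finset.sum_eq_zero fun k hk => ?_
    exact hz i (Finset.mem_range.1 hi) j (Finset.mem_range.1 hj) k (Finset.mem_range.1 hk)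
  simp only [cubeS_eq] at hsum
  have eX : ∑ i ∈ Finset.range N, ∑ j ∈ Finset.range N, ∑ k ∈ Finset.range N,
      (sqX L (i+1) j k + sqX L i j k) = 0 := by
    rw [Finset.sum_comm]
    refine Finset.sum_eq_zero fun j hj => ?_
    rw [Finset.sum_comm]
    refine Finset.sum_eq_zero fun k hk => ?_
    rw [tel N (fun i => sqX L i j k)]
    have hj := Finset.mem_range.1 hj
    have hk := Finset.mem_range.1 hk
    unfold sqX
    rw [rr2_zero2, rr2_zero2, rr2_zero0, rr2_zero0]
    · simp
    all_goals first
      | exact (hu0 _ (by omega) _ (by omega)).1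
      | exact (hu1 _ (by omega) _ (by omega)).1
  have eY : ∑ i ∈ Finset.range N, ∑ j ∈ Finset.range N, ∑ k ∈ Finset.range N,
      (sqY L i (j+1) k + sqY L i j k) = 0 := by
    refine Finset.sum_eq_zero fun i hi => ?_
    rw [Finset.sum_comm]
    refine Finset.sum_eq_zero fun k hk => ?_
    rw [tel N (fun j => sqY L i j k)]
    have hi := Finset.mem_range.1 hi
    have hk := Finset.mem_range.1 hk
    unfold sqY
    rw [rr2_zero1, rr2_zero1, rr2_zero0, rr2_zero0]
    · simp
    all_goals first
      | exact (hv0 _ (by omega) _ (by omega))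
      | exact (hv1 _ (by omega) _ (by omega))
  have eZ : ∑ i ∈ Finset.range N, ∑ j ∈ Finset.range N, ∑ k ∈ Finset.range N,
      (sqZ L i j (k+1) + sqZ L i j k) = 1 := by
    have e1 : ∀ i ∈ Finset.range N, ∀ j ∈ Finset.range N,
        ∑ k ∈ Finset.range N, (sqZ L i j (k+1) + sqZ L i j k) =
        (rr1 (L i (j+1) N) (L (i+1) (j+1) N) + rr1 (L i j N) (L (i+1) j N)) +
        (rr1 (L (i+1) j N) (L (i+1) (j+1) N) + rr1 (L i j N) (L i (j+1) N)) := by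
      intro i hi j hj
      have hi := Finset.mem_range.1 hi
      have hj := Finset.mem_range.1 hj
      rw [tel N (fun k => sqZ L i j k)]
      unfold sqZ
      have z1 : rr2 (L i j 0) (L (i+1) j 0) (L (i+1) (j+1) 0) = 0 :=
        rr2_zero2 _ _ _ (hw0 _ (by omega) _ (by omega)) (hw0 _ (by omega) _ (by omega))
          (hw0 _ (by omega) _ (by omega))
      have z2 : rr2 (L i j 0) (L i (j+1) 0) (L (i+1) (j+1) 0) = 0 :=
        rr2_zero2 _ _ _ (hw0 _ (by omega) _ (by omega)) (hw0 _ (by omega) _ (by omega))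
          (hw0 _ (by omega) _ (by omega))
      rw [z1, z2, rr2_eq _ _ _ (hw1 _ (by omega) _ (by omega)) (hw1 _ (by omega) _ (by omega))
          (hw1 _ (by omega) _ (by omega)),
          rr2_eq _ _ _ (hw1 _ (by omega) _ (by omega)) (hw1 _ (by omega) _ (by omega))
          (hw1 _ (by omega) _ (by omega))]
      linear_combination h2 (rr1 (L i j N) (L (i+1) (j+1) N))
    rw [Finset.sum_congr rfl (fun i hi => Finset.sum_congr rfl (e1 i hi))]
    have e2 : ∑ i ∈ Finset.range N, ∑ j ∈ Finset.range N,
        (rr1 (L i (j+1) N) (L (i+1) (j+1) N) + rr1 (L i j N) (L (i+1) j N)) = 0 := by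
      refine Finset.sum_eq_zero fun i hi => ?_
      rw [tel N (fun j => rr1 (L i j N) (L (i+1) j N))]
      have hi := Finset.mem_range.1 hi
      rw [rr1_zero1 _ _ (hv1 _ (by omega) _ le_rfl) (hv1 _ (by omega) _ le_rfl),
        rr1_zero0 _ _ (hv0 _ (by omega) _ le_rfl) (hv0 _ (by omega) _ le_rfl)]
      simp
    have e3 : ∑ i ∈ Finset.range N, ∑ j ∈ Finset.range N,
        (rr1 (L (i+1) j N) (L (i+1) (j+1) N) + rr1 (L i j N) (L i (j+1) N)) = 1 := by
      rw [Finset.sum_comm]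
      have e4 : ∀ j ∈ Finset.range N, ∑ i ∈ Finset.range N,
        (rr1 (L (i+1) j N) (L (i+1) (j+1) N) + rr1 (L i j N) (L i (j+1) N)) =
        rr0 (L N (j+1) N) + rr0 (L N j N) := by
        intro j hj
        have hj := Finset.mem_range.1 hj
        rw [tel N (fun i => rr1 (L i j N) (L i (j+1) N))]
        rw [rr1_zero0 _ _ (hu0 _ (by omega) _ le_rfl).1 (hu0 _ (by omega) _ le_rfl).1,
          rr1_eq _ _ (hu1 _ (by omega) _ le_rfl).1 (hu1 _ (by omega) _ le_rfl).2
          (hu1 _ (by omega) _ le_rfl).1 (hu1 _ (by omega) _ le_rfl).2]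
        simp
      rw [Finset.sum_congr rfl e4, tel N (fun j => rr0 (L N j N))]
      have a1 : L N 0 N ≠ 0 := hv0 _ le_rfl _ le_rfl
      have a2 : L N N N = 0 := by
        have b1 := hv1 N le_rfl N le_rfl
        have b2 := hu1 N le_rfl N le_rfl
        generalize L N N N = z at *
        revert z; decide
      simp [rr0, a1, a2]
    simp only [Finset.sum_add_distrib] at e2 e3 ⊢
    linear_combination e2 + e3
  simp only [Finset.sum_add_distrib] at hsum eX eY eZ
  have hfin : (0 : ZMod 2) = 1 := by linear_combination -hsum + eX + eY + eZ
  revert hfin; decide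

/-- KKM-type theorem on the cube. -/
theorem kkm_cube (P : Fin 4 → ℝ × ℝ × ℝ → Prop) (Z : Fin 4 → Set (ℝ × ℝ × ℝ))
    (hZ : ∀ l, IsClosed (Z l)) (hPZ : ∀ l p, P l p → p ∈ Z l)
    (hcov : ∀ u v w : ℝ, 0 ≤ u → u ≤ 1 → 0 ≤ v → v ≤ 1 → 0 ≤ w → w ≤ 1 → ∃ l, P l (u, v, w))
    (hu0 : ∀ v w : ℝ, 0 ≤ v → v ≤ 1 → 0 ≤ w → w ≤ 1 → ¬ P 0 (0, v, w) ∧ ¬ P 1 (0, v, w))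
    (hu1 : ∀ v w : ℝ, 0 ≤ v → v ≤ 1 → 0 ≤ w → w ≤ 1 → ¬ P 2 (1, v, w) ∧ ¬ P 3 (1, v, w))
    (hv0 : ∀ u w : ℝ, 0 ≤ u → u ≤ 1 → 0 ≤ w → w ≤ 1 → ¬ P 0 (u, 0, w))
    (hv1 : ∀ u w : ℝ, 0 ≤ u → u ≤ 1 → 0 ≤ w → w ≤ 1 → ¬ P 1 (u, 1, w))
    (hw0 : ∀ u v : ℝ, 0 ≤ u → u ≤ 1 → 0 ≤ v → v ≤ 1 → ¬ P 2 (u, v, 0))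
    (hw1 : ∀ u v : ℝ, 0 ≤ u → u ≤ 1 → 0 ≤ v → v ≤ 1 → ¬ P 3 (u, v, 1)) :
    ∃ u v w : ℝ, (0 ≤ u ∧ u ≤ 1) ∧ (0 ≤ v ∧ v ≤ 1) ∧ (0 ≤ w ∧ w ≤ 1) ∧
      ∀ l, (u, v, w) ∈ Z l := by
  classical
  have hcov' : ∀ p : ℝ × ℝ × ℝ, ∃ l, (0 ≤ p.1 → p.1 ≤ 1 → 0 ≤ p.2.1 → p.2.1 ≤ 1 →
      0 ≤ p.2.2 → p.2.2 ≤ 1 → P l p) := by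
    rintro ⟨u, v, w⟩
    by_cases h : 0 ≤ u ∧ u ≤ 1 ∧ 0 ≤ v ∧ v ≤ 1 ∧ 0 ≤ w ∧ w ≤ 1
    · obtain ⟨l, hl⟩ := hcov u v w h.1 h.2.1 h.2.2.1 h.2.2.2.1 h.2.2.2.2.1 h.2.2.2.2.2
      exact ⟨l, fun _ _ _ _ _ _ => hl⟩
    · exact ⟨0, fun a b c d e f => absurd ⟨a, b, c, d, e, f⟩ h⟩
  choose lab hlab using hcov'
  -- for each n a small cell
  have step : ∀ n : ℕ, ∃ p : ℝ × ℝ × ℝ, p ∈ Set.Icc ((0 : ℝ), (0 : ℝ), (0 : ℝ)) (1, 1, 1) ∧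
      ∀ l, ∃ q ∈ Z l, dist q p ≤ 1 / ((n : ℝ) + 1) := by
    intro n
    set N := n + 1 with hN
    have hNpos : (0 : ℝ) < (N : ℝ) := by positivity
    set pt : ℕ → ℕ → ℕ → ℝ × ℝ × ℝ := fun i j k => ((i : ℝ) / N, (j : ℝ) / N, (k : ℝ) / N) with hpt
    have h0 : ∀ i : ℕ, 0 ≤ (i : ℝ) / N := fun i => by positivity
    have h1 : ∀ i : ℕ, i ≤ N → (i : ℝ) / N ≤ 1 := fun i hi => by
      rw [div_le_one hNpos]; exact_mod_cast hi
    have hP : ∀ i j k, i ≤ N → j ≤ N → k ≤ N → P (lab (pt i j k)) (pt i j k) :=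
      fun i j k hi hj hk => hlab _ (h0 _) (h1 _ hi) (h0 _) (h1 _ hj) (h0 _) (h1 _ hk)
    have z0 : ((0 : ℕ) : ℝ) / N = 0 := by simp
    have z1 : ((N : ℕ) : ℝ) / N = 1 := by field_simp
    obtain ⟨i, j, k, hi, hj, hk, h⟩ := sperner N (fun i j k => lab (pt i j k))
      (fun j hj k hk => by
        have := hP 0 j k (by omega) hj hk
        have h' := hu0 _ _ (h0 j) (h1 j hj) (h0 k) (h1 k hk)
        rw [← z0] at h'
        exact ⟨fun e => h'.1 (e ▸ this), fun e => h'.2 (e ▸ this)⟩)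
      (fun j hj k hk => by
        have := hP N j k (by omega) hj hk
        have h' := hu1 _ _ (h0 j) (h1 j hj) (h0 k) (h1 k hk)
        rw [← z1] at h'
        exact ⟨fun e => h'.1 (e ▸ this), fun e => h'.2 (e ▸ this)⟩)
      (fun j hj k hk => by
        have := hP j 0 k hj (by omega) hk
        have h' := hv0 _ _ (h0 j) (h1 j hj) (h0 k) (h1 k hk)
        rw [← z0] at h'
        exact fun e => h' (e ▸ this))
      (fun j hj k hk => by
        have := hP j N k hj (by omega) hk
        have h' := hv1 _ _ (h0 j) (h1 j hj) (h0 k) (h1 k hk)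
        rw [← z1] at h'
        exact fun e => h' (e ▸ this))
      (fun j hj k hk => by
        have := hP j k 0 hj hk (by omega)
        have h' := hw0 _ _ (h0 j) (h1 j hj) (h0 k) (h1 k hk)
        rw [← z0] at h'
        exact fun e => h' (e ▸ this))
      (fun j hj k hk => by
        have := hP j k N hj hk (by omega)
        have h' := hw1 _ _ (h0 j) (h1 j hj) (h0 k) (h1 k hk)
        rw [← z1] at h'
        exact fun e => h' (e ▸ this))
    refine ⟨pt i j k, ⟨⟨h0 _, h0 _, h0 _⟩, ⟨h1 _ hi.le, h1 _ hj.le, h1 _ hk.le⟩⟩, fun l => ?_⟩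
    obtain ⟨a, b, c, ha, hb, hc, e⟩ := h l
    refine ⟨pt a b c, hPZ l _ ?_, ?_⟩
    · rw [← e]; exact hP a b c (by omega) (by omega) (by omega)
    · have d : ∀ a i : ℕ, (a = i ∨ a = i + 1) → dist ((a : ℝ) / N) ((i : ℝ) / N) ≤ 1 / ((n : ℝ) + 1) := by
        intro a i h
        have hN' : (N : ℝ) = (n : ℝ) + 1 := by rw [hN]; push_cast; ring
        rw [Real.dist_eq, ← sub_div, abs_div, abs_of_pos hNpos, hN']
        gcongr
        rcases h with rfl | rfl <;> simp
      simp only [hpt, Prod.dist_eq]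
      exact max_le (d _ _ ha) (max_le (d _ _ hb) (d _ _ hc))
  choose p hp hq using step
  obtain ⟨x, hx, φ, hφ, hlim⟩ := (isCompact_Icc (a := ((0 : ℝ), (0 : ℝ), (0 : ℝ)))
    (b := (1, 1, 1))).tendsto_subseq hp
  refine ⟨x.1, x.2.1, x.2.2, ⟨hx.1.1, hx.2.1⟩, ⟨hx.1.2.1, hx.2.2.1⟩, ⟨hx.1.2.2, hx.2.2.2⟩,
    fun l => ?_⟩
  choose q hqZ hqd using fun n => hq n l
  have hto : Filter.Tendsto (fun n => q (φ n)) Filter.atTop (nhds x) := by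
    rw [tendsto_iff_dist_tendsto_zero] at hlim ⊢
    have h0 : Filter.Tendsto (fun n : ℕ => 1 / ((φ n : ℝ) + 1) + dist ((p ∘ φ) n) x)
        Filter.atTop (nhds (0 + 0)) :=
      (tendsto_one_div_add_atTop_nhds_zero_nat.comp hφ.tendsto_atTop).add hlim
    rw [add_zero] at h0
    refine squeeze_zero (fun _ => dist_nonneg) (fun n => ?_) h0
    exact (dist_triangle _ (p (φ n)) _).trans (add_le_add (hqd _) le_rfl)
  exact (hZ l).mem_of_tendsto hto (Filter.Eventually.of_forall fun n => hqZ _)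


/-- The plane. -/
abbrev Pl := Fin 2 → ℝ

/-- Affine functions on the plane. -/
def Aff (f : Pl → ℝ) : Prop := ∃ a b c : ℝ, ∀ q, f q = a + b * q 0 + c * q 1

theorem Aff.cont {f : Pl → ℝ} (h : Aff f) : Continuous f := by
  obtain ⟨a, b, c, h⟩ := h
  have : f = fun q => a + b * q 0 + c * q 1 := funext h
  rw [this]; fun_prop

theorem Aff.comb {f : Pl → ℝ} (h : Aff f) (x y : Pl) (s t : ℝ) (hst : s + t = 1) :
    f (s • x + t • y) = s * f x + t * f y := by
  obtain ⟨a, b, c, h⟩ := h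
  simp only [h, Pi.add_apply, Pi.smul_apply, smul_eq_mul]
  linear_combination (-a) * hst

theorem Aff.lin {f g : Pl → ℝ} (hf : Aff f) (hg : Aff g) (u v w : ℝ) :
    Aff (fun q => u + v * f q + w * g q) := by
  obtain ⟨a, b, c, h⟩ := hf
  obtain ⟨a', b', c', h'⟩ := hg
  exact ⟨u + v * a + w * a', v * b + w * b', v * c + w * c', fun q => by
    simp only [h, h']; ring⟩

/-- intermediate value on a segment -/
theorem Aff.ivt {f : Pl → ℝ} (hf : Aff f) {x y : Pl} {κ : ℝ} (h1 : f x ≤ κ) (h2 : κ ≤ f y) :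
    ∃ s t : ℝ, 0 ≤ s ∧ 0 ≤ t ∧ s + t = 1 ∧ f (s • x + t • y) = κ := by
  rcases eq_or_lt_of_le (h1.trans h2) with h | h
  · refine ⟨1, 0, by norm_num, le_rfl, by norm_num, ?_⟩
    rw [hf.comb _ _ _ _ (by norm_num)]; linarith
  · have hd : 0 < f y - f x := by linarith
    have hst : (f y - κ) / (f y - f x) + (κ - f x) / (f y - f x) = 1 := by field_simp; ring
    refine ⟨(f y - κ) / (f y - f x), (κ - f x) / (f y - f x), div_nonneg (by linarith) hd.le,
      div_nonneg (by linarith) hd.le, hst, ?_⟩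
    rw [hf.comb _ _ _ _ hst]; field_simp; ring

theorem Aff.ivt_mem {f : Pl → ℝ} (hf : Aff f) {H : Set Pl} (hH : Convex ℝ H)
    {x y : Pl} {κ : ℝ} (hx : x ∈ H) (hy : y ∈ H) (h1 : f x ≤ κ) (h2 : κ ≤ f y) :
    ∃ w ∈ H, f w = κ := by
  obtain ⟨s, t, hs, ht, hst, h⟩ := hf.ivt h1 h2
  exact ⟨_, hH hx hy hs ht hst, h⟩

theorem track {ι : Type*} [Fintype ι] (F : ι → Set Pl) (hne : ∀ i, (F i).Nonempty)
    (hc : ∀ i, IsCompact (F i)) (hv : ∀ i, Convex ℝ (F i)) (f g : Pl → ℝ) (hf : Aff f)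
    (hg : Aff g) (hinj : ∀ p q, f p = 0 → f q = 0 → g p = g q → p = q) :
    ∃ l r : ι → ℝ, ∃ φ : ℝ → Pl, (∀ i, l i ≤ r i) ∧
      (∀ i x, l i ≤ x → x ≤ r i → φ x ∈ F i) ∧
      (∀ i j, (∃ p ∈ F i, p ∈ F j ∧ f p = 0) → Mt l r i j) := by
  classical
  have hB : ∃ B : ℝ, ∀ i, ∀ p ∈ F i, B ≤ g p := by
    have h1 : ∀ i, ∃ b : ℝ, ∀ p ∈ F i, b ≤ g p := by
      intro i
      obtain ⟨x, -, hx⟩ := (hc i).exists_isMinOn (hne i) hg.cont.continuousOn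
      exact ⟨g x, fun p hp => hx hp⟩
    choose b hb using h1
    obtain ⟨B, hB⟩ := (Set.finite_range b).bddBelow
    exact ⟨B, fun i p hp => (hB ⟨i, rfl⟩).trans (hb i p hp)⟩
  obtain ⟨B, hB⟩ := hB
  let e := Fintype.equivFin ι
  let pr : ι → ℝ := fun i => B - 1 - ((e i : ℕ) : ℝ)
  have hpr : ∀ i, pr i < B := fun i => by
    have : (0 : ℝ) ≤ ((e i : ℕ) : ℝ) := Nat.cast_nonneg _
    simp only [pr]; linarith
  have hpi : ∀ i j, pr i = pr j → i = j := fun i j h => by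
    simp only [pr] at h
    have : ((e i : ℕ) : ℝ) = ((e j : ℕ) : ℝ) := by linarith
    exact e.injective (Fin.ext (by exact_mod_cast this))
  have hex : ∀ i, ∃ l r : ℝ, ((F i ∩ {p | f p = 0}).Nonempty →
      (∃ p ∈ F i, f p = 0 ∧ g p = l) ∧ (∃ p ∈ F i, f p = 0 ∧ g p = r) ∧
      ∀ p ∈ F i, f p = 0 → l ≤ g p ∧ g p ≤ r) ∧
      (¬ (F i ∩ {p | f p = 0}).Nonempty → l = pr i ∧ r = pr i) := by
    intro i
    by_cases h : (F i ∩ {p | f p = 0}).Nonempty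
    · have hcc : IsCompact (F i ∩ {p | f p = 0}) :=
        (hc i).inter_right (isClosed_eq hf.cont continuous_const)
      obtain ⟨x, hx, hx'⟩ := hcc.exists_isMinOn h hg.cont.continuousOn
      obtain ⟨y, hy, hy'⟩ := hcc.exists_isMaxOn h hg.cont.continuousOn
      exact ⟨g x, g y, fun _ => ⟨⟨x, hx.1, hx.2, rfl⟩, ⟨y, hy.1, hy.2, rfl⟩,
        fun p hp hp0 => ⟨hx' ⟨hp, hp0⟩, hy' ⟨hp, hp0⟩⟩⟩, fun h' => absurd h h'⟩
    · exact ⟨pr i, pr i, fun h' => absurd h' h, fun _ => ⟨rfl, rfl⟩⟩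
  choose l r h1 h2 using hex
  refine ⟨l, r, fun x => if h : ∃ i, pr i = x then (hne h.choose).some else
    if h : ∃ p, f p = 0 ∧ g p = x then h.choose else 0, ?_, ?_, ?_⟩
  · intro i
    by_cases h : (F i ∩ {p | f p = 0}).Nonempty
    · obtain ⟨p, hp, hp0⟩ := h
      have := (h1 i ⟨p, hp, hp0⟩).2.2 p hp hp0
      linarith
    · rw [(h2 i h).1, (h2 i h).2]
  · intro i x hx1 hx2
    by_cases h : (F i ∩ {p | f p = 0}).Nonempty
    · obtain ⟨⟨p, hp, hp0, hpl⟩, ⟨q, hq, hq0, hqr⟩, -⟩ := h1 i h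
      have hn : ¬ ∃ i, pr i = x := by
        rintro ⟨j, hj⟩
        have := hpr j
        have := hB i p hp
        linarith
      obtain ⟨s, t, hs, ht, hst, hw⟩ := hg.ivt (x := p) (y := q) (κ := x)
        (by linarith) (by linarith)
      have hw0 : f (s • p + t • q) = 0 := by rw [hf.comb _ _ _ _ hst, hp0, hq0]; ring
      have hE : ∃ p, f p = 0 ∧ g p = x := ⟨_, hw0, hw⟩
      simp only [hn, dite_false, hE, dite_true]
      have := hinj _ _ hE.choose_spec.1 hw0 (hE.choose_spec.2.trans hw.symm)
      rw [this]
      exact hv i hp hq hs ht hst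
    · obtain ⟨e1, e2⟩ := h2 i h
      have hE : ∃ j, pr j = x := ⟨i, by linarith⟩
      simp only [hE, dite_true]
      have : hE.choose = i := hpi _ _ (by rw [hE.choose_spec]; linarith)
      have h3 : ∀ k, k = i → (hne k).some ∈ F i := by
        rintro k rfl; exact (hne k).some_mem
      exact h3 _ this
  · rintro i j ⟨p, hp, hq, h0⟩
    have := (h1 i ⟨p, hp, h0⟩).2.2 p hp h0
    have := (h1 j ⟨p, hq, h0⟩).2.2 p hq h0
    constructor <;> linarith


/-- `κ` separates two sets of reals -/
def SepBy (κ : ℝ) (S T : Set ℝ) : Prop :=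
  ((∀ s ∈ S, s ≤ κ) ∧ (∀ t ∈ T, κ ≤ t)) ∨ ((∀ t ∈ T, t ≤ κ) ∧ (∀ s ∈ S, κ ≤ s))

/-- one of the sets is to the left of the other -/
def CmpSets (S T : Set ℝ) : Prop := (∀ s ∈ S, ∀ t ∈ T, s < t) ∨ (∀ s ∈ S, ∀ t ∈ T, t < s)

theorem cut_of_lt {S T : Set ℝ} (hS : S.Finite) (hT : T.Finite)
    (h : ∀ s ∈ S, ∀ t ∈ T, s < t) : ∃ κ, (∀ s ∈ S, s ≤ κ) ∧ (∀ t ∈ T, κ ≤ t) := by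
  rcases S.eq_empty_or_nonempty with he | hne
  · obtain ⟨b, hb⟩ := hT.bddBelow
    exact ⟨b, by simp [he], fun t ht => hb ht⟩
  · obtain ⟨m, hm, hmax⟩ := Set.exists_max_image S id hS hne
    exact ⟨m, fun s hs => hmax s hs, fun t ht => (h m hm t ht).le⟩

theorem cut_of_cmp {S T : Set ℝ} (hS : S.Finite) (hT : T.Finite) (h : CmpSets S T) :
    ∃ κ, SepBy κ S T := by
  rcases h with h | h
  · obtain ⟨κ, h1, h2⟩ := cut_of_lt hS hT h
    exact ⟨κ, Or.inl ⟨h1, h2⟩⟩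
  · obtain ⟨κ, h1, h2⟩ := cut_of_lt hT hS (fun t ht s hs => h s hs t ht)
    exact ⟨κ, Or.inr ⟨h1, h2⟩⟩

theorem cuts_aux {Y Z : Set ℝ} {S : Bool → Set ℝ} (hY : Y.Finite) (hZ : Z.Finite)
    (hS : ∀ c, (S c).Finite) (hYZ : ∀ s ∈ Y, ∀ t ∈ Z, s < t) (hSY : ∀ c, CmpSets (S c) Y)
    (hSZ : ∀ c, CmpSets (S c) Z) :
    ∃ κ : ℝ, ∃ κ' : Bool → ℝ, SepBy κ Y Z ∧ ∀ c, (SepBy κ (S c) Z ∧ SepBy (κ' c) (S c) Y) ∨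
      (SepBy κ (S c) Y ∧ SepBy (κ' c) (S c) Z) := by
  have key : ∃ κ, (∀ y ∈ Y, y ≤ κ) ∧ (∀ z ∈ Z, κ ≤ z) ∧
      ∀ c, (∀ x ∈ S c, x ≤ κ) ∨ (∀ x ∈ S c, κ ≤ x) := by
    rcases Y.eq_empty_or_nonempty with he | hne
    · rcases Z.eq_empty_or_nonempty with he' | hne'
      · obtain ⟨b, hb⟩ := ((hS true).union (hS false)).bddAbove
        refine ⟨b, by simp [he], by simp [he'], fun c => Or.inl fun x hx => hb ?_⟩
        cases c
        · exact Or.inr hx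
        · exact Or.inl hx
      · obtain ⟨m, hm, hmin⟩ := Set.exists_min_image Z id hZ hne'
        refine ⟨m, by simp [he], fun s hs => hmin s hs, fun c => ?_⟩
        rcases hSZ c with h | h
        · exact Or.inl fun x hx => (h x hx m hm).le
        · exact Or.inr fun x hx => (h x hx m hm).le
    · obtain ⟨m, hm, hmax⟩ := Set.exists_max_image Y id hY hne
      refine ⟨m, fun s hs => hmax s hs, fun t ht => (hYZ m hm t ht).le, fun c => ?_⟩
      rcases hSY c with h | h
      · exact Or.inl fun x hx => (h x hx m hm).le
      · exact Or.inr fun x hx => (h x hx m hm).le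
  obtain ⟨κ, h1, h2, h3⟩ := key
  have h4 : ∀ c, ∃ k, (SepBy κ (S c) Z ∧ SepBy k (S c) Y) ∨ (SepBy κ (S c) Y ∧ SepBy k (S c) Z) := by
    intro c
    rcases h3 c with h | h
    · obtain ⟨k, hk⟩ := cut_of_cmp (hS c) hY (hSY c)
      exact ⟨k, Or.inl ⟨Or.inl ⟨h, h2⟩, hk⟩⟩
    · obtain ⟨k, hk⟩ := cut_of_cmp (hS c) hZ (hSZ c)
      exact ⟨k, Or.inr ⟨Or.inr ⟨h1, h⟩, hk⟩⟩
  choose κ' hκ' using h4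
  exact ⟨κ, κ', Or.inl ⟨h1, h2⟩, hκ'⟩

theorem SepBy.symm {κ : ℝ} {S T : Set ℝ} (h : SepBy κ S T) : SepBy κ T S := Or.symm h

theorem cuts {Y Z : Set ℝ} {S : Bool → Set ℝ} (hY : Y.Finite) (hZ : Z.Finite)
    (hS : ∀ c, (S c).Finite) (hYZ : CmpSets Y Z) (hSY : ∀ c, CmpSets (S c) Y)
    (hSZ : ∀ c, CmpSets (S c) Z) :
    ∃ κ : ℝ, ∃ κ' : Bool → ℝ, SepBy κ Y Z ∧ ∀ c, (SepBy κ (S c) Z ∧ SepBy (κ' c) (S c) Y) ∨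
      (SepBy κ (S c) Y ∧ SepBy (κ' c) (S c) Z) := by
  rcases hYZ with h | h
  · exact cuts_aux hY hZ hS h hSY hSZ
  · obtain ⟨κ, κ', h1, h2⟩ := cuts_aux hZ hY hS (fun s hs t ht => h t ht s hs) hSZ hSY
    exact ⟨κ, κ', h1.symm, fun c => (h2 c).symm⟩

theorem hamming {ι : Type*} (A : Finset ι) (s : ι → Fin 3 → Bool)
    (h : ∀ i ∈ A, ∀ j ∈ A, ∀ a b, a ≠ b → s i a = s j a ∨ s i b = s j b) :
    ∃ a, ∀ i ∈ A, ∀ j ∈ A, ∀ b, b ≠ a → s i b = s j b := by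
  by_cases hx : ∃ i ∈ A, ∃ j ∈ A, ∃ a, s i a ≠ s j a
  · obtain ⟨i, hi, j, hj, a, hne⟩ := hx
    have key : ∀ k ∈ A, ∀ b, b ≠ a → s k b = s i b := by
      intro k hk b hb
      by_contra hc
      have e1 : s i b = s j b := (h i hi j hj a b hb.symm).resolve_left hne
      have e2 : s k a = s i a := (h k hk i hi a b hb.symm).resolve_right hc
      rcases h k hk j hj a b hb.symm with e | e
      · exact hne (e2.symm.trans e)
      · exact hc (e.trans e1.symm)
    exact ⟨a, fun k hk l hl b hb => (key k hk b hb).trans (key l hl b hb).symm⟩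
  · push Not at hx
    exact ⟨0, fun i hi j hj b _ => hx i hi j hj b⟩

/-! ### geometry of the frame -/

structure Fr (α β : Pl → ℝ) (o x0 : Pl) : Prop where
  ha : Aff α
  hb : Aff β
  inj : ∀ p q, α p = α q → β p = β q → p = q
  oa : α o = -1
  ob : β o = -1
  xa : α x0 = 0
  xb : β x0 = 0

/-- outside the closed quadrant -/
def Out (α β : Pl → ℝ) (q : Pl) : Prop := 0 < α q ∨ 0 < β q

/-- angular coordinate -/
noncomputable def tau (α β : Pl → ℝ) (q : Pl) : ℝ :=
  if β q ≤ α q then (β q + 1) / (α q + 1) else 2 - (α q + 1) / (β q + 1)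

theorem tA {α β : Pl → ℝ} {q : Pl} (h : Out α β q) (h1 : β q ≤ α q) :
    0 < α q ∧ tau α β q * (α q + 1) = β q + 1 ∧ tau α β q ≤ 1 := by
  have h0 : 0 < α q := by rcases h with h | h <;> linarith
  have h2 : α q + 1 ≠ 0 := by linarith
  refine ⟨h0, ?_, ?_⟩
  · rw [tau, if_pos h1]; field_simp
  · rw [tau, if_pos h1, div_le_one (by linarith)]; linarith

theorem tB {α β : Pl → ℝ} {q : Pl} (h : Out α β q) (h1 : α q < β q) :
    0 < β q ∧ (2 - tau α β q) * (β q + 1) = α q + 1 ∧ 1 < tau α β q := by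
  have h0 : 0 < β q := by rcases h with h | h <;> linarith
  have h2 : β q + 1 ≠ 0 := by linarith
  refine ⟨h0, ?_, ?_⟩
  · rw [tau, if_neg (by linarith)]; field_simp; ring
  · have : (α q + 1) / (β q + 1) < 1 := by rw [div_lt_one (by linarith)]; linarith
    rw [tau, if_neg (by linarith)]; linarith

theorem tA' {α β : Pl → ℝ} {q : Pl} {κ : ℝ} (h0 : 0 < α q) (h1 : β q ≤ α q)
    (h : κ * (α q + 1) = β q + 1) : tau α β q = κ := by
  have h2 : α q + 1 ≠ 0 := by linarith
  rw [tau, if_pos h1, ← h]; field_simp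

theorem tB' {α β : Pl → ℝ} {q : Pl} {κ : ℝ} (h0 : 0 < β q) (h1 : α q < β q)
    (h : (2 - κ) * (β q + 1) = α q + 1) : tau α β q = κ := by
  have h2 : β q + 1 ≠ 0 := by linarith
  rw [tau, if_neg (by linarith), ← h]; field_simp; ring

noncomputable def fl (α β : Pl → ℝ) (κ : ℝ) (q : Pl) : ℝ :=
  if κ ≤ 1 then (β q + 1) - κ * (α q + 1) else (α q + 1) - (2 - κ) * (β q + 1)

noncomputable def gl (α β : Pl → ℝ) (κ : ℝ) (q : Pl) : ℝ := if κ ≤ 1 then α q else β q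

theorem fl_inj {α β : Pl → ℝ} {o x0 : Pl} (fr : Fr α β o x0) (κ : ℝ) (p q : Pl)
    (hp : fl α β κ p = 0) (hq : fl α β κ q = 0) (hg : gl α β κ p = gl α β κ q) : p = q := by
  unfold fl at hp hq
  unfold gl at hg
  split_ifs at hp hq hg with h
  · exact fr.inj p q hg (by rw [hg] at hp; linarith)
  · exact fr.inj p q (by rw [hg] at hp; linarith) hg

theorem fl_aff {α β : Pl → ℝ} {o x0 : Pl} (fr : Fr α β o x0) (κ : ℝ) : Aff (fl α β κ) := by
  by_cases h : κ ≤ 1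
  · have : fl α β κ = fun q => (1 - κ) + (-κ) * α q + 1 * β q := by
      funext q; rw [fl, if_pos h]; ring
    rw [this]; exact fr.ha.lin fr.hb _ _ _
  · have : fl α β κ = fun q => (1 - (2 - κ)) + 1 * α q + (-(2 - κ)) * β q := by
      funext q; rw [fl, if_neg h]; ring
    rw [this]; exact fr.ha.lin fr.hb _ _ _

theorem gl_aff {α β : Pl → ℝ} {o x0 : Pl} (fr : Fr α β o x0) (κ : ℝ) : Aff (gl α β κ) := by
  by_cases h : κ ≤ 1
  · have : gl α β κ = α := by funext q; rw [gl, if_pos h]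
    rw [this]; exact fr.ha
  · have : gl α β κ = β := by funext q; rw [gl, if_neg h]
    rw [this]; exact fr.hb

/-- a diagonal point between the two sides -/
theorem diag {α β : Pl → ℝ} {o x0 : Pl} (fr : Fr α β o x0) {H : Set Pl} (hH : Convex ℝ H)
    {u v : Pl} (hu : u ∈ H) (hv : v ∈ H) (h1 : β u ≤ α u) (h2 : α v ≤ β v) :
    ∃ w ∈ H, α w = β w := by
  obtain ⟨w, hw, h⟩ := (fr.hb.lin fr.ha 0 1 (-1)).ivt_mem hH hu hv (κ := 0)
    (by linarith) (by linarith)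
  exact ⟨w, hw, by linarith⟩

theorem crossing {α β : Pl → ℝ} {o x0 : Pl} (fr : Fr α β o x0) {H : Set Pl} (hH : Convex ℝ H)
    (hO : ∀ q ∈ H, Out α β q) {u v : Pl} (hu : u ∈ H) (hv : v ∈ H) {κ : ℝ}
    (h1 : tau α β u ≤ κ) (h2 : κ ≤ tau α β v) : ∃ w ∈ H, fl α β κ w = 0 := by
  by_cases hκ : κ ≤ 1
  · have hu1 : β u ≤ α u := by
      by_contra hc
      have := (tB (hO u hu) (by linarith)).2.2
      linarith
    obtain ⟨a1, a2, a3⟩ := tA (hO u hu) hu1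
    have fu : fl α β κ u ≤ 0 := by
      rw [fl, if_pos hκ]; nlinarith
    have hv' : ∃ v' ∈ H, 0 ≤ fl α β κ v' := by
      by_cases hv1 : β v ≤ α v
      · obtain ⟨b1, b2, b3⟩ := tA (hO v hv) hv1
        exact ⟨v, hv, by rw [fl, if_pos hκ]; nlinarith⟩
      · obtain ⟨w, hw, hd⟩ := diag fr hH hu hv hu1 (by linarith)
        have : 0 < α w := by rcases hO w hw with h | h <;> linarith
        exact ⟨w, hw, by rw [fl, if_pos hκ, ← hd]; nlinarith⟩
    obtain ⟨v', hv'1, hv'2⟩ := hv'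
    exact (fl_aff fr κ).ivt_mem hH hu hv'1 fu hv'2
  · have hv1 : α v < β v := by
      by_contra hc
      have := (tA (hO v hv) (by linarith)).2.2
      linarith
    obtain ⟨a1, a2, a3⟩ := tB (hO v hv) hv1
    have fv : fl α β κ v ≤ 0 := by
      rw [fl, if_neg hκ]; nlinarith
    have hu' : ∃ u' ∈ H, 0 ≤ fl α β κ u' := by
      by_cases hu1 : β u ≤ α u
      · obtain ⟨w, hw, hd⟩ := diag fr hH hu hv hu1 (by linarith)
        have : 0 < α w := by rcases hO w hw with h | h <;> linarith
        exact ⟨w, hw, by rw [fl, if_neg hκ, ← hd]; nlinarith⟩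
      · obtain ⟨b1, b2, b3⟩ := tB (hO u hu) (by linarith)
        exact ⟨u, hu, by rw [fl, if_neg hκ]; nlinarith⟩
    obtain ⟨u', hu'1, hu'2⟩ := hu'
    exact (fl_aff fr κ).ivt_mem hH hv hu'1 fv hu'2

theorem ray {α β : Pl → ℝ} {o x0 : Pl} (fr : Fr α β o x0) {Y : Set Pl} (hY : Convex ℝ Y)
    (ho : o ∈ Y) {u v : Pl} (hv : v ∈ Y) {c : ℝ} (h0 : 0 ≤ c) (h1 : c ≤ 1)
    (ha : α u + 1 = c * (α v + 1)) (hb : β u + 1 = c * (β v + 1)) : u ∈ Y := by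
  have : u = c • v + (1 - c) • o := by
    apply fr.inj
    · rw [fr.ha.comb _ _ _ _ (by ring), fr.oa]; linarith
    · rw [fr.hb.comb _ _ _ _ (by ring), fr.ob]; linarith
  rw [this]
  exact hY hv ho h0 (by linarith) (by ring)

theorem noray {α β : Pl → ℝ} {o x0 : Pl} (fr : Fr α β o x0) {X Y : Set Pl} (hX : Convex ℝ X)
    (hY : Convex ℝ Y) (hoX : o ∈ X) (hoY : o ∈ Y)
    (hXY : ∀ q ∈ X, q ∈ Y → α q < 0 ∧ β q < 0) {u v : Pl} (hu : u ∈ X) (hv : v ∈ Y)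
    (hu' : Out α β u) (hv' : Out α β v) : tau α β u ≠ tau α β v := by
  intro he
  have nu : u ∉ Y := fun h => by
    have := hXY u hu h
    rcases hu' with h | h <;> linarith
  have nv : v ∉ X := fun h => by
    have := hXY v h hv
    rcases hv' with h | h <;> linarith
  by_cases h1 : β u ≤ α u
  · obtain ⟨a1, a2, a3⟩ := tA hu' h1
    have h2 : β v ≤ α v := by
      by_contra hc
      have := (tB hv' (by linarith)).2.2
      linarith
    obtain ⟨b1, b2, b3⟩ := tA hv' h2
    have p1 : 0 < α u + 1 := by linarith
    have p2 : 0 < α v + 1 := by linarith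
    rcases le_total (α u) (α v) with h | h
    · apply nu
      refine ray fr hY hoY hv (c := (α u + 1) / (α v + 1)) (by positivity)
        ((div_le_one p2).2 (by linarith)) (by field_simp) ?_
      rw [← a2, ← b2, he]; field_simp
    · apply nv
      refine ray fr hX hoX hu (c := (α v + 1) / (α u + 1)) (by positivity)
        ((div_le_one p1).2 (by linarith)) (by field_simp) ?_
      rw [← a2, ← b2, he]; field_simp
  · obtain ⟨a1, a2, a3⟩ := tB hu' (by linarith)
    have h2 : α v < β v := by
      by_contra hc
      have := (tA hv' (by linarith)).2.2
      linarith
    obtain ⟨b1, b2, b3⟩ := tB hv' h2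
    have p1 : 0 < β u + 1 := by linarith
    have p2 : 0 < β v + 1 := by linarith
    rcases le_total (β u) (β v) with h | h
    · apply nu
      refine ray fr hY hoY hv (c := (β u + 1) / (β v + 1)) (by positivity)
        ((div_le_one p2).2 (by linarith)) ?_ (by field_simp)
      rw [← a2, ← b2, he]; field_simp
    · apply nv
      refine ray fr hX hoX hu (c := (β v + 1) / (β u + 1)) (by positivity)
        ((div_le_one p1).2 (by linarith)) ?_ (by field_simp)
      rw [← a2, ← b2, he]; field_simp

/-- the relevant part of a set -/
def part (α β : Pl → ℝ) (x0 : Pl) (X : Set Pl) (c : Bool) : Set Pl :=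
  {q | q ∈ X ∧ Out α β q ∧ (x0 ∉ X → if c = true then β q < α q else α q < β q)}

theorem conn0 {α β : Pl → ℝ} {o x0 : Pl} (fr : Fr α β o x0) {X : Set Pl} (hX : Convex ℝ X)
    (hx : x0 ∈ X) (c : Bool) {u u' : Pl} (hu : u ∈ part α β x0 X c) (hu' : u' ∈ part α β x0 X c)
    {κ : ℝ} (h1 : tau α β u ≤ κ) (h2 : κ ≤ tau α β u') (hκ : κ ≠ 1) :
    ∃ w ∈ part α β x0 X c, tau α β w = κ := by
  obtain ⟨m, O, -⟩ := hu
  obtain ⟨m', O', -⟩ := hu'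
  rcases lt_or_gt_of_ne hκ with hk | hk
  · have hu1 : β u ≤ α u := by
      by_contra hc
      have := (tB O (by linarith)).2.2
      linarith
    obtain ⟨a1, a2, a3⟩ := tA O hu1
    have fu : fl α β κ u ≤ 0 := by rw [fl, if_pos hk.le]; nlinarith
    have fx : fl α β κ x0 = 1 - κ := by rw [fl, if_pos hk.le, fr.xa, fr.xb]; ring
    obtain ⟨s, t, hs, ht, hst, hw⟩ := (fl_aff fr κ).ivt (x := u) (y := x0) (κ := 0) fu
      (by linarith)
    have hw' := hw
    rw [(fl_aff fr κ).comb _ _ _ _ hst, fx] at hw'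
    have hs' : 0 < s := by
      rcases eq_or_lt_of_le hs with h | h
      · exfalso
        rw [← h] at hw' hst
        have : t = 1 := by linarith
        rw [this] at hw'; linarith
      · exact h
    have ea := fr.ha.comb u x0 s t hst
    have eb := fr.hb.comb u x0 s t hst
    rw [fr.xa] at ea
    rw [fr.xb] at eb
    have pa : 0 < α (s • u + t • x0) := by rw [ea]; nlinarith
    refine ⟨s • u + t • x0, ⟨hX m hx hs ht hst, Or.inl pa, fun h => absurd hx h⟩, ?_⟩
    apply tA' pa
    · rw [ea, eb]; nlinarith
    · rw [fl, if_pos hk.le] at hw; linarith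
  · have hu1 : α u' < β u' := by
      by_contra hc
      have := (tA O' (by linarith)).2.2
      linarith
    obtain ⟨a1, a2, a3⟩ := tB O' hu1
    have fu : fl α β κ u' ≤ 0 := by rw [fl, if_neg (by linarith)]; nlinarith
    have fx : fl α β κ x0 = κ - 1 := by rw [fl, if_neg (by linarith), fr.xa, fr.xb]; ring
    obtain ⟨s, t, hs, ht, hst, hw⟩ := (fl_aff fr κ).ivt (x := u') (y := x0) (κ := 0) fu
      (by linarith)
    have hw' := hw
    rw [(fl_aff fr κ).comb _ _ _ _ hst, fx] at hw'
    have hs' : 0 < s := by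
      rcases eq_or_lt_of_le hs with h | h
      · exfalso
        rw [← h] at hw' hst
        have : t = 1 := by linarith
        rw [this] at hw'; linarith
      · exact h
    have ea := fr.ha.comb u' x0 s t hst
    have eb := fr.hb.comb u' x0 s t hst
    rw [fr.xa] at ea
    rw [fr.xb] at eb
    have pa : 0 < β (s • u' + t • x0) := by rw [eb]; nlinarith
    refine ⟨s • u' + t • x0, ⟨hX m' hx hs ht hst, Or.inr pa, fun h => absurd hx h⟩, ?_⟩
    apply tB' pa
    · rw [ea, eb]; nlinarith
    · rw [fl, if_neg (by linarith)] at hw; linarith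

theorem conn1 {α β : Pl → ℝ} {o x0 : Pl} (fr : Fr α β o x0) {X : Set Pl} (hX : Convex ℝ X)
    (hx : x0 ∉ X) (c : Bool) {u u' : Pl} (hu : u ∈ part α β x0 X c) (hu' : u' ∈ part α β x0 X c)
    {κ : ℝ} (h1 : tau α β u ≤ κ) (h2 : κ ≤ tau α β u') :
    ∃ w ∈ part α β x0 X c, tau α β w = κ := by
  obtain ⟨m, O, S⟩ := hu
  obtain ⟨m', O', S'⟩ := hu'
  have S := S hx
  have S' := S' hx
  cases c
  · simp only [Bool.false_eq_true, if_false] at S S'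
    obtain ⟨a1, a2, a3⟩ := tB O S
    obtain ⟨b1, b2, b3⟩ := tB O' S'
    have hk : ¬ κ ≤ 1 := by linarith
    have fu : 0 ≤ fl α β κ u := by rw [fl, if_neg hk]; nlinarith
    have fu' : fl α β κ u' ≤ 0 := by rw [fl, if_neg hk]; nlinarith
    obtain ⟨s, t, hs, ht, hst, hw⟩ := (fl_aff fr κ).ivt (x := u') (y := u) (κ := 0) fu' fu
    have ea := fr.ha.comb u' u s t hst
    have eb := fr.hb.comb u' u s t hst
    have pos : ∀ x y : ℝ, 0 < x → 0 < y → 0 < s * x + t * y := by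
      intro x y hx hy
      rcases eq_or_lt_of_le hs with h | h
      · rw [← h] at hst ⊢
        have : t = 1 := by linarith
        rw [this]; linarith
      · nlinarith
    have pa : 0 < β (s • u' + t • u) := by rw [eb]; exact pos _ _ b1 a1
    have pd : α (s • u' + t • u) < β (s • u' + t • u) := by
      have := pos (β u' - α u') (β u - α u) (by linarith) (by linarith)
      rw [ea, eb]; nlinarith
    refine ⟨s • u' + t • u, ⟨hX m' m hs ht hst, Or.inr pa, fun _ => by simpa using pd⟩, ?_⟩
    apply tB' pa pd
    rw [fl, if_neg hk] at hw; linarith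
  · simp only [if_true] at S S'
    obtain ⟨a1, a2, a3⟩ := tA O S.le
    obtain ⟨b1, b2, b3⟩ := tA O' S'.le
    have hk : κ ≤ 1 := by linarith
    have fu : fl α β κ u ≤ 0 := by rw [fl, if_pos hk]; nlinarith
    have fu' : 0 ≤ fl α β κ u' := by rw [fl, if_pos hk]; nlinarith
    obtain ⟨s, t, hs, ht, hst, hw⟩ := (fl_aff fr κ).ivt (x := u) (y := u') (κ := 0) fu fu'
    have ea := fr.ha.comb u u' s t hst
    have eb := fr.hb.comb u u' s t hst
    have pos : ∀ x y : ℝ, 0 < x → 0 < y → 0 < s * x + t * y := by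
      intro x y hx hy
      rcases eq_or_lt_of_le hs with h | h
      · rw [← h] at hst ⊢
        have : t = 1 := by linarith
        rw [this]; linarith
      · nlinarith
    have pa : 0 < α (s • u + t • u') := by rw [ea]; exact pos _ _ a1 b1
    have pd : β (s • u + t • u') < α (s • u + t • u') := by
      have := pos (α u - β u) (α u' - β u') (by linarith) (by linarith)
      rw [ea, eb]; nlinarith
    refine ⟨s • u + t • u', ⟨hX m m' hs ht hst, Or.inl pa, fun _ => by simpa using pd⟩, ?_⟩
    apply tA' pa pd.le
    rw [fl, if_pos hk] at hw; linarith

theorem part_ne_one {α β : Pl → ℝ} {x0 : Pl} {X : Set Pl}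
    (hx : x0 ∉ X) (c : Bool) {u : Pl} (hu : u ∈ part α β x0 X c) : tau α β u ≠ 1 := by
  obtain ⟨m, O, S⟩ := hu
  have S := S hx
  intro he
  cases c
  · simp only [Bool.false_eq_true, if_false] at S
    have := (tB O S).2.2
    linarith
  · simp only [if_true] at S
    have := (tA O S.le).2.1
    rw [he] at this; linarith

theorem comparable_aux {α β : Pl → ℝ} {o x0 : Pl} (fr : Fr α β o x0) {X Y : Set Pl}
    (hX : Convex ℝ X) (hY : Convex ℝ Y) (hoX : o ∈ X) (hoY : o ∈ Y)
    (hXY : ∀ q ∈ X, q ∈ Y → α q < 0 ∧ β q < 0) (c d : Bool) (hx : x0 ∉ Y) :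
    CmpSets (tau α β '' part α β x0 X c) (tau α β '' part α β x0 Y d) := by
  have NR : ∀ u ∈ part α β x0 X c, ∀ v ∈ part α β x0 Y d, tau α β u ≠ tau α β v :=
    fun u hu v hv => noray fr hX hY hoX hoY hXY hu.1 hv.1 hu.2.1 hv.2.1
  by_contra hc
  simp only [CmpSets, not_or, not_forall, not_lt, Set.mem_image] at hc
  obtain ⟨⟨_, ⟨u', hu', rfl⟩, _, ⟨v', hv', rfl⟩, h1⟩, ⟨_, ⟨u, hu, rfl⟩, _, ⟨v, hv, rfl⟩, h2⟩⟩ := hc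
  have CX : ∀ u ∈ part α β x0 X c, ∀ u' ∈ part α β x0 X c, ∀ κ, tau α β u ≤ κ →
      κ ≤ tau α β u' → κ ≠ 1 → ∃ w ∈ part α β x0 X c, tau α β w = κ := by
    intro u hu u' hu' κ k1 k2 k3
    by_cases h : x0 ∈ X
    · exact conn0 fr hX h c hu hu' k1 k2 k3
    · exact conn1 fr hX h c hu hu' k1 k2
  have h3 : tau α β u' < tau α β v := by
    by_contra hlt
    obtain ⟨w, hw, e⟩ := CX u hu u' hu' _ h2 (not_lt.1 hlt) (part_ne_one hx d hv)
    exact NR w hw v hv e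
  have h4 : tau α β v' < tau α β u := by
    by_contra hlt
    obtain ⟨w, hw, e⟩ := CX u hu u' hu' _ (not_lt.1 hlt) h1 (part_ne_one hx d hv')
    exact NR w hw v' hv' e
  obtain ⟨w, hw, e⟩ := conn1 fr hY hx d hv' hv h4.le h2
  exact NR u hu w hw e.symm

theorem comparable {α β : Pl → ℝ} {o x0 : Pl} (fr : Fr α β o x0) {X Y : Set Pl}
    (hX : Convex ℝ X) (hY : Convex ℝ Y) (hoX : o ∈ X) (hoY : o ∈ Y)
    (hXY : ∀ q ∈ X, q ∈ Y → α q < 0 ∧ β q < 0) (c d : Bool) :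
    CmpSets (tau α β '' part α β x0 X c) (tau α β '' part α β x0 Y d) := by
  by_cases hx : x0 ∈ Y
  · have hx' : x0 ∉ X := fun h => by
      have := (hXY x0 h hx).1
      rw [fr.xa] at this; linarith
    rcases comparable_aux fr hY hX hoY hoX (fun q h1 h2 => hXY q h2 h1) d c hx' with h | h
    · exact Or.inr fun s hs t ht => h t ht s hs
    · exact Or.inl fun s hs t ht => h t ht s hs
  · exact comparable_aux fr hX hY hoX hoY hXY c d hx

theorem CmpSets.mono {S T S' T' : Set ℝ} (h : CmpSets S T) (h1 : S' ⊆ S) (h2 : T' ⊆ T) : CmpSets S' T' := by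
  rcases h with h | h
  · exact Or.inl fun s hs t ht => h s (h1 hs) t (h2 ht)
  · exact Or.inr fun s hs t ht => h s (h1 hs) t (h2 ht)


theorem sep_cross {α β : Pl → ℝ} {o x0 : Pl} (fr : Fr α β o x0) {H : Set Pl} (hH : Convex ℝ H)
    (hO : ∀ q ∈ H, Out α β q) {S T : Set ℝ} {κ : ℝ} (hs : SepBy κ S T) {u v : Pl} (hu : u ∈ H)
    (hv : v ∈ H) (hu' : tau α β u ∈ S) (hv' : tau α β v ∈ T) : ∃ w ∈ H, fl α β κ w = 0 := by
  rcases hs with ⟨h1, h2⟩ | ⟨h1, h2⟩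
  · exact crossing fr hH hO hu hv (h1 _ hu') (h2 _ hv')
  · exact crossing fr hH hO hv hu (h1 _ hv') (h2 _ hu')

theorem three_other : ∀ a : Fin 3, ∃ y z : Fin 3, y ≠ a ∧ z ≠ a ∧ y ≠ z := by decide

theorem class_norm {ι : Type*} [Fintype ι] (F : ι → Set Pl) (hne : ∀ i, (F i).Nonempty)
    (hc : ∀ i, IsCompact (F i)) (hv : ∀ i, Convex ℝ (F i)) (A : Finset ι)
    {α β : Pl → ℝ} {o x0 : Pl} (fr : Fr α β o x0) (X : Fin 3 → Set Pl)
    (hX : ∀ a, Convex ℝ (X a)) (ho : ∀ a, o ∈ X a)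
    (hXX : ∀ a b, a ≠ b → ∀ q ∈ X a, q ∈ X b → α q < 0 ∧ β q < 0)
    (hA : ∀ i ∈ A, ∀ q ∈ F i, Out α β q)
    (hP : ∀ i ∈ A, ∀ j ∈ A, i ≠ j → ∀ a b, a ≠ b →
      (∃ q ∈ F i, q ∈ F j ∧ q ∈ X a) ∨ (∃ q ∈ F i, q ∈ F j ∧ q ∈ X b)) :
    ∃ C : Finset Pl, C.card ≤ 2 ∧ ∀ i ∈ A, ∃ x ∈ C, x ∈ F i := by
  classical
  -- diagonal points force `x0`
  have hdiag : ∀ a, ∀ w ∈ X a, Out α β w → α w = β w → x0 ∈ X a := by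
    intro a w hw hO hd
    have hp : 0 < α w := by rcases hO with h | h <;> linarith
    have hp' : 0 < α w + 1 := by linarith
    refine ray fr (hX a) (ho a) hw (c := 1 / (α w + 1)) (by positivity)
      ((div_le_one hp').2 (by linarith)) ?_ ?_
    · rw [fr.xa]; field_simp; ring
    · rw [fr.xb, ← hd]; field_simp; ring
  -- sides
  let s : ι → Fin 3 → Bool := fun i a =>
    decide (x0 ∈ X a ∨ ∃ p ∈ F i, p ∈ X a ∧ β p < α p)
  have hpart : ∀ i ∈ A, ∀ a, ∀ q ∈ F i, q ∈ X a → q ∈ part α β x0 (X a) (s i a) := by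
    intro i hi a q hq hqa
    refine ⟨hqa, hA i hi q hq, fun hx => ?_⟩
    have hqd : α q ≠ β q := fun h => hx (hdiag a q hqa (hA i hi q hq) h)
    by_cases h : ∃ p ∈ F i, p ∈ X a ∧ β p < α p
    · have hs : s i a = true := by simp only [s, decide_eq_true_eq]; exact Or.inr h
      rw [hs, if_pos rfl]
      by_contra hlt
      obtain ⟨p, hp, hpa, hpl⟩ := h
      obtain ⟨w, hw, hd⟩ := diag fr ((hv i).inter (hX a)) ⟨hp, hpa⟩ ⟨hq, hqa⟩ hpl.le
        (not_lt.1 hlt)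
      exact hx (hdiag a w hw.2 (hA i hi w hw.1) hd)
    · have hs : s i a = false := by
        simp only [s, decide_eq_false_iff_not, not_or]; exact ⟨hx, h⟩
      rw [hs, if_neg (by simp)]
      push Not at h
      exact lt_of_le_of_ne (h q hq hqa) hqd
  have hagree : ∀ i ∈ A, ∀ j ∈ A, ∀ a, (∃ q ∈ F i, q ∈ F j ∧ q ∈ X a) → s i a = s j a := by
    rintro i hi j hj a ⟨q, hqi, hqj, hqa⟩
    by_cases hx : x0 ∈ X a
    · simp [s, hx]
    · have h1 := (hpart i hi a q hqi hqa).2.2 hx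
      have h2 := (hpart j hj a q hqj hqa).2.2 hx
      cases e1 : s i a <;> cases e2 : s j a <;> simp only [e1, e2, if_true, if_false,
        Bool.false_eq_true] at h1 h2 ⊢ <;> linarith
  obtain ⟨a, ha⟩ := hamming A s (by
    intro i hi j hj b c hbc
    by_cases hij : i = j
    · subst hij; simp
    · exact (hP i hi j hj hij b c hbc).imp (hagree i hi j hj b) (hagree i hi j hj c))
  obtain ⟨y, z, hya, hza, hyz⟩ : ∃ y z : Fin 3, y ≠ a ∧ z ≠ a ∧ y ≠ z := by
    exact three_other a
  -- witnesses
  have hwit : ∀ i j b, ∃ w, (∃ q ∈ F i, q ∈ F j ∧ q ∈ X b) → w ∈ F i ∧ w ∈ F j ∧ w ∈ X b := by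
    intro i j b
    by_cases h : ∃ q ∈ F i, q ∈ F j ∧ q ∈ X b
    · obtain ⟨q, hq⟩ := h
      exact ⟨q, fun _ => hq⟩
    · exact ⟨0, fun h' => absurd h' h⟩
  choose w hw using hwit
  let S : Fin 3 → Bool → Set ℝ := fun b c => {x | ∃ i ∈ A, ∃ j ∈ A,
    (∃ q ∈ F i, q ∈ F j ∧ q ∈ X b) ∧ s i b = c ∧ tau α β (w i j b) = x}
  have hSfin : ∀ b c, (S b c).Finite := by
    intro b c
    refine (Set.finite_range (fun p : ι × ι => tau α β (w p.1 p.2 b))).subset ?_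
    rintro x ⟨i, -, j, -, -, -, h⟩
    exact ⟨(i, j), h⟩
  have hSsub : ∀ b c, S b c ⊆ tau α β '' part α β x0 (X b) c := by
    rintro b c x ⟨i, hi, j, hj, h, rfl, rfl⟩
    obtain ⟨h1, -, h3⟩ := hw i j b h
    exact ⟨_, hpart i hi b _ h1 h3, rfl⟩
  have hcmp : ∀ b b', b ≠ b' → ∀ c c', CmpSets (S b c) (S b' c') := fun b b' hbb c c' =>
    (comparable fr (hX b) (hX b') (ho b) (ho b') (hXX b b' hbb) c c').mono (hSsub b c)
      (hSsub b' c')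
  rcases A.eq_empty_or_nonempty with he | ⟨i0, hi0⟩
  · exact ⟨∅, by simp, by simp [he]⟩
  obtain ⟨κ, κ', hκ, hκ'⟩ := cuts (hSfin y (s i0 y)) (hSfin z (s i0 z)) (hSfin a)
    (hcmp y z hyz _ _) (fun c => hcmp a y hya.symm _ _) (fun c => hcmp a z hza.symm _ _)
  obtain ⟨l1, r1, φ, t1, t2, t3⟩ := track F hne hc hv (fl α β κ) (gl α β κ) (fl_aff fr κ)
    (gl_aff fr κ) (fl_inj fr κ)
  have htr := fun c => track F hne hc hv (fl α β (κ' c)) (gl α β (κ' c)) (fl_aff fr (κ' c))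
    (gl_aff fr (κ' c)) (fl_inj fr (κ' c))
  choose l2 r2 ψ T1 T2 T3 using htr
  obtain ⟨x, x', c, hxy⟩ := two_track A (fun i => s i a) l1 r1 (fun i => l2 (s i a) i)
    (fun i => r2 (s i a) i) t1 (fun i => T1 _ i) (by
      intro i hi j hj
      by_cases hij : i = j
      · subst hij; exact Or.inl ⟨t1 i, t1 i⟩
      have hcv : Convex ℝ (F i ∩ F j) := (hv i).inter (hv j)
      have hO : ∀ q ∈ F i ∩ F j, Out α β q := fun q hq => hA i hi q hq.1
      have mem : ∀ b, (∃ q ∈ F i, q ∈ F j ∧ q ∈ X b) →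
          w i j b ∈ F i ∩ F j ∧ tau α β (w i j b) ∈ S b (s i b) := fun b h =>
        ⟨⟨(hw i j b h).1, (hw i j b h).2.1⟩, i, hi, j, hj, h, rfl, rfl⟩
      have M : ∀ b b' k, (∃ q ∈ F i, q ∈ F j ∧ q ∈ X b) → (∃ q ∈ F i, q ∈ F j ∧ q ∈ X b') →
          SepBy k (S b (s i b)) (S b' (s i b')) → ∃ p ∈ F i, p ∈ F j ∧ fl α β k p = 0 := by
        intro b b' k h h' hk
        obtain ⟨p, hp, hp0⟩ := sep_cross fr hcv hO hk (mem b h).1 (mem b' h').1 (mem b h).2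
          (mem b' h').2
        exact ⟨p, hp.1, hp.2, hp0⟩
      have ey : s i y = s i0 y := ha i hi i0 hi0 y hya
      have ez : s i z = s i0 z := ha i hi i0 hi0 z hza
      rw [← ey, ← ez] at hκ
      by_cases hYZ : (∃ q ∈ F i, q ∈ F j ∧ q ∈ X y) ∧ (∃ q ∈ F i, q ∈ F j ∧ q ∈ X z)
      · exact Or.inl (t3 i j (M y z κ hYZ.1 hYZ.2 hκ))
      have hXa : ∃ q ∈ F i, q ∈ F j ∧ q ∈ X a := by
        rcases hP i hi j hj hij a y hya.symm with h | h
        · exact h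
        · rcases hP i hi j hj hij a z hza.symm with h' | h'
          · exact h'
          · exact absurd ⟨h, h'⟩ hYZ
      have es : s i a = s j a := hagree i hi j hj a hXa
      have hk := hκ' (s i a)
      rw [← ey, ← ez] at hk
      have second : (∃ p ∈ F i, p ∈ F j ∧ fl α β (κ' (s i a)) p = 0) →
          s i a = s j a ∧ Mt (fun i => l2 (s i a) i) (fun i => r2 (s i a) i) i j := by
        intro h
        refine ⟨es, ?_⟩
        have := T3 (s i a) i j h
        unfold Mt at this ⊢
        simp only
        rw [← es]; exact this
      rcases hP i hi j hj hij y z hyz with h | h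
      · rcases hk with hk | hk
        · exact Or.inr (second (M a y _ hXa h hk.2))
        · exact Or.inl (t3 i j (M a y _ hXa h hk.1))
      · rcases hk with hk | hk
        · exact Or.inl (t3 i j (M a z _ hXa h hk.1))
        · exact Or.inr (second (M a z _ hXa h hk.2)))
  refine ⟨{φ x, ψ c x'}, Finset.card_le_two, fun i hi => ?_⟩
  rcases hxy i hi with h | ⟨h0, h1, h2⟩
  · exact ⟨φ x, by simp, t2 i x h.1 h.2⟩
  · refine ⟨ψ c x', by simp, ?_⟩
    rw [h0] at h1 h2
    exact T2 c i x' h1 h2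

/-- the `(4,3)` property in unfolded form -/
def Prop43 {ι : Type*} (F : ι → Set Pl) : Prop :=
  ∀ i j k m : ι, i ≠ j → i ≠ k → i ≠ m → j ≠ k → j ≠ m → k ≠ m →
    (∃ q ∈ F i, q ∈ F j ∧ q ∈ F k) ∨ (∃ q ∈ F i, q ∈ F j ∧ q ∈ F m) ∨
    (∃ q ∈ F i, q ∈ F k ∧ q ∈ F m) ∨ (∃ q ∈ F j, q ∈ F k ∧ q ∈ F m)

theorem class_lemma {ι : Type*} [Fintype ι] (F : ι → Set Pl) (hne : ∀ i, (F i).Nonempty)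
    (hc : ∀ i, IsCompact (F i)) (hv : ∀ i, Convex ℝ (F i)) (h43 : Prop43 F) (A : Finset ι)
    {α β : Pl → ℝ} (hα : Aff α) (hβ : Aff β)
    (hinj : ∀ p q, α p = α q → β p = β q → p = q) (hsurj : ∀ a b, ∃ x, α x = a ∧ β x = b)
    (t : Fin 3 → ι) (ht : ∀ a b, a ≠ b → t a ≠ t b) (o : Pl) (ho : ∀ a, o ∈ F (t a))
    (hXX : ∀ a b, a ≠ b → ∀ q ∈ F (t a), q ∈ F (t b) → α q ≤ 0 ∧ β q ≤ 0)
    (hA : ∀ i ∈ A, ∀ q ∈ F i, 0 < α q ∨ 0 < β q) :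
    ∃ C : Finset Pl, C.card ≤ 2 ∧ ∀ i ∈ A, ∃ x ∈ C, x ∈ F i := by
  classical
  have hε : ∃ ε : ℝ, 0 < ε ∧ ∀ i ∈ A, ∀ q ∈ F i, ε < α q ∨ ε < β q := by
    have h1 : ∀ i : ι, ∃ m : ℝ, 0 < m ∧ (i ∈ A → ∀ q ∈ F i, m < max (α q) (β q)) := by
      intro i
      by_cases hi : i ∈ A
      · obtain ⟨x, hx, hx'⟩ := (hc i).exists_isMinOn (hne i)
          (f := fun q => max (α q) (β q)) (hα.cont.max hβ.cont).continuousOn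
        have hp : 0 < max (α x) (β x) := by
          rcases hA i hi x hx with h | h
          · exact lt_max_of_lt_left h
          · exact lt_max_of_lt_right h
        exact ⟨max (α x) (β x) / 2, by linarith, fun _ q hq => by
          have : max (α x) (β x) ≤ max (α q) (β q) := hx' hq
          linarith⟩
      · exact ⟨1, one_pos, fun h => absurd h hi⟩
    choose m hm hm' using h1
    rcases isEmpty_or_nonempty ι with hE | hE
    · exact ⟨1, one_pos, fun i => (hE.false i).elim⟩
    · obtain ⟨i, hi⟩ := Finite.exists_min m
      refine ⟨m i, hm i, fun j hj q hq => ?_⟩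
      have := (hi j).trans_lt (hm' j hj q hq)
      exact lt_max_iff.1 this
  obtain ⟨ε, hε, hA'⟩ := hε
  have hoo := hXX 0 1 (by decide) o (ho 0) (ho 1)
  have da : 0 < ε - α o := by linarith
  have db : 0 < ε - β o := by linarith
  obtain ⟨x0, hx0, hx0'⟩ := hsurj ε ε
  let α' : Pl → ℝ := fun q => (α q - ε) / (ε - α o)
  let β' : Pl → ℝ := fun q => (β q - ε) / (ε - β o)
  have fr : Fr α' β' o x0 := by
    refine ⟨?_, ?_, ?_, ?_, ?_, ?_, ?_⟩
    · have : α' = fun q => (-ε / (ε - α o)) + (1 / (ε - α o)) * α q + 0 * β q := by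
        funext q; simp only [α']; ring
      rw [this]; exact hα.lin hβ _ _ _
    · have : β' = fun q => (-ε / (ε - β o)) + (1 / (ε - β o)) * β q + 0 * α q := by
        funext q; simp only [β']; ring
      rw [this]; exact hβ.lin hα _ _ _
    · intro p q h1 h2
      simp only [α', β'] at h1 h2
      rw [div_left_inj' da.ne'] at h1
      rw [div_left_inj' db.ne'] at h2
      exact hinj p q (by linarith) (by linarith)
    · simp only [α']; field_simp; ring
    · simp only [β']; field_simp; ring
    · simp only [α', hx0]; simp
    · simp only [β', hx0']; simp
  have hnA : ∀ i ∈ A, ∀ a, i ≠ t a := by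
    rintro i hi a rfl
    rcases hA _ hi o (ho a) with h | h <;> linarith
  refine class_norm F hne hc hv A fr (fun a => F (t a)) (fun a => hv _) ho ?_ ?_ ?_
  · intro a b hab q h1 h2
    obtain ⟨e1, e2⟩ := hXX a b hab q h1 h2
    exact ⟨div_neg_of_neg_of_pos (by linarith) da, div_neg_of_neg_of_pos (by linarith) db⟩
  · intro i hi q hq
    rcases hA' i hi q hq with h | h
    · exact Or.inl (div_pos (by linarith) da)
    · exact Or.inr (div_pos (by linarith) db)
  · intro i hi j hj hij a b hab
    rcases h43 i j (t a) (t b) hij (hnA i hi a) (hnA i hi b) (hnA j hj a) (hnA j hj b)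
      (ht a b hab) with h | h | ⟨q, h1, h2, h3⟩ | ⟨q, h1, h2, h3⟩
    · exact Or.inl h
    · exact Or.inr h
    · exfalso
      have := hXX a b hab q h2 h3
      rcases hA i hi q h1 with h | h <;> linarith
    · exfalso
      have := hXX a b hab q h2 h3
      rcases hA j hj q h1 with h | h <;> linarith


/-- first line -/
noncomputable def la (M : ℝ) (p : ℝ × ℝ × ℝ) (q : Pl) : ℝ := q 1 - M * (1 - 2 * p.1)

/-- second line -/
noncomputable def lb (M : ℝ) (p : ℝ × ℝ × ℝ) (q : Pl) : ℝ :=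
  (p.2.1 * p.2.2 + (1 - p.2.1) * (1 - p.2.2)) * q 0 +
    (p.2.2 - p.2.1) * (q 1 - M * (1 - 2 * p.1)) - M * (p.2.1 + p.2.2 - 1)

theorem la_aff (M : ℝ) (p : ℝ × ℝ × ℝ) : Aff (la M p) :=
  ⟨-(M * (1 - 2 * p.1)), 0, 1, fun q => by simp only [la]; ring⟩

theorem lb_aff (M : ℝ) (p : ℝ × ℝ × ℝ) : Aff (lb M p) :=
  ⟨-((p.2.2 - p.2.1) * (M * (1 - 2 * p.1))) - M * (p.2.1 + p.2.2 - 1),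
    (p.2.1 * p.2.2 + (1 - p.2.1) * (1 - p.2.2)), (p.2.2 - p.2.1),
    fun q => by simp only [lb]; ring⟩

/-- signs of the quadrants -/
def sgA : Fin 4 → ℝ := ![1, 1, -1, -1]
/-- signs of the quadrants -/
def sgB : Fin 4 → ℝ := ![-1, 1, -1, 1]

/-- in two of three sets -/
def Pairw {ι : Type*} (F : ι → Set Pl) (i j k : ι) (q : Pl) : Prop :=
  (q ∈ F i ∧ q ∈ F j) ∨ (q ∈ F i ∧ q ∈ F k) ∨ (q ∈ F j ∧ q ∈ F k)

/-- a distinct intersecting triple -/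
def Trip {ι : Type*} (F : ι → Set Pl) (i j k : ι) : Prop :=
  i ≠ j ∧ i ≠ k ∧ j ≠ k ∧ ∃ q ∈ F i, q ∈ F j ∧ q ∈ F k

/-- good triple in the open quadrant -/
def GoodO {ι : Type*} (F : ι → Set Pl) (M : ℝ) (l : Fin 4) (p : ℝ × ℝ × ℝ) : Prop :=
  ∃ i j k, Trip F i j k ∧ ∀ q, Pairw F i j k q → 0 < sgA l * la M p q ∧ 0 < sgB l * lb M p q

/-- good triple in the closed quadrant -/
def GoodC {ι : Type*} (F : ι → Set Pl) (M : ℝ) (l : Fin 4) : Set (ℝ × ℝ × ℝ) :=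
  {p | ∃ i j k, Trip F i j k ∧
    ∀ q, Pairw F i j k q → 0 ≤ sgA l * la M p q ∧ 0 ≤ sgB l * lb M p q}

theorem goodC_closed {ι : Type*} [Fintype ι] (F : ι → Set Pl) (M : ℝ) (l : Fin 4) :
    IsClosed (GoodC F M l) := by
  have : GoodC F M l = ⋃ i, ⋃ j, ⋃ k, {p | Trip F i j k ∧
    ∀ q, Pairw F i j k q → 0 ≤ sgA l * la M p q ∧ 0 ≤ sgB l * lb M p q} := by
    ext p; simp [GoodC]
  rw [this]
  refine isClosed_iUnion_of_finite fun i => isClosed_iUnion_of_finite fun j =>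
    isClosed_iUnion_of_finite fun k => ?_
  have : {p | Trip F i j k ∧
    ∀ q, Pairw F i j k q → 0 ≤ sgA l * la M p q ∧ 0 ≤ sgB l * lb M p q} =
    {p : ℝ × ℝ × ℝ | Trip F i j k} ∩ ⋂ q, ⋂ (_ : Pairw F i j k q),
      ({p | 0 ≤ sgA l * la M p q} ∩ {p | 0 ≤ sgB l * lb M p q}) := by
    ext p; simp
  rw [this]
  refine isClosed_const.inter (isClosed_iInter fun q => isClosed_iInter fun _ =>
    IsClosed.inter (isClosed_le continuous_const ?_) (isClosed_le continuous_const ?_))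
  · unfold la; fun_prop
  · unfold lb; fun_prop

/-- A convex set meeting all four closed quadrants contains the centre. -/
theorem four_quadrants {a b : Pl → ℝ} (ha : Aff a) (hb : Aff b)
    (hinj : ∀ p q, a p = a q → b p = b q → p = q) {x0 : Pl} (hx : a x0 = 0) (hx' : b x0 = 0)
    {G : Set Pl} (hG : Convex ℝ G)
    (h : ∀ l, ∃ q ∈ G, 0 ≤ sgA l * a q ∧ 0 ≤ sgB l * b q) : x0 ∈ G := by
  obtain ⟨p0, m0, h0⟩ := h 0
  obtain ⟨p1, m1, h1⟩ := h 1
  obtain ⟨p2, m2, h2⟩ := h 2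
  obtain ⟨p3, m3, h3⟩ := h 3
  simp [sgA, sgB] at h0 h1 h2 h3
  obtain ⟨s, t, hs, ht, hst, e⟩ := hb.ivt (x := p0) (y := p1) (κ := 0) (by linarith) (by linarith)
  obtain ⟨s', t', hs', ht', hst', e'⟩ := hb.ivt (x := p2) (y := p3) (κ := 0)
    (by linarith) (by linarith)
  have n1 := hG m0 m1 hs ht hst
  have n2 := hG m2 m3 hs' ht' hst'
  have q1 : 0 ≤ a (s • p0 + t • p1) := by
    rw [ha.comb _ _ _ _ hst]
    have := mul_nonneg hs h0.1
    have := mul_nonneg ht h1.1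
    linarith
  have q2 : a (s' • p2 + t' • p3) ≤ 0 := by
    rw [ha.comb _ _ _ _ hst']
    have := mul_nonpos_of_nonneg_of_nonpos hs' h2.1
    have := mul_nonpos_of_nonneg_of_nonpos ht' h3.1
    linarith
  obtain ⟨c, d, hc, hd, hcd, e2⟩ := ha.ivt q2 q1
  have n3 := hG n2 n1 hc hd hcd
  have : x0 = c • (s' • p2 + t' • p3) + d • (s • p0 + t • p1) := by
    apply hinj
    · rw [hx, e2]
    · rw [hx', hb.comb _ _ _ _ hcd, e, e']; ring
  rw [this]; exact n3

theorem sg_cases {x y : ℝ} (hx : x ≠ 0) (hy : y ≠ 0) :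
    ∃ l, 0 < sgA l * x ∧ 0 < sgB l * y := by
  rcases lt_or_gt_of_ne hx with h | h <;> rcases lt_or_gt_of_ne hy with h' | h'
  · exact ⟨2, by simp [sgA, sgB]; exact ⟨h, h'⟩⟩
  · exact ⟨3, by simp [sgA, sgB]; exact ⟨h, h'⟩⟩
  · exact ⟨0, by simp [sgA, sgB]; exact ⟨h, h'⟩⟩
  · exact ⟨1, by simp [sgA, sgB]; exact ⟨h, h'⟩⟩

theorem pos_cross {a : Pl → ℝ} (ha : Aff a) {H : Set Pl} (hH : Convex ℝ H) {z q : Pl}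
    (hz : z ∈ H) (hq : q ∈ H) {c : ℝ} (h1 : 0 < c * a z) (h2 : ¬ 0 < c * a q) :
    ∃ p ∈ H, a p = 0 := by
  have hc : c ≠ 0 := by rintro rfl; simp at h1
  obtain ⟨p, hp, h⟩ := (ha.lin ha 0 c 0).ivt_mem hH hq hz (κ := 0)
    (by linarith) (by linarith)
  refine ⟨p, hp, ?_⟩
  have : c * a p = 0 := by linarith
  exact (mul_eq_zero.1 this).resolve_left hc

theorem bad_case {ι : Type*} [Fintype ι] (F : ι → Set Pl) (hne : ∀ i, (F i).Nonempty)
    (hc : ∀ i, IsCompact (F i)) (hv : ∀ i, Convex ℝ (F i)) (h43 : Prop43 F) (M : ℝ)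
    (p : ℝ × ℝ × ℝ) (hbad : ∀ l, ¬ GoodO F M l p) :
    ∃ C : Finset Pl, C.card ≤ 13 ∧ ∀ i, ∃ x ∈ C, x ∈ F i := by
  classical
  set n1 := p.2.1 * p.2.2 + (1 - p.2.1) * (1 - p.2.2) with hn1
  set n2 := p.2.2 - p.2.1 with hn2
  have hn : 0 < n1 * n1 + n2 * n2 := by
    by_contra hcon
    have e1 : n1 = 0 := by nlinarith [mul_self_nonneg n1, mul_self_nonneg n2]
    have e2 : n2 = 0 := by nlinarith [mul_self_nonneg n1, mul_self_nonneg n2]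
    have e3 : p.2.2 = p.2.1 := by linarith
    rw [hn1, e3] at e1
    nlinarith [mul_self_nonneg (p.2.1), mul_self_nonneg (1 - p.2.1), sq_nonneg (2 * p.2.1 - 1)]
  obtain ⟨l1, r1, φ, t1, t2, t3⟩ := track F hne hc hv (la M p) (fun q => q 0) (la_aff M p)
    ⟨0, 1, 0, fun q => by ring⟩ (by
      intro x y hx hy h
      simp only [la] at hx hy
      ext i; fin_cases i
      · exact h
      · show x 1 = y 1
        linarith)
  obtain ⟨l2, r2, ψ, T1, T2, T3⟩ := track F hne hc hv (lb M p)
    (fun q => -n2 * q 0 + n1 * q 1) (lb_aff M p) ⟨0, -n2, n1, fun q => by ring⟩ (by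
      intro x y hx hy h
      simp only [lb, ← hn1, ← hn2] at hx hy
      have d1 : n1 * (x 0 - y 0) + n2 * (x 1 - y 1) = 0 := by linarith
      have d2 : -n2 * (x 0 - y 0) + n1 * (x 1 - y 1) = 0 := by linarith
      have k1 : (n1 * n1 + n2 * n2) * (x 0 - y 0) = 0 := by
        linear_combination n1 * d1 - n2 * d2
      have k2 : (n1 * n1 + n2 * n2) * (x 1 - y 1) = 0 := by
        linear_combination n2 * d1 + n1 * d2
      ext i; fin_cases i
      · have := (mul_eq_zero.1 k1).resolve_left hn.ne'
        show x 0 = y 0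
        linarith
      · have := (mul_eq_zero.1 k2).resolve_left hn.ne'
        show x 1 = y 1
        linarith)
  have mt : ∀ i j, (∃ q ∈ F i ∩ F j, la M p q = 0 ∨ lb M p q = 0) →
      Mt l1 r1 i j ∨ Mt l2 r2 i j := by
    rintro i j ⟨q, hq, h | h⟩
    · exact Or.inl (t3 i j ⟨q, hq.1, hq.2, h⟩)
    · exact Or.inr (T3 i j ⟨q, hq.1, hq.2, h⟩)
  have pairx : ∀ i j z q l, z ∈ F i → z ∈ F j → q ∈ F i → q ∈ F j →
      0 < sgA l * la M p z ∧ 0 < sgB l * lb M p z →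
      ¬ (0 < sgA l * la M p q ∧ 0 < sgB l * lb M p q) → Mt l1 r1 i j ∨ Mt l2 r2 i j := by
    intro i j z q l hzi hzj hqi hqj h1 h2
    apply mt
    have hH : Convex ℝ (F i ∩ F j) := (hv i).inter (hv j)
    rw [not_and_or] at h2
    rcases h2 with h2 | h2
    · obtain ⟨x, hx, h⟩ := pos_cross (la_aff M p) hH ⟨hzi, hzj⟩ ⟨hqi, hqj⟩ h1.1 h2
      exact ⟨x, hx, Or.inl h⟩
    · obtain ⟨x, hx, h⟩ := pos_cross (lb_aff M p) hH ⟨hzi, hzj⟩ ⟨hqi, hqj⟩ h1.2 h2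
      exact ⟨x, hx, Or.inr h⟩
  have tri : ∀ i j k, Trip F i j k → (Mt l1 r1 i j ∨ Mt l2 r2 i j) ∨
      (Mt l1 r1 i k ∨ Mt l2 r2 i k) ∨ (Mt l1 r1 j k ∨ Mt l2 r2 j k) := by
    intro i j k hT
    obtain ⟨z, hzi, hzj, hzk⟩ := hT.2.2.2
    by_cases ha : la M p z = 0
    · exact Or.inl (mt i j ⟨z, ⟨hzi, hzj⟩, Or.inl ha⟩)
    by_cases hb : lb M p z = 0
    · exact Or.inl (mt i j ⟨z, ⟨hzi, hzj⟩, Or.inr hb⟩)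
    obtain ⟨l, hl⟩ := sg_cases ha hb
    have hl' := hbad l
    simp only [GoodO, not_exists, not_and, not_forall] at hl'
    obtain ⟨q, hq, hq'⟩ := hl' i j k hT
    have hq'' : ¬ (0 < sgA l * la M p q ∧ 0 < sgB l * lb M p q) := fun h => hq' h.1 h.2
    rcases hq with ⟨m1, m2⟩ | ⟨m1, m2⟩ | ⟨m1, m2⟩
    · exact Or.inl (pairx i j z q l hzi hzj m1 m2 hl hq'')
    · exact Or.inr (Or.inl (pairx i k z q l hzi hzk m1 m2 hl hq''))
    · exact Or.inr (Or.inr (pairx j k z q l hzj hzk m1 m2 hl hq''))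
  obtain ⟨X, Y, hXY, hcov⟩ := eleven l1 r1 l2 r2 t1 T1 (by
    intro i j k m hij hik him hjk hjm hkm
    have fin : ∀ x y z, x ∈ ({i, j, k, m} : Set ι) → y ∈ ({i, j, k, m} : Set ι) →
        z ∈ ({i, j, k, m} : Set ι) → Trip F x y z → ∃ a ∈ ({i, j, k, m} : Set ι),
        ∃ b ∈ ({i, j, k, m} : Set ι), a ≠ b ∧ (Mt l1 r1 a b ∨ Mt l2 r2 a b) := by
      intro x y z hx hy hz hT
      rcases tri x y z hT with h | h | h
      · exact ⟨x, hx, y, hy, hT.1, h⟩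
      · exact ⟨x, hx, z, hz, hT.2.1, h⟩
      · exact ⟨y, hy, z, hz, hT.2.2.1, h⟩
    rcases h43 i j k m hij hik him hjk hjm hkm with h | h | h | h
    · exact fin i j k (by simp) (by simp) (by simp) ⟨hij, hik, hjk, h⟩
    · exact fin i j m (by simp) (by simp) (by simp) ⟨hij, him, hjm, h⟩
    · exact fin i k m (by simp) (by simp) (by simp) ⟨hik, him, hkm, h⟩
    · exact fin j k m (by simp) (by simp) (by simp) ⟨hjk, hjm, hkm, h⟩)
  refine ⟨X.image φ ∪ Y.image ψ, ?_, fun i => ?_⟩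
  · have h1 := Finset.card_union_le (X.image φ) (Y.image ψ)
    have h2 := Finset.card_image_le (s := X) (f := φ)
    have h3 := Finset.card_image_le (s := Y) (f := ψ)
    omega
  · rcases hcov i with ⟨x, hx, h1, h2⟩ | ⟨x, hx, h1, h2⟩
    · exact ⟨φ x, Finset.mem_union_left _ (Finset.mem_image_of_mem _ hx), t2 i x h1 h2⟩
    · exact ⟨ψ x, Finset.mem_union_right _ (Finset.mem_image_of_mem _ hx), T2 i x h1 h2⟩

theorem vec3_ne {ι : Type*} {i j k : ι} (hij : i ≠ j) (hik : i ≠ k) (hjk : j ≠ k)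
    (x y : Fin 3) (hxy : x ≠ y) : (![i, j, k] : Fin 3 → ι) x ≠ (![i, j, k] : Fin 3 → ι) y := by
  fin_cases x <;> fin_cases y <;> first
    | exact absurd rfl hxy
    | exact hij
    | exact hik
    | exact hjk
    | exact hij.symm
    | exact hik.symm
    | exact hjk.symm

theorem vec3_pairw {ι : Type*} (F : ι → Set Pl) (i j k : ι) (q : Pl)
    (x y : Fin 3) (hxy : x ≠ y) (h1 : q ∈ F ((![i, j, k] : Fin 3 → ι) x))
    (h2 : q ∈ F ((![i, j, k] : Fin 3 → ι) y)) : Pairw F i j k q := by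
  fin_cases x <;> fin_cases y <;> first
    | exact absurd rfl hxy
    | exact Or.inl ⟨h1, h2⟩
    | exact Or.inl ⟨h2, h1⟩
    | exact Or.inr (Or.inl ⟨h1, h2⟩)
    | exact Or.inr (Or.inl ⟨h2, h1⟩)
    | exact Or.inr (Or.inr ⟨h1, h2⟩)
    | exact Or.inr (Or.inr ⟨h2, h1⟩)

theorem good_case {ι : Type*} [Fintype ι] (F : ι → Set Pl) (hne : ∀ i, (F i).Nonempty)
    (hc : ∀ i, IsCompact (F i)) (hv : ∀ i, Convex ℝ (F i)) (h43 : Prop43 F)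
    (hfat : ∀ i j k, ∀ p ∈ F i, p ∈ F j → p ∈ F k → ∃ q ∈ F i, q ∈ F j ∧ q ∈ F k ∧ q 1 ≠ p 1)
    (M u v w : ℝ) (hv0 : 0 ≤ v ∧ v ≤ 1) (hw0 : 0 ≤ w ∧ w ≤ 1)
    (hgood : ∀ l, (u, v, w) ∈ GoodC F M l) :
    ∃ C : Finset Pl, C.card ≤ 13 ∧ ∀ i, ∃ x ∈ C, x ∈ F i := by
  classical
  have hn : v * w + (1 - v) * (1 - w) ≠ 0 := by
    intro h
    have g1 : 0 ≤ v * w := mul_nonneg hv0.1 hw0.1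
    have g2 : 0 ≤ (1 - v) * (1 - w) := mul_nonneg (sub_nonneg.2 hv0.2) (sub_nonneg.2 hw0.2)
    have e1 : v * w = 0 := by linarith
    have e2 : (1 - v) * (1 - w) = 0 := by linarith
    have hvw : (v = 0 ∧ w = 1) ∨ (v = 1 ∧ w = 0) := by
      rcases mul_eq_zero.1 e1 with h1 | h1
      · left; refine ⟨h1, ?_⟩; rw [h1] at e2; linarith
      · right; refine ⟨?_, h1⟩; rw [h1] at e2; linarith
    have hno : ∀ l, (∀ q, 0 ≤ sgA l * la M (u, v, w) q → 0 ≤ sgB l * lb M (u, v, w) q →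
        la M (u, v, w) q = 0) → False := by
      intro l hl
      obtain ⟨i, j, k, hT, h⟩ := hgood l
      obtain ⟨z, m1, m2, m3⟩ := hT.2.2.2
      obtain ⟨q, k1, k2, k3, k4⟩ := hfat i j k z m1 m2 m3
      have hz := h z (Or.inl ⟨m1, m2⟩)
      have hq := h q (Or.inl ⟨k1, k2⟩)
      have a1 := hl z hz.1 hz.2
      have a2 := hl q hq.1 hq.2
      simp only [la] at a1 a2
      exact k4 (by linarith)
    rcases hvw with ⟨rfl, rfl⟩ | ⟨rfl, rfl⟩
    · apply hno 0
      intro q h1 h2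
      simp [sgA, sgB, la, lb] at h1 h2 ⊢
      linarith
    · apply hno 1
      intro q h1 h2
      simp [sgA, sgB, la, lb] at h1 h2 ⊢
      linarith
  set a := la M (u, v, w) with ha
  set b := lb M (u, v, w) with hb
  have haff : Aff a := la_aff _ _
  have hbff : Aff b := lb_aff _ _
  have hinj : ∀ p q, a p = a q → b p = b q → p = q := by
    intro p q h1 h2
    simp only [ha, hb, la, lb] at h1 h2
    have e1 : p 1 = q 1 := by linarith
    rw [e1] at h2
    have e0 : (v * w + (1 - v) * (1 - w)) * p 0 = (v * w + (1 - v) * (1 - w)) * q 0 := by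
      linarith
    have e0 := mul_left_cancel₀ hn e0
    ext i; fin_cases i
    · exact e0
    · exact e1
  have hsurj : ∀ c d, ∃ x, a x = c ∧ b x = d := by
    intro c d
    refine ⟨![(d + M * (v + w - 1) - (w - v) * c) / (v * w + (1 - v) * (1 - w)),
      c + M * (1 - 2 * u)], ?_, ?_⟩
    · simp [ha, la]
    · simp only [hb, lb, Matrix.cons_val_zero, Matrix.cons_val_one]
      rw [mul_div_cancel₀ _ hn]; ring
  obtain ⟨x0, hx, hx'⟩ := hsurj 0 0
  have hcl : ∀ l, ∃ C : Finset Pl, C.card ≤ 2 ∧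
      ∀ i, (∀ q ∈ F i, ¬ (0 ≤ sgA l * a q ∧ 0 ≤ sgB l * b q)) → ∃ x ∈ C, x ∈ F i := by
    intro l
    have hA0 : sgA l ≠ 0 := by fin_cases l <;> simp [sgA]
    have hB0 : sgB l ≠ 0 := by fin_cases l <;> simp [sgB]
    obtain ⟨i, j, k, hT, h⟩ := hgood l
    obtain ⟨hij, hik, hjk, z, m1, m2, m3⟩ := hT
    obtain ⟨C, hC, hC'⟩ := class_lemma F hne hc hv h43
      (Finset.univ.filter fun i => ∀ q ∈ F i, ¬ (0 ≤ sgA l * a q ∧ 0 ≤ sgB l * b q))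
      (α := fun q => 0 + (-sgA l) * a q + 0 * b q) (β := fun q => 0 + (-sgB l) * b q + 0 * a q)
      (haff.lin hbff _ _ _) (hbff.lin haff _ _ _)
      (by
        intro p q h1 h2
        apply hinj
        · apply mul_left_cancel₀ hA0; linarith
        · apply mul_left_cancel₀ hB0; linarith)
      (by
        intro c d
        obtain ⟨x, h1, h2⟩ := hsurj (-c / sgA l) (-d / sgB l)
        refine ⟨x, ?_, ?_⟩
        · rw [h1]; field_simp; ring
        · rw [h2]; field_simp; ring)
      ![i, j, k]
      (by
        intro x y hxy
        exact vec3_ne hij hik hjk x y hxy)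
      z
      (by intro x; fin_cases x <;> simp [m1, m2, m3])
      (by
        intro x y hxy q h1 h2
        have hp : Pairw F i j k q := by
          exact vec3_pairw F i j k q x y hxy h1 h2
        have := h q hp
        constructor <;> linarith)
      (by
        intro i hi q hq
        have := (Finset.mem_filter.1 hi).2 q hq
        rw [not_and_or] at this
        rcases this with h | h
        · left; linarith
        · right; linarith)
    exact ⟨C, hC, fun i hi => hC' i (Finset.mem_filter.2 ⟨Finset.mem_univ _, hi⟩)⟩
  choose C hC hC' using hcl
  refine ⟨{x0} ∪ Finset.univ.biUnion C, ?_, fun i => ?_⟩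
  · have h1 := Finset.card_union_le {x0} (Finset.univ.biUnion C)
    have h2 : (Finset.univ.biUnion C).card ≤ ∑ l, (C l).card := Finset.card_biUnion_le
    have h3 : ∑ l, (C l).card ≤ ∑ l : Fin 4, 2 := Finset.sum_le_sum fun l _ => hC l
    simp at h3
    rw [Finset.card_singleton] at h1
    omega
  · by_cases hx0 : x0 ∈ F i
    · exact ⟨x0, by simp, hx0⟩
    · have : ∃ l, ∀ q ∈ F i, ¬ (0 ≤ sgA l * a q ∧ 0 ≤ sgB l * b q) := by
        by_contra hcon
        push Not at hcon
        exact hx0 (four_quadrants haff hbff hinj hx hx' (hv i) hcon)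
      obtain ⟨l, hl⟩ := this
      obtain ⟨x, hx, hxi⟩ := hC' l i hl
      exact ⟨x, Finset.mem_union_right _ (Finset.mem_biUnion.2 ⟨l, Finset.mem_univ _, hx⟩), hxi⟩

theorem main_compact {ι : Type*} [Fintype ι] (F : ι → Set Pl) (hne : ∀ i, (F i).Nonempty)
    (hc : ∀ i, IsCompact (F i)) (hv : ∀ i, Convex ℝ (F i)) (h43 : Prop43 F)
    (hfat : ∀ i j k, ∀ p ∈ F i, p ∈ F j → p ∈ F k → ∃ q ∈ F i, q ∈ F j ∧ q ∈ F k ∧ q 1 ≠ p 1) :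
    ∃ C : Finset Pl, C.card ≤ 13 ∧ ∀ i, ∃ x ∈ C, x ∈ F i := by
  have hM : ∃ M : ℝ, ∀ i, ∀ q ∈ F i, ‖q‖ ≤ M := by
    have h1 : ∀ i, ∃ R : ℝ, ∀ q ∈ F i, ‖q‖ ≤ R := fun i => (hc i).isBounded.exists_norm_le
    choose R hR using h1
    obtain ⟨B, hB⟩ := (Set.finite_range R).bddAbove
    exact ⟨B, fun i q hq => (hR i q hq).trans (hB ⟨i, rfl⟩)⟩
  obtain ⟨M, hM⟩ := hM
  have hM' : ∀ i, ∀ q ∈ F i, (-M ≤ q 0 ∧ q 0 ≤ M) ∧ (-M ≤ q 1 ∧ q 1 ≤ M) := fun i q hq =>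
    ⟨abs_le.1 ((norm_le_pi_norm q 0).trans (hM i q hq)),
      abs_le.1 ((norm_le_pi_norm q 1).trans (hM i q hq))⟩
  by_cases hcov : ∀ u v w : ℝ, 0 ≤ u → u ≤ 1 → 0 ≤ v → v ≤ 1 → 0 ≤ w → w ≤ 1 →
      ∃ l, GoodO F M l (u, v, w)
  · have ex : ∀ l p, GoodO F M l p → ∃ q : Pl, ((-M ≤ q 0 ∧ q 0 ≤ M) ∧ (-M ≤ q 1 ∧ q 1 ≤ M)) ∧
        0 < sgA l * la M p q ∧ 0 < sgB l * lb M p q := by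
      rintro l p ⟨i, j, k, hT, h⟩
      obtain ⟨z, m1, m2, m3⟩ := hT.2.2.2
      exact ⟨z, hM' i z m1, h z (Or.inl ⟨m1, m2⟩)⟩
    obtain ⟨u, v, w, -, hv0, hw0, hg⟩ := kkm_cube (GoodO F M) (GoodC F M) (goodC_closed F M)
      (by
        rintro l p ⟨i, j, k, hT, h⟩
        exact ⟨i, j, k, hT, fun q hq => ⟨(h q hq).1.le, (h q hq).2.le⟩⟩)
      hcov
      (by
        intro v w _ _ _ _
        constructor <;>
        · intro h
          obtain ⟨q, hq, h1, h2⟩ := ex _ _ h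
          simp [sgA, la] at h1
          linarith)
      (by
        intro v w _ _ _ _
        constructor <;>
        · intro h
          obtain ⟨q, hq, h1, h2⟩ := ex _ _ h
          simp [sgA, la] at h1
          linarith)
      (by
        intro u w _ _ _ _ h
        obtain ⟨q, hq, h1, h2⟩ := ex _ _ h
        simp [sgA, sgB, la, lb] at h1 h2
        nlinarith)
      (by
        intro u w _ _ _ _ h
        obtain ⟨q, hq, h1, h2⟩ := ex _ _ h
        simp [sgA, sgB, la, lb] at h1 h2
        nlinarith)
      (by
        intro u w _ _ _ _ h
        obtain ⟨q, hq, h1, h2⟩ := ex _ _ h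
        simp [sgA, sgB, la, lb] at h1 h2
        nlinarith)
      (by
        intro u w _ _ _ _ h
        obtain ⟨q, hq, h1, h2⟩ := ex _ _ h
        simp [sgA, sgB, la, lb] at h1 h2
        nlinarith)
    exact good_case F hne hc hv h43 hfat M u v w hv0 hw0 hg
  · push Not at hcov
    obtain ⟨u, v, w, -, -, -, -, -, -, h⟩ := hcov
    exact bad_case F hne hc hv h43 M (u, v, w) h


theorem sep_delta {ι : Type*} (X : ι → Set Pl) (hc : ∀ i, IsCompact (X i))
    (hne : ∀ i, (X i).Nonempty) (S : Finset ι) (hS : ¬ ∃ x, ∀ i ∈ S, x ∈ X i) :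
    ∃ δ : ℝ, 0 < δ ∧ δ ≤ 1 ∧ ¬ ∃ x, ∀ i ∈ S, Metric.infDist x (X i) ≤ δ := by
  rcases S.eq_empty_or_nonempty with he | ⟨i0, hi0⟩
  · exact absurd ⟨0, by simp [he]⟩ hS
  have hK : IsCompact (Metric.cthickening 1 (X i0)) := (hc i0).cthickening
  have hKne : (Metric.cthickening 1 (X i0)).Nonempty :=
    (hne i0).mono (Metric.self_subset_cthickening _)
  have hcont : Continuous (fun x => ∑ i ∈ S, Metric.infDist x (X i)) :=
    continuous_finsetSum _ fun i _ => Metric.continuous_infDist_pt _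
  obtain ⟨z, hz, hmin⟩ := hK.exists_isMinOn hKne hcont.continuousOn
  set m := ∑ i ∈ S, Metric.infDist z (X i) with hm
  have hnn : ∀ x, ∀ i ∈ S, 0 ≤ Metric.infDist x (X i) := fun x i _ => Metric.infDist_nonneg
  have hpos : 0 < m := by
    rcases (Finset.sum_nonneg (hnn z)).eq_or_lt with h | h
    · exfalso
      apply hS
      refine ⟨z, fun i hi => ?_⟩
      have := (Finset.sum_eq_zero_iff_of_nonneg (hnn z)).1 h.symm i hi
      exact ((hc i).isClosed.mem_iff_infDist_zero (hne i)).2 this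
    · exact h
  have hcp : (0 : ℝ) < (S.card : ℝ) + 1 := by positivity
  refine ⟨min 1 (m / (S.card + 1)), lt_min one_pos (div_pos hpos hcp), min_le_left _ _, ?_⟩
  rintro ⟨x, hx⟩
  have hxK : x ∈ Metric.cthickening 1 (X i0) := by
    obtain ⟨y, hy, hxy⟩ := (hc i0).exists_infDist_eq_dist (hne i0) x
    refine Metric.mem_cthickening_of_dist_le x y 1 _ hy ?_
    rw [← hxy]; exact (hx i0 hi0).trans (min_le_left _ _)
  have h1 : m ≤ ∑ i ∈ S, Metric.infDist x (X i) := hmin hxK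
  have h2 : ∑ i ∈ S, Metric.infDist x (X i) ≤ ∑ i ∈ S, m / (S.card + 1) :=
    Finset.sum_le_sum fun i hi => (hx i hi).trans (min_le_right _ _)
  rw [Finset.sum_const, nsmul_eq_mul] at h2
  have h3 : (S.card : ℝ) * (m / (S.card + 1)) < m := by
    rw [mul_div_assoc', div_lt_iff₀ hcp]; nlinarith
  linarith

/-- vertical shift -/
def shift (z : Pl) (δ : ℝ) : Pl := ![z 0, z 1 + δ]

theorem shift_one (z : Pl) (δ : ℝ) : shift z δ 1 = z 1 + δ := rfl

theorem shift_dist (z : Pl) (δ : ℝ) (hδ : 0 ≤ δ) : dist (shift z δ) z ≤ δ := by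
  rw [dist_pi_le_iff hδ]
  intro i
  fin_cases i
  · simp [shift, hδ]
  · simp [shift, abs_of_nonneg hδ]

/-- Kleitman–Gyárfás–Tóth: a finite family of at least `4` convex sets in the plane
with the `(4,3)`-property can be pierced by at most `13` points. -/
theorem piercing_431 {ι : Type*} [Fintype ι] (hcard : 4 ≤ Fintype.card ι)
    (F : ι → Set (Fin 2 → ℝ)) (hconv : ∀ i, Convex ℝ (F i))
    (hne : ∀ i, (F i).Nonempty)
    (h43 : ∀ P : Finset ι, P.card = 4 →
      ∃ Q ⊆ P, Q.card = 3 ∧ (⋂ i ∈ Q, F i).Nonempty) :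
    ∃ C : Finset (Fin 2 → ℝ), C.card ≤ 13 ∧ ∀ i, ∃ x ∈ C, x ∈ F i := by
  classical
  have hp : ∀ S : Finset ι, ∃ p : Pl, (∃ x, ∀ i ∈ S, x ∈ F i) → ∀ i ∈ S, p ∈ F i := by
    intro S
    by_cases h : ∃ x, ∀ i ∈ S, x ∈ F i
    · obtain ⟨x, hx⟩ := h; exact ⟨x, fun _ => hx⟩
    · exact ⟨0, fun h' => absurd h' h⟩
  choose p hp using hp
  let X : ι → Set Pl := fun i =>
    convexHull ℝ (p '' {S : Finset ι | i ∈ S ∧ ∃ x, ∀ i ∈ S, x ∈ F i})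
  have hXF : ∀ i, X i ⊆ F i := by
    intro i
    refine convexHull_min ?_ (hconv i)
    rintro _ ⟨S, ⟨hi, hS⟩, rfl⟩
    exact hp S hS i hi
  have hXp : ∀ S : Finset ι, (∃ x, ∀ i ∈ S, x ∈ F i) → ∀ i ∈ S, p S ∈ X i := fun S hS i hi =>
    subset_convexHull ℝ _ ⟨S, ⟨hi, hS⟩, rfl⟩
  have hXc : ∀ i, IsCompact (X i) := fun i =>
    (Set.Finite.image p (Set.toFinite _)).isCompact_convexHull (𝕜 := ℝ)
  have hXv : ∀ i, Convex ℝ (X i) := fun i => convex_convexHull ℝ _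
  have hXne : ∀ i, (X i).Nonempty := fun i =>
    ⟨p {i}, hXp {i} (by obtain ⟨x, hx⟩ := hne i; exact ⟨x, by simpa using hx⟩) i (by simp)⟩
  -- thickening
  have hδ : ∃ δ : ℝ, 0 < δ ∧ ∀ S : Finset ι, (∃ x, ∀ i ∈ S, Metric.infDist x (X i) ≤ δ) →
      ∃ x, ∀ i ∈ S, x ∈ F i := by
    have h1 : ∀ S : Finset ι, ∃ δ : ℝ, 0 < δ ∧ ((∃ x, ∀ i ∈ S, Metric.infDist x (X i) ≤ δ) →
        ∃ x, ∀ i ∈ S, x ∈ F i) := by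
      intro S
      by_cases h : ∃ x, ∀ i ∈ S, x ∈ F i
      · exact ⟨1, one_pos, fun _ => h⟩
      · obtain ⟨δ, h1, -, h2⟩ := sep_delta X hXc hXne S (fun ⟨x, hx⟩ =>
          h ⟨x, fun i hi => hXF i (hx i hi)⟩)
        exact ⟨δ, h1, fun h' => absurd h' h2⟩
    choose d hd hd' using h1
    obtain ⟨S0, hS0⟩ := Finite.exists_min d
    refine ⟨d S0, hd S0, fun S ⟨x, hx⟩ => hd' S ⟨x, fun i hi => (hx i hi).trans (hS0 S)⟩⟩
  obtain ⟨δ, hδ, hδF⟩ := hδ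
  let Y : ι → Set Pl := fun i => Metric.cthickening δ (X i)
  have hYX : ∀ i, X i ⊆ Y i := fun i => Metric.self_subset_cthickening _
  have hYF : ∀ (S : Finset ι) (x : Pl), (∀ i ∈ S, x ∈ Y i) → ∃ x, ∀ i ∈ S, x ∈ F i := by
    intro S x hx
    refine hδF S ⟨x, fun i hi => ?_⟩
    have := Metric.mem_cthickening_iff.1 (hx i hi)
    rw [Metric.infDist]
    exact ENNReal.toReal_le_of_le_ofReal hδ.le this
  have hY43 : Prop43 Y := by
    intro i j k m hij hik him hjk hjm hkm
    obtain ⟨Q, hQ, hQ3, hQn⟩ := h43 {i, j, k, m} (by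
      rw [Finset.card_insert_of_notMem, Finset.card_insert_of_notMem,
        Finset.card_insert_of_notMem, Finset.card_singleton] <;> simp [*])
    have hQn' : ∃ x, ∀ i ∈ Q, x ∈ F i := by
      obtain ⟨x, hx⟩ := hQn
      exact ⟨x, fun i hi => Set.mem_iInter₂.1 hx i hi⟩
    have hin : ∀ i ∈ Q, p Q ∈ Y i := fun i hi => hYX i (hXp Q hQn' i hi)
    have hcd : (({i, j, k, m} : Finset ι) \ Q).card = 1 := by
      rw [Finset.card_sdiff_of_subset hQ, hQ3,
        Finset.card_insert_of_notMem, Finset.card_insert_of_notMem,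
        Finset.card_insert_of_notMem, Finset.card_singleton] <;> simp [*]
    obtain ⟨x, hx⟩ := Finset.card_eq_one.1 hcd
    have hmem : ∀ y ∈ ({i, j, k, m} : Finset ι), y ≠ x → y ∈ Q := by
      intro y hy hyx
      by_contra hc
      have : y ∈ ({i, j, k, m} : Finset ι) \ Q := Finset.mem_sdiff.2 ⟨hy, hc⟩
      rw [hx, Finset.mem_singleton] at this
      exact hyx this
    have hxm : x ∈ ({i, j, k, m} : Finset ι) := by
      have : x ∈ ({i, j, k, m} : Finset ι) \ Q := by rw [hx]; simp
      exact (Finset.mem_sdiff.1 this).1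
    simp only [Finset.mem_insert, Finset.mem_singleton] at hxm
    rcases hxm with rfl | rfl | rfl | rfl
    · exact Or.inr (Or.inr (Or.inr ⟨p Q, hin _ (hmem j (by simp) hij.symm),
        hin _ (hmem k (by simp) hik.symm), hin _ (hmem m (by simp) him.symm)⟩))
    · exact Or.inr (Or.inr (Or.inl ⟨p Q, hin _ (hmem i (by simp) hij),
        hin _ (hmem k (by simp) hjk.symm), hin _ (hmem m (by simp) hjm.symm)⟩))
    · exact Or.inr (Or.inl ⟨p Q, hin _ (hmem i (by simp) hik),
        hin _ (hmem j (by simp) hjk), hin _ (hmem m (by simp) hkm.symm)⟩)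
    · exact Or.inl ⟨p Q, hin _ (hmem i (by simp) him),
        hin _ (hmem j (by simp) hjm), hin _ (hmem k (by simp) hkm)⟩
  have hfat : ∀ i j k, ∀ x ∈ Y i, x ∈ Y j → x ∈ Y k →
      ∃ q ∈ Y i, q ∈ Y j ∧ q ∈ Y k ∧ q 1 ≠ x 1 := by
    intro i j k x hi hj hk
    have hS := hYF {i, j, k} x (by simp [hi, hj, hk])
    have hpS := hXp {i, j, k} hS
    by_cases h : p {i, j, k} 1 = x 1
    · have hmem : ∀ l ∈ ({i, j, k} : Finset ι), shift (p {i, j, k}) δ ∈ Y l := by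
        intro l hl
        refine Metric.mem_cthickening_of_dist_le _ (p {i, j, k}) δ _ (hpS l hl) ?_
        exact shift_dist _ δ hδ.le
      refine ⟨shift (p {i, j, k}) δ, hmem i (by simp), hmem j (by simp), hmem k (by simp), ?_⟩
      rw [shift_one, h]
      linarith
    · exact ⟨p {i, j, k}, hYX i (hpS i (by simp)), hYX j (hpS j (by simp)),
        hYX k (hpS k (by simp)), h⟩
  obtain ⟨C, hC, hC'⟩ := main_compact Y (fun i => (hXne i).mono (hYX i))
    (fun i => (hXc i).cthickening) (fun i => (hXv i).cthickening δ) hY43 hfat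
  have hφ : ∀ x : Pl, ∃ y : Pl, ∀ i, x ∈ Y i → y ∈ F i := by
    intro x
    obtain ⟨y, hy⟩ := hYF (Finset.univ.filter fun i => x ∈ Y i) x (by simp)
    exact ⟨y, fun i hi => hy i (by simpa using hi)⟩
  choose φ hφ using hφ
  refine ⟨C.image φ, Finset.card_image_le.trans hC, fun i => ?_⟩
  obtain ⟨x, hx, hxi⟩ := hC' i
  exact ⟨φ x, Finset.mem_image_of_mem φ hx, hφ x i hxi⟩
end

section
/- Let d ≥ 1 and p ≥ q ≥ 2 be integers, let n ≥ p, and let F : Fin n → Set (ℝ^d) be a family of n nonempty convex sets in ℝ^d such that for every p-element subset P of the indices there exist q indices in P whose sets have a common point. Then there exists a point x ∈ ℝ^d such that the number of indices i with x ∈ F i is at least (1 - (1 - (C(q,d+1)/C(p,d+1)))^(1/(d+1))) · n, where C(a,b) denotes the binomial coefficient a choose b. -/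
/-- Skew set-pair inequality. -/
lemma skew_bollobas {n a b : ℕ} {ι κ : Type*} [Fintype ι] [LinearOrder κ]
    (A B : ι → Finset (Fin n)) (hA : ∀ i, (A i).card = a) (hB : ∀ i, (B i).card = b)
    (hAB : ∀ i, Disjoint (A i) (B i)) (key : ι → κ)
    (h : ∀ i j, Disjoint (A i) (B j) → i ≠ j → key i < key j) :
    Fintype.card ι ≤ (a + b).choose b := by
  classical
  let mono : (m : ℕ) → Sym (Fin (a + 1)) m → ((Fin (a + 1) → ℝ) → ℝ) :=
    fun m s x => (s.1.map x).prod
  let f : Finset (Fin n) → ((Fin (a + 1) → ℝ) → ℝ) :=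
    fun T x => ∏ t ∈ T, ∑ k, x k * (t.val : ℝ) ^ (k : ℕ)
  have hmem : ∀ T : Finset (Fin n), ∀ m, T.card = m →
      f T ∈ Submodule.span ℝ (Set.range (mono m)) := by
    intro T
    induction T using Finset.induction_on with
    | empty =>
      intro m hm
      obtain rfl : 0 = m := by simpa using hm
      apply Submodule.subset_span
      refine ⟨⟨0, by simp⟩, ?_⟩
      funext x
      simp only [f, Finset.prod_empty]
      change (Multiset.map x 0).prod = 1
      simp
    | insert t T ht ih =>
      intro m hm
      rw [Finset.card_insert_of_notMem ht] at hm
      subst hm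
      have ih' := ih _ rfl
      have key2 : ∀ g ∈ Submodule.span ℝ (Set.range (mono T.card)),
          (fun x : Fin (a + 1) → ℝ => (∑ k, x k * (t.val : ℝ) ^ (k : ℕ)) * g x) ∈
            Submodule.span ℝ (Set.range (mono (T.card + 1))) := by
        intro g hg
        induction hg using Submodule.span_induction with
        | mem g hg =>
          obtain ⟨s, rfl⟩ := hg
          have : (fun x : Fin (a + 1) → ℝ => (∑ k, x k * (t.val : ℝ) ^ (k : ℕ)) * mono _ s x)
              = ∑ k : Fin (a + 1), ((t.val : ℝ) ^ (k : ℕ)) • mono (T.card + 1) (k ::ₛ s) := by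
            funext x
            simp only [Finset.sum_apply, Pi.smul_apply, smul_eq_mul, mono, Finset.sum_mul]
            refine Finset.sum_congr rfl fun k _ => ?_
            have : ((k ::ₛ s : Sym _ _) : Multiset _) = k ::ₘ s.1 := rfl
            change _ = _ * (Multiset.map x (k ::ₘ s.1)).prod
            rw [Multiset.map_cons, Multiset.prod_cons]
            ring
          rw [this]
          exact Submodule.sum_mem _ fun k _ => Submodule.smul_mem _ _
            (Submodule.subset_span ⟨_, rfl⟩)
        | zero =>
          convert Submodule.zero_mem _ using 1
          funext x; simp
        | add g₁ g₂ _ _ h₁ h₂ =>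
          convert Submodule.add_mem _ h₁ h₂ using 1
          funext x; simp [mul_add]
        | smul c g _ hg =>
          convert Submodule.smul_mem _ c hg using 1
          funext x; simp; ring
      have := key2 _ ih'
      convert this using 1
      funext x
      simp [f, Finset.prod_insert ht]
  let P : ι → Polynomial ℝ := fun i => ∏ t ∈ A i, (Polynomial.X - Polynomial.C (t.val : ℝ))
  let pt : ι → (Fin (a + 1) → ℝ) := fun i k => (P i).coeff k
  have hdeg : ∀ i, (P i).natDegree = a := by
    intro i
    simp only [P]
    rw [Polynomial.natDegree_finsetProd_X_sub_C_eq_card, hA]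
  have heval : ∀ i (s : ℝ), ∑ k, pt i k * s ^ (k : ℕ) = ∏ t ∈ A i, (s - (t.val : ℝ)) := by
    intro i s
    have : (P i).eval s = ∏ t ∈ A i, (s - (t.val : ℝ)) := by
      simp [P, Polynomial.eval_prod]
    rw [← this, Polynomial.eval_eq_sum_range' (n := a + 1) (by rw [hdeg]; omega),
      Finset.sum_range]
  have hf : ∀ i T, f T (pt i) ≠ 0 ↔ Disjoint (A i) T := by
    intro i T
    simp only [f, heval]
    rw [Finset.prod_ne_zero_iff, Finset.disjoint_right]
    refine forall₂_congr fun t _ => ?_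
    rw [Finset.prod_ne_zero_iff]
    constructor
    · intro h1 h2
      exact h1 t h2 (by simp)
    · intro h1 s hs h2
      have : (t.val : ℝ) = s.val := by linarith
      have : t = s := Fin.ext (by exact_mod_cast this)
      exact h1 (this ▸ hs)
  have hli : LinearIndependent ℝ (fun i => f (B i)) := by
    rw [Fintype.linearIndependent_iff]
    intro c hc
    by_contra hcon
    push Not at hcon
    have hne : (Finset.univ.filter fun i => c i ≠ 0).Nonempty := by
      obtain ⟨i, hi⟩ := hcon
      exact ⟨i, by simpa using hi⟩
    obtain ⟨i, hi, hmax⟩ := Finset.exists_max_image _ key hne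
    have h0 := congrFun hc (pt i)
    simp only [Finset.sum_apply, Pi.smul_apply, smul_eq_mul, Pi.zero_apply] at h0
    rw [Finset.sum_eq_single i] at h0
    · rcases mul_eq_zero.1 h0 with h1 | h1
      · exact (Finset.mem_filter.1 hi).2 h1
      · exact (hf i _).2 (hAB i) h1
    · intro j _ hj
      by_contra hcj
      have h1 : c j ≠ 0 := left_ne_zero_of_mul hcj
      have h2 := (hf i _).1 (right_ne_zero_of_mul hcj)
      exact absurd (hmax j (by simpa using h1)) (not_le.2 (h i j h2 (Ne.symm hj)))
    · simp
  have := linearIndependent_le_span_aux' _ hli (Set.range (mono b)) (by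
    rintro _ ⟨i, rfl⟩
    exact hmem _ _ (hB i))
  refine this.trans ?_
  refine (Fintype.card_range_le _).trans ?_
  rw [Sym.card_sym_eq_choose]
  rw [Fintype.card_fin, show a + 1 + b - 1 = a + b by omega]

lemma collapse_count {n d r : ℕ} {κ : Type*} [LinearOrder κ] (hr : d + r ≤ n)
    (LL SS : Finset (Finset (Fin n))) (M : Finset (Fin n) → Finset (Fin n))
    (key : Finset (Fin n) → κ)
    (hL : ∀ L ∈ LL, L.card = d) (hLM : ∀ L ∈ LL, L ⊆ M L)
    (hM : ∀ L ∈ LL, (M L).card ≤ d + r)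
    (hkey : ∀ L ∈ LL, ∀ L' ∈ LL, L ⊆ M L' → L ≠ L' → key L < key L')
    (hS : ∀ S ∈ SS, S.card = d + 1)
    (hSL : ∀ S ∈ SS, ∃ L ∈ LL, L ⊆ S ∧ S ⊆ M L) :
    SS.card ≤ ∑ j ∈ Finset.range r, (n - (j + 1)).choose d := by
  classical
  have h1 : SS ⊆ LL.biUnion (fun L => (M L \ L).image (fun y => insert y L)) := by
    intro S hSS
    obtain ⟨L, hLL, hLS, hSM⟩ := hSL S hSS
    have hc : (S \ L).card = 1 := by
      rw [Finset.card_sdiff_of_subset hLS, hS S hSS, hL L hLL]; omega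
    obtain ⟨y, hy⟩ := Finset.card_eq_one.1 hc
    have hyS : y ∈ S \ L := by rw [hy]; simp
    rw [Finset.mem_sdiff] at hyS
    simp only [Finset.mem_biUnion, Finset.mem_image, Finset.mem_sdiff]
    refine ⟨L, hLL, y, ⟨hSM hyS.1, hyS.2⟩, ?_⟩
    rw [Finset.insert_eq, ← hy, Finset.sdiff_union_of_subset hLS]
  have h2 : SS.card ≤ ∑ L ∈ LL, (M L \ L).card := by
    refine (Finset.card_le_card h1).trans (Finset.card_biUnion_le.trans ?_)
    exact Finset.sum_le_sum fun L _ => Finset.card_image_le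
  have h3 : ∀ L ∈ LL, (M L \ L).card =
      ∑ j ∈ Finset.range r, if j < (M L \ L).card then 1 else 0 := by
    intro L hLL
    have hle : (M L \ L).card ≤ r := by
      rw [Finset.card_sdiff_of_subset (hLM L hLL), hL L hLL]
      have := hM L hLL; omega
    rw [← Finset.card_filter]
    have : (Finset.range r).filter (fun j => j < (M L \ L).card) =
        Finset.range (M L \ L).card := by
      ext j; simp; omega
    rw [this, Finset.card_range]
  rw [Finset.sum_congr rfl h3, Finset.sum_comm] at h2
  refine h2.trans (Finset.sum_le_sum fun j hj => ?_)
  rw [Finset.mem_range] at hj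
  rw [← Finset.card_filter]
  set T := LL.filter (fun L => j < (M L \ L).card) with hT
  have hT1 : ∀ L : T, L.1 ∈ LL := fun L => (Finset.mem_filter.1 L.2).1
  have hT2 : ∀ L : T, ∃ M', L.1 ⊆ M' ∧ M' ⊆ M L.1 ∧ M'.card = d + j + 1 := by
    intro L
    have hlt := (Finset.mem_filter.1 L.2).2
    apply Finset.exists_subsuperset_card_eq (hLM _ (hT1 L))
    · rw [hL _ (hT1 L)]; omega
    · rw [Finset.card_sdiff_of_subset (hLM _ (hT1 L)), hL _ (hT1 L)] at hlt
      omega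
  choose M' hM1 hM2 hM3 using hT2
  have := skew_bollobas (a := d) (b := n - (d + j + 1)) (fun L : T => L.1) (fun L => (M' L)ᶜ)
    (fun L => hL _ (hT1 L)) (fun L => by rw [Finset.card_compl, hM3, Fintype.card_fin])
    (fun L => by
      exact disjoint_compl_right_iff.2 (hM1 L)) (fun L => key L.1)
    (fun L L' hd hne => by
      have hd' : L.1 ⊆ M' L' := disjoint_compl_right_iff.1 hd
      exact hkey _ (hT1 L) _ (hT1 L') (hd'.trans (hM2 L')) (fun h => hne (Subtype.ext h)))
  rw [Fintype.card_coe] at this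
  refine this.trans (le_of_eq ?_)
  rw [show d + (n - (d + j + 1)) = n - (j + 1) by omega]
  exact Nat.choose_symm_of_eq_add (by omega)

lemma sum_choose_eq (n d r : ℕ) (hr : r ≤ n) :
    (∑ j ∈ Finset.range r, (n - (j + 1)).choose d) + (n - r).choose (d + 1) = n.choose (d + 1) := by
  induction r with
  | zero => simp
  | succ r ih =>
    rw [Finset.sum_range_succ]
    have := ih (by omega)
    have h : n - r = (n - (r + 1)) + 1 := by omega
    rw [h, Nat.choose_succ_succ] at this
    simp only [Nat.succ_eq_add_one] at this
    omega

/-- `x` is a point of minimal norm in the intersection of the sets `C i`, `i ∈ S`. -/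
def IsMinPt {n d : ℕ} (C : Fin n → Set (EuclideanSpace ℝ (Fin d))) (S : Finset (Fin n))
    (x : EuclideanSpace ℝ (Fin d)) : Prop :=
  (∀ i ∈ S, x ∈ C i) ∧ ∀ y, (∀ i ∈ S, y ∈ C i) → ‖x‖ ≤ ‖y‖

lemma isMinPt_exists {n d : ℕ} {C : Fin n → Set (EuclideanSpace ℝ (Fin d))}
    (hcl : ∀ i, IsClosed (C i)) (S : Finset (Fin n)) (hS : ∃ x, ∀ i ∈ S, x ∈ C i) :
    ∃ x, IsMinPt C S x := by
  have hcl' : IsClosed (⋂ i ∈ S, C i) := isClosed_biInter fun i _ => hcl i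
  obtain ⟨x₀, hx₀⟩ := hS
  obtain ⟨x, hx, hx2⟩ := hcl'.exists_infDist_eq_dist ⟨x₀, by simpa using hx₀⟩ 0
  refine ⟨x, by simpa using hx, fun y hy => ?_⟩
  have := Metric.infDist_le_dist_of_mem (x := (0 : EuclideanSpace ℝ (Fin d)))
    (s := ⋂ i ∈ S, C i) (y := y) (by simpa using hy)
  rw [hx2] at this
  simpa using this

lemma isMinPt_unique {n d : ℕ} {C : Fin n → Set (EuclideanSpace ℝ (Fin d))}
    (hconv : ∀ i, Convex ℝ (C i)) {S : Finset (Fin n)} {x y : EuclideanSpace ℝ (Fin d)}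
    (hx : IsMinPt C S x) (hy : ∀ i ∈ S, y ∈ C i) (hxy : ‖y‖ ≤ ‖x‖) : x = y := by
  by_contra hne
  have h1 := norm_combo_lt_of_ne (le_refl ‖x‖) hxy hne (a := 1/2) (b := 1/2) (by norm_num)
    (by norm_num) (by norm_num)
  have h2 := hx.2 _ (fun i hi => hconv i (hx.1 i hi) (hy i hi) (a := 1/2) (b := 1/2) (by norm_num)
    (by norm_num) (by norm_num))
  linarith

lemma isMinPt_helly {n d : ℕ} {C : Fin n → Set (EuclideanSpace ℝ (Fin d))}
    (hconv : ∀ i, Convex ℝ (C i)) {S : Finset (Fin n)} (hS : S.card = d + 1)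
    {x : EuclideanSpace ℝ (Fin d)} (hx : IsMinPt C S x) :
    ∃ i ∈ S, IsMinPt C (S.erase i) x := by
  classical
  by_contra hcon
  push Not at hcon
  have hpt : ∀ i ∈ S, ∃ y, (∀ j ∈ S.erase i, y ∈ C j) ∧ ‖y‖ < ‖x‖ := by
    intro i hi
    by_contra h
    push Not at h
    exact hcon i hi ⟨fun j hj => hx.1 j (Finset.mem_of_mem_erase hj), h⟩
  let F : Option (Fin n) → Set (EuclideanSpace ℝ (Fin d)) := fun o =>
    o.elim (Metric.ball 0 ‖x‖) C
  have := Convex.helly_theorem' (𝕜 := ℝ) (F := F) (s := Finset.insertNone S) (by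
      intro o _
      cases o with
      | none => exact convex_ball _ _
      | some i => exact hconv i) (by
      intro I hI hIc
      rw [finrank_euclideanSpace_fin] at hIc
      by_cases hnone : none ∈ I
      · have : ∃ i ∈ S, some i ∉ I := by
          by_contra hall
          push Not at hall
          have : Finset.insertNone S ⊆ I := by
            intro o ho
            cases o with
            | none => exact hnone
            | some i => exact hall i (by simpa using ho)
          have := Finset.card_le_card this
          rw [Finset.card_insertNone, hS] at this
          omega
        obtain ⟨i, hi, hiI⟩ := this
        obtain ⟨y, hy, hyx⟩ := hpt i hi
        refine ⟨y, ?_⟩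
        simp only [Set.mem_iInter]
        intro o ho
        cases o with
        | none => simpa [F] using hyx
        | some j =>
          have hj : j ∈ S := by simpa using hI ho
          exact hy j (Finset.mem_erase.2 ⟨fun h => hiI (h ▸ ho), hj⟩)
      · refine ⟨x, ?_⟩
        simp only [Set.mem_iInter]
        intro o ho
        cases o with
        | none => exact absurd ho hnone
        | some j => exact hx.1 j (by simpa using hI ho))
  obtain ⟨y, hy⟩ := this
  simp only [Set.mem_iInter] at hy
  have h1 : ‖y‖ < ‖x‖ := by simpa [F] using hy none (by simp)
  have h2 := hx.2 y (fun i hi => hy (some i) (by simpa using hi))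
  linarith

lemma sum_lt_of_swap {n : ℕ} {L L' : Finset (Fin n)} (hc : L.card = L'.card) (hne : L ≠ L')
    (h : ∀ y ∈ L \ L', ∀ z ∈ L' \ L, z < y) :
    ∑ z ∈ L', z.val < ∑ z ∈ L, z.val := by
  classical
  have hc2 : (L \ L').card = (L' \ L).card := Finset.card_sdiff_comm hc
  have hne2 : (L' \ L).Nonempty := by
    rw [Finset.nonempty_iff_ne_empty]
    intro h0
    rw [Finset.sdiff_eq_empty_iff_subset] at h0
    exact hne (Finset.eq_of_subset_of_card_le h0 hc.le).symm
  obtain ⟨m, hm, hmax⟩ := Finset.exists_max_image (L' \ L) (fun z => z) hne2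
  have h1 : ∑ z ∈ L' \ L, z.val ≤ (L' \ L).card • m.val :=
    Finset.sum_le_card_nsmul _ _ _ fun z hz => hmax z hz
  have h2 : (L \ L').card • (m.val + 1) ≤ ∑ z ∈ L \ L', z.val :=
    Finset.card_nsmul_le_sum _ _ _ fun y hy => h y hy m hm
  have h3 : 0 < (L' \ L).card := Finset.card_pos.2 hne2
  rw [hc2] at h2
  simp only [smul_eq_mul] at h1 h2
  have h4 := Finset.sum_inter_add_sum_sdiff L L' (fun z => z.val)
  have h5 := Finset.sum_inter_add_sum_sdiff L' L (fun z => z.val)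
  rw [Finset.inter_comm] at h5
  nlinarith

lemma exists_generic {n : ℕ} {K : Type*} [Fintype K] (Bad : K → Set (Fin n → ℝ))
    (dir : K → Fin n)
    (h : ∀ k, ∀ e ∈ Bad k, ∀ e' ∈ Bad k, (∀ j, j ≠ dir k → e j = e' j) → e = e')
    {δ : ℝ} (hδ : 0 < δ) :
    ∃ e : Fin n → ℝ, (∀ i, 0 < e i ∧ e i < δ) ∧ ∀ k, e ∉ Bad k := by
  classical
  by_contra hcon
  push Not at hcon
  set N := Fintype.card K + 1 with hN
  let g : (Fin n → Fin N) → (Fin n → ℝ) := fun f i => δ * (((f i).val : ℝ) + 1) / (N + 1)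
  have hNp : (0 : ℝ) < N + 1 := by positivity
  have hg : ∀ f, ∃ k, g f ∈ Bad k := by
    intro f
    apply hcon
    intro i
    refine ⟨by positivity, ?_⟩
    simp only [g]
    rw [div_lt_iff₀ hNp]
    have : ((f i).val : ℝ) < N := by exact_mod_cast (f i).2
    nlinarith
  choose k hk using hg
  have hginj : Function.Injective g := by
    intro f f' hff
    funext i
    have := congrFun hff i
    simp only [g] at this
    field_simp at this
    apply Fin.ext
    have h2 : ((f i).val : ℝ) = (f' i).val := by linarith
    exact_mod_cast h2
  let φ : (Fin n → Fin N) → Σ k : K, ({j // j ≠ dir k} → Fin N) :=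
    fun f => ⟨k f, fun j => f j.1⟩
  have hφ : Function.Injective φ := by
    intro f f' hff
    simp only [φ, Sigma.mk.injEq] at hff
    obtain ⟨h1, h2⟩ := hff
    apply hginj
    apply h (k f) _ (hk f) _ (h1 ▸ hk f')
    intro j hj
    have h3 : f j = f' j := by
      have : ∀ (k1 k2 : K) (u : {j // j ≠ dir k1} → Fin N) (v : {j // j ≠ dir k2} → Fin N),
          k1 = k2 → u ≍ v → ∀ j (hj : j ≠ dir k1) (hj' : j ≠ dir k2), u ⟨j, hj⟩ = v ⟨j, hj'⟩ := by
        rintro k1 _ u v rfl huv j hj hj'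
        rw [eq_of_heq huv]
      exact this _ _ _ _ h1 h2 j hj (h1 ▸ hj)
    simp only [g, h3]
  have hcard := Fintype.card_le_of_injective φ hφ
  rw [Fintype.card_sigma] at hcard
  simp only [Fintype.card_fun, Fintype.card_fin, ne_eq, Fintype.card_subtype_compl,
    Fintype.card_unique, Finset.sum_const, Finset.card_univ, smul_eq_mul] at hcard
  rcases isEmpty_or_nonempty K with hK | ⟨⟨k0⟩⟩
  · have : Fintype.card K = 0 := Fintype.card_eq_zero
    rw [this] at hN
    simp [hN] at hcard
  · have hn : 0 < n := (dir k0).pos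
    obtain ⟨m, rfl⟩ : ∃ m, n = m + 1 := ⟨n - 1, by omega⟩
    rw [Nat.add_sub_cancel, pow_succ] at hcard
    have : 0 < N ^ m := by positivity
    nlinarith

lemma exists_thickening {n d : ℕ} (K : Fin n → Set (EuclideanSpace ℝ (Fin d)))
    (hK : ∀ i, IsCompact (K i)) (hne : ∀ i, (K i).Nonempty) :
    ∃ δ > 0, ∀ G : Finset (Fin n), (∃ x, ∀ i ∈ G, x ∈ Metric.cthickening δ (K i)) →
      ∃ x, ∀ i ∈ G, x ∈ K i := by
  have key : ∀ G : Finset (Fin n), ∃ δ > 0, (∃ x, ∀ i ∈ G, x ∈ Metric.cthickening δ (K i)) →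
      ∃ x, ∀ i ∈ G, x ∈ K i := by
    intro G
    by_cases hG : ∃ x, ∀ i ∈ G, x ∈ K i
    · exact ⟨1, one_pos, fun _ => hG⟩
    have hGne : G.Nonempty := by
      rw [Finset.nonempty_iff_ne_empty]
      rintro rfl
      exact hG ⟨0, by simp⟩
    obtain ⟨i0, hi0⟩ := hGne
    let g : EuclideanSpace ℝ (Fin d) → ℝ := fun x => ∑ i ∈ G, Metric.infDist x (K i)
    have hgc : Continuous g := continuous_finsetSum _ fun i _ => Metric.continuous_infDist_pt _
    obtain ⟨x0, hx0, hmin⟩ := ((hK i0).cthickening (r := 1)).exists_isMinOn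
      ((hne i0).mono (Metric.self_subset_cthickening _)) hgc.continuousOn
    have hpos : 0 < g x0 := by
      by_contra hle
      have h0 : g x0 = 0 := le_antisymm (not_lt.1 hle)
        (Finset.sum_nonneg fun i _ => Metric.infDist_nonneg)
      rw [Finset.sum_eq_zero_iff_of_nonneg (fun i _ => Metric.infDist_nonneg)] at h0
      exact hG ⟨x0, fun i hi =>
        ((hK i).isClosed.mem_iff_infDist_zero (hne i)).2 (h0 i hi)⟩
    refine ⟨min 1 (g x0 / (G.card + 1)), by positivity, ?_⟩
    rintro ⟨x, hx⟩
    exfalso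
    have h1 : g x0 ≤ g x := hmin (Metric.cthickening_mono (min_le_left _ _) _ (hx i0 hi0))
    have h2 : g x ≤ G.card • (g x0 / (G.card + 1)) := by
      apply Finset.sum_le_card_nsmul
      intro i hi
      have := hx i hi
      rw [Metric.mem_cthickening_iff] at this
      have h3 := ENNReal.toReal_mono ENNReal.ofReal_ne_top this
      rw [ENNReal.toReal_ofReal (by positivity)] at h3
      exact h3.trans (min_le_right _ _)
    rw [nsmul_eq_mul] at h2
    have h4 : (G.card : ℝ) * (g x0 / (G.card + 1)) < g x0 := by
      rw [← mul_div_assoc, div_lt_iff₀ (by positivity)]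
      nlinarith
    linarith
  choose δ hδ hδ2 using key
  obtain ⟨G0, -, hmin⟩ := Finset.exists_min_image Finset.univ δ ⟨∅, by simp⟩
  refine ⟨δ G0, hδ G0, fun G ⟨x, hx⟩ => hδ2 G ⟨x, fun i hi =>
    Metric.cthickening_mono (hmin G (by simp)) _ (hx i hi)⟩⟩

lemma bad_aux {n d : ℕ} (K : Fin n → Set (EuclideanSpace ℝ (Fin d)))
    (hK : ∀ i, Convex ℝ (K i)) {e e' : Fin n → ℝ} {i : Fin n} (he : e i < e' i)
    (he0 : 0 < e' i)
    (hag : ∀ j, j ≠ i → e j = e' j) {B B' : Finset (Fin n)} (hiB' : i ∉ B')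
    {x x' y x₂ x₂' : EuclideanSpace ℝ (Fin d)}
    (h1 : IsMinPt (fun j => Metric.cthickening (e j) (K j)) B x)
    (h2 : IsMinPt (fun j => Metric.cthickening (e j) (K j)) B' x')
    (h3 : ‖x‖ = ‖x'‖)
    (hy : ∀ j ∈ B.erase i, y ∈ Metric.cthickening (e j) (K j)) (hyx : ‖y‖ < ‖x‖)
    (h4 : IsMinPt (fun j => Metric.cthickening (e' j) (K j)) B x₂)
    (h5 : IsMinPt (fun j => Metric.cthickening (e' j) (K j)) B' x₂')
    (h6 : ‖x₂‖ = ‖x₂'‖) (hiB : i ∈ B) : False := by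
  have hB' : ‖x'‖ ≤ ‖x₂'‖ := h2.2 _ fun j hj => by
    have := h5.1 j hj
    change x₂' ∈ Metric.cthickening (e j) (K j)
    rw [hag j (fun h => hiB' (h ▸ hj))]
    exact this
  have hx : x ∈ Metric.thickening (e' i) (K i) :=
    Metric.cthickening_subset_thickening' he0 he _ (h1.1 i hiB)
  have hcont : Filter.Tendsto (fun s : ℝ => (1 - s) • x + s • y) (nhdsWithin 0 (Set.Ioi 0))
      (nhds x) := by
    have : Continuous (fun s : ℝ => (1 - s) • x + s • y) := by fun_prop
    have h := this.tendsto 0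
    simp only [sub_zero, one_smul, zero_smul, add_zero] at h
    exact h.mono_left nhdsWithin_le_nhds
  have hev := hcont.eventually (Metric.isOpen_thickening.mem_nhds hx)
  obtain ⟨s, hs, hs0, hs1⟩ := (hev.and (Ioo_mem_nhdsGT (zero_lt_one (α := ℝ)))).exists
  have hz : ‖(1 - s) • x + s • y‖ < ‖x‖ := by
    calc ‖(1 - s) • x + s • y‖ ≤ ‖(1 - s) • x‖ + ‖s • y‖ := norm_add_le _ _
      _ = (1 - s) * ‖x‖ + s * ‖y‖ := by
        rw [norm_smul, norm_smul, Real.norm_of_nonneg (by linarith), Real.norm_of_nonneg hs0.le]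
      _ < ‖x‖ := by nlinarith
  have h7 := h4.2 ((1 - s) • x + s • y) (fun j hj => by
    by_cases hji : j = i
    · subst hji
      exact Metric.thickening_subset_cthickening _ _ hs
    · have ha := h1.1 j hj
      have hb := hy j (Finset.mem_erase.2 ⟨hji, hj⟩)
      have := ((hK j).cthickening (e j)) ha hb (a := 1 - s) (b := s) (by linarith) hs0.le (by ring)
      rw [hag j hji] at this
      exact this)
  linarith

lemma generic_count {n d r : ℕ} (hr : d + r ≤ n) (C : Fin n → Set (EuclideanSpace ℝ (Fin d)))
    (hconv : ∀ i, Convex ℝ (C i)) (hcl : ∀ i, IsClosed (C i))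
    (hgen : ∀ B B' i x x', i ∈ B → i ∉ B' → IsMinPt C B x → IsMinPt C B' x' → ‖x‖ = ‖x'‖ →
      IsMinPt C (B.erase i) x)
    (hdepth : ∀ G : Finset (Fin n), (∃ x, ∀ i ∈ G, x ∈ C i) → G.card ≤ d + r)
    (SS : Finset (Finset (Fin n))) (hSS : ∀ S ∈ SS, S.card = d + 1 ∧ ∃ x, ∀ i ∈ S, x ∈ C i) :
    SS.card ≤ ∑ j ∈ Finset.range r, (n - (j + 1)).choose d := by
  classical
  have hX : ∀ S : Finset (Fin n), ∃ x, (∃ x, ∀ i ∈ S, x ∈ C i) → IsMinPt C S x := by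
    intro S
    by_cases h : ∃ x, ∀ i ∈ S, x ∈ C i
    · obtain ⟨x, hx⟩ := isMinPt_exists hcl S h
      exact ⟨x, fun _ => hx⟩
    · exact ⟨0, fun h' => absurd h' h⟩
  choose X hX using hX
  have hBs : ∀ S : Finset (Fin n), ∃ B, (∃ x, ∀ i ∈ S, x ∈ C i) →
      IsMinPt C B (X S) ∧ ∀ T, IsMinPt C T (X S) → B ⊆ T := by
    intro S
    by_cases h : ∃ x, ∀ i ∈ S, x ∈ C i
    · have hne : (Finset.univ.filter fun B => IsMinPt C B (X S)).Nonempty :=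
        ⟨S, by simpa using hX S h⟩
      obtain ⟨B, hB, hmin⟩ := Finset.exists_min_image _ Finset.card hne
      have hB' : IsMinPt C B (X S) := (Finset.mem_filter.1 hB).2
      refine ⟨B, fun _ => ⟨hB', fun T hT i hi => ?_⟩⟩
      by_contra hiT
      have h1 := hgen B T i _ _ hi hiT hB' hT rfl
      have h2 := hmin (B.erase i) (by simpa using h1)
      have h3 := Finset.card_erase_lt_of_mem hi
      omega
    · exact ⟨∅, fun h' => absurd h' h⟩
  choose Bs hBs using hBs
  let M : Finset (Fin n) → Finset (Fin n) := fun L =>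
    L ∪ Finset.univ.filter (fun y => X L ∈ C y ∧ ∀ z ∈ L \ Bs L, z < y)
  let key : Finset (Fin n) → ℝ ×ₗ ℤ := fun L => toLex (‖X L‖, -((∑ z ∈ L, z.val : ℕ) : ℤ))
  have hMC : ∀ L, (∃ x, ∀ i ∈ L, x ∈ C i) → ∀ y ∈ M L, X L ∈ C y := by
    intro L hL y hy
    rcases Finset.mem_union.1 hy with h | h
    · exact (hX L hL).1 y h
    · exact (Finset.mem_filter.1 h).2.1
  refine collapse_count hr (Finset.univ.filter fun L => L.card = d ∧ ∃ x, ∀ i ∈ L, x ∈ C i) SS M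
    key ?_ ?_ ?_ ?_ (fun S hS => (hSS S hS).1) ?_
  · intro L hL
    exact (Finset.mem_filter.1 hL).2.1
  · intro L _
    exact Finset.subset_union_left
  · intro L hL
    have hL2 := (Finset.mem_filter.1 hL).2.2
    exact hdepth _ ⟨X L, hMC L hL2⟩
  · intro L hL L' hL' hsub hne
    obtain ⟨hLc, hLi⟩ := (Finset.mem_filter.1 hL).2
    obtain ⟨hLc', hLi'⟩ := (Finset.mem_filter.1 hL').2
    have hmem : ∀ i ∈ L, X L' ∈ C i := fun i hi => hMC L' hLi' i (hsub hi)
    have hle : ‖X L‖ ≤ ‖X L'‖ := (hX L hLi).2 _ hmem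
    rw [Prod.Lex.toLex_lt_toLex]
    rcases hle.lt_or_eq with hlt | heq
    · exact Or.inl hlt
    · refine Or.inr ⟨heq, ?_⟩
      have hxx : X L = X L' := isMinPt_unique hconv (hX L hLi) hmem heq.ge
      have hBL : Bs L' ⊆ L := (hBs L' hLi').2 L (hxx ▸ hX L hLi)
      have := sum_lt_of_swap (hLc.trans hLc'.symm) hne (by
        intro y hy z hz
        rw [Finset.mem_sdiff] at hy hz
        rcases Finset.mem_union.1 (hsub hy.1) with h | h
        · exact absurd h hy.2
        · exact (Finset.mem_filter.1 h).2.2 z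
            (Finset.mem_sdiff.2 ⟨hz.1, fun h' => hz.2 (hBL h')⟩))
      simp only
      omega
  · intro S hS
    obtain ⟨hSc, hSi⟩ := hSS S hS
    obtain ⟨i, hi, hmin⟩ := isMinPt_helly hconv hSc (hX S hSi)
    have hBi : Bs S ⊆ S.erase i := (hBs S hSi).2 _ hmin
    have hne : (S \ Bs S).Nonempty :=
      ⟨i, Finset.mem_sdiff.2 ⟨hi, fun h => by simpa using hBi h⟩⟩
    obtain ⟨m, hm, hmax⟩ := Finset.exists_max_image (S \ Bs S) (fun z => z) hne
    rw [Finset.mem_sdiff] at hm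
    have hBL : Bs S ⊆ S.erase m := fun z hz => Finset.mem_erase.2
      ⟨fun h => hm.2 (h ▸ hz), Finset.mem_of_mem_erase (hBi hz)⟩
    have hminL : IsMinPt C (S.erase m) (X S) :=
      ⟨fun j hj => (hX S hSi).1 j (Finset.mem_of_mem_erase hj),
        fun y hy => (hBs S hSi).1.2 y fun j hj => hy j (hBL hj)⟩
    have hLi : ∃ x, ∀ j ∈ S.erase m, x ∈ C j := ⟨X S, hminL.1⟩
    have hxx : X (S.erase m) = X S := isMinPt_unique hconv (hX _ hLi) hminL.1
      (hminL.2 _ (hX _ hLi).1)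
    have hBB : Bs S ⊆ Bs (S.erase m) := (hBs S hSi).2 _ (hxx ▸ (hBs _ hLi).1)
    refine ⟨S.erase m, ?_, Finset.erase_subset _ _, ?_⟩
    · refine Finset.mem_filter.2 ⟨Finset.mem_univ _, ?_, hLi⟩
      rw [Finset.card_erase_of_mem hm.1, hSc]; rfl
    · intro y hy
      by_cases hym : y = m
      · refine Finset.mem_union_right _ (Finset.mem_filter.2 ⟨Finset.mem_univ _, ?_, ?_⟩)
        · rw [hxx]
          exact (hX S hSi).1 y hy
        · intro z hz
          rw [Finset.mem_sdiff, Finset.mem_erase] at hz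
          rw [hym]
          exact lt_of_le_of_ne (hmax z (Finset.mem_sdiff.2 ⟨hz.1.2, fun h => hz.2 (hBB h)⟩)) hz.1.1
      · exact Finset.mem_union_left _ (Finset.mem_erase.2 ⟨hym, hy⟩)

/-- Upper bound theorem for families of convex sets. -/
lemma convex_upper_bound {n d r : ℕ} (hr : d + r ≤ n) (F : Fin n → Set (EuclideanSpace ℝ (Fin d)))
    (hconv : ∀ i, Convex ℝ (F i)) (hne : ∀ i, (F i).Nonempty)
    (hdepth : ∀ G : Finset (Fin n), (∃ x, ∀ i ∈ G, x ∈ F i) → G.card ≤ d + r)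
    (SS : Finset (Finset (Fin n))) (hSS : ∀ S ∈ SS, S.card = d + 1 ∧ ∃ x, ∀ i ∈ S, x ∈ F i) :
    SS.card ≤ ∑ j ∈ Finset.range r, (n - (j + 1)).choose d := by
  classical
  have hp : ∀ G : Finset (Fin n), ∃ x, (∃ x, ∀ i ∈ G, x ∈ F i) → ∀ i ∈ G, x ∈ F i := by
    intro G
    by_cases h : ∃ x, ∀ i ∈ G, x ∈ F i
    · obtain ⟨x, hx⟩ := h
      exact ⟨x, fun _ => hx⟩
    · exact ⟨0, fun h' => absurd h' h⟩
  choose p hp using hp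
  let K : Fin n → Set (EuclideanSpace ℝ (Fin d)) := fun i =>
    convexHull ℝ (p '' {G | i ∈ G ∧ ∃ x, ∀ i ∈ G, x ∈ F i})
  have hKF : ∀ i, K i ⊆ F i := by
    intro i
    apply convexHull_min _ (hconv i)
    rintro _ ⟨G, ⟨hi, hG⟩, rfl⟩
    exact hp G hG i hi
  have hpK : ∀ G, (∃ x, ∀ i ∈ G, x ∈ F i) → ∀ i ∈ G, p G ∈ K i := fun G hG i hi =>
    subset_convexHull ℝ _ ⟨G, ⟨hi, hG⟩, rfl⟩
  have hKc : ∀ i, IsCompact (K i) := fun i =>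
    ((Set.toFinite _).image p).isCompact_convexHull ℝ
  have hKconv : ∀ i, Convex ℝ (K i) := fun i => convex_convexHull _ _
  have hKne : ∀ i, (K i).Nonempty := by
    intro i
    obtain ⟨x, hx⟩ := hne i
    exact ⟨p {i}, hpK {i} ⟨x, by simpa using hx⟩ i (by simp)⟩
  obtain ⟨δ, hδ, hthick⟩ := exists_thickening K hKc hKne
  let Cf : (Fin n → ℝ) → Fin n → Set (EuclideanSpace ℝ (Fin d)) :=
    fun e j => Metric.cthickening (e j) (K j)
  let Bad : Finset (Fin n) × Finset (Fin n) × Fin n → Set (Fin n → ℝ) := fun k =>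
    {e | (∀ j, 0 < e j) ∧ k.2.2 ∈ k.1 ∧ k.2.2 ∉ k.2.1 ∧ ∃ x x', IsMinPt (Cf e) k.1 x ∧
      IsMinPt (Cf e) k.2.1 x' ∧ ‖x‖ = ‖x'‖ ∧
      ∃ y, (∀ j ∈ k.1.erase k.2.2, y ∈ Cf e j) ∧ ‖y‖ < ‖x‖}
  obtain ⟨e, he, hbad⟩ := exists_generic Bad (fun k => k.2.2) (by
    rintro ⟨B, B', i⟩ e ⟨hpos, hiB, hiB', x, x', hx, hx', hxx, y, hy, hyx⟩
      e' ⟨hpos', -, -, x₂, x₂', hx₂, hx₂', hxx₂, y₂, hy₂, hyx₂⟩ hag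
    simp only at *
    funext j
    by_cases hj : j = i
    · subst hj
      rcases lt_trichotomy (e j) (e' j) with h | h | h
      · exact (bad_aux K hKconv h (hpos' _) hag hiB' hx hx' hxx hy hyx hx₂ hx₂' hxx₂ hiB).elim
      · exact h
      · exact (bad_aux K hKconv h (hpos _) (fun k hk => (hag k hk).symm) hiB' hx₂ hx₂' hxx₂
          hy₂ hyx₂ hx hx' hxx hiB).elim
    · exact hag j hj) hδ
  refine generic_count hr (Cf e) (fun i => (hKconv i).cthickening _)
    (fun i => Metric.isClosed_cthickening) ?_ ?_ SS ?_
  · intro B B' i x x' hi hi' hx hx' hxx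
    refine ⟨fun j hj => hx.1 j (Finset.mem_of_mem_erase hj), fun y hy => ?_⟩
    by_contra hlt
    exact hbad (B, B', i) ⟨fun j => (he j).1, hi, hi', x, x', hx, hx', hxx, y, hy, not_le.1 hlt⟩
  · rintro G ⟨x, hx⟩
    apply hdepth
    obtain ⟨y, hy⟩ := hthick G ⟨x, fun i hi => Metric.cthickening_mono (he i).2.le _ (hx i hi)⟩
    exact ⟨y, fun i hi => hKF i (hy i hi)⟩
  · intro S hS
    refine ⟨(hSS S hS).1, p S, fun i hi => Metric.self_subset_cthickening _ (hpK S (hSS S hS).2 i hi)⟩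

lemma double_count {n p q k : ℕ} (hk : k ≤ p) (hn : p ≤ n)
    (I : Finset (Fin n) → Prop) [DecidablePred I]
    (hI : ∀ P : Finset (Fin n), P.card = p → ∃ Q ⊆ P, Q.card = q ∧ ∀ S ⊆ Q, I S) :
    q.choose k * n.choose k ≤
      (((Finset.univ : Finset (Fin n)).powersetCard k).filter I).card * p.choose k := by
  classical
  set SS := ((Finset.univ : Finset (Fin n)).powersetCard k).filter I
  set PP := (Finset.univ : Finset (Fin n)).powersetCard p
  have h := Finset.sum_card_bipartiteAbove_eq_sum_card_bipartiteBelow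
    (s := PP) (t := SS) (fun P S => S ⊆ P)
  have h1 : ∀ P ∈ PP, q.choose k ≤ (Finset.bipartiteAbove (fun P S => S ⊆ P) SS P).card := by
    intro P hP
    obtain ⟨Q, hQP, hQ, hIQ⟩ := hI P (Finset.mem_powersetCard.1 hP).2
    rw [← hQ, ← Finset.card_powersetCard]
    apply Finset.card_le_card
    intro S hS
    rw [Finset.mem_powersetCard] at hS
    simp only [Finset.bipartiteAbove, Finset.mem_filter, SS, Finset.mem_powersetCard]
    exact ⟨⟨⟨Finset.subset_univ _, hS.2⟩, hIQ S hS.1⟩, hS.1.trans hQP⟩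
  have h2 : ∀ S ∈ SS, (Finset.bipartiteBelow (fun P S => S ⊆ P) PP S).card =
      (n - k).choose (p - k) := by
    intro S hS
    have hSc : S.card = k := (Finset.mem_powersetCard.1 (Finset.mem_filter.1 hS).1).2
    have := Finset.card_filter_powersetCard_subset S Finset.univ p (by simp) (by omega)
    simpa [Finset.bipartiteBelow, PP, hSc] using this
  rw [Finset.sum_congr rfl h2, Finset.sum_const, smul_eq_mul] at h
  have h3 := Finset.card_nsmul_le_sum PP _ _ h1
  rw [h, Finset.card_powersetCard, Finset.card_univ, Fintype.card_fin, smul_eq_mul] at h3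
  have h4 := Nat.choose_mul (n := n) hk
  have h5 : 0 < (n - k).choose (p - k) := Nat.choose_pos (by omega)
  apply Nat.le_of_mul_le_mul_right _ h5
  calc q.choose k * n.choose k * (n - k).choose (p - k)
      = n.choose p * q.choose k * p.choose k := by rw [mul_assoc, ← h4]; ring
    _ ≤ SS.card * (n - k).choose (p - k) * p.choose k := Nat.mul_le_mul_right _ h3
    _ = _ := by ring

lemma pow_mul_descFactorial_le (n k d : ℕ) :
    k ^ (d + 1) * n.descFactorial (d + 1) ≤ n ^ (d + 1) * (k + d).descFactorial (d + 1) := by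
  induction d with
  | zero => simp [mul_comm]
  | succ d ih =>
    rw [Nat.descFactorial_succ n (d + 1), show k + (d + 1) = (k + d) + 1 by ring,
      Nat.succ_descFactorial_succ, pow_succ k, pow_succ n]
    have h : k * (n - (d + 1)) ≤ n * (k + d + 1) :=
      (Nat.mul_le_mul (Nat.le_add_right k (d + 1)) (Nat.sub_le n (d + 1))).trans
        (le_of_eq (by ring))
    calc k ^ (d + 1) * k * ((n - (d + 1)) * n.descFactorial (d + 1))
        = (k ^ (d + 1) * n.descFactorial (d + 1)) * (k * (n - (d + 1))) := by ring
      _ ≤ (n ^ (d + 1) * (k + d).descFactorial (d + 1)) * (n * (k + d + 1)) :=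
        Nat.mul_le_mul ih h
      _ = _ := by ring

lemma pow_mul_choose_le (n k d : ℕ) :
    k ^ (d + 1) * n.choose (d + 1) ≤ n ^ (d + 1) * (k + d).choose (d + 1) := by
  have h := pow_mul_descFactorial_le n k d
  rw [Nat.descFactorial_eq_factorial_mul_choose, Nat.descFactorial_eq_factorial_mul_choose] at h
  apply Nat.le_of_mul_le_mul_left _ (Nat.factorial_pos (d + 1))
  calc _ = _ := by ring
    _ ≤ _ := h
    _ = _ := by ring

/-- Berg et al. (fractional Helly): in an `ℝ^d`-convex `(q,p)`-agreeable society with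
`n` voters, some point lies in at least `(1 - (1 - C(q,d+1)/C(p,d+1))^(1/(d+1))) n`
of the approval sets. -/
theorem fractional_helly_agreement {d p q n : ℕ} (hd : 1 ≤ d) (hq : 2 ≤ q) (hpq : q ≤ p)
    (hn : p ≤ n) (F : Fin n → Set (Fin d → ℝ))
    (hconv : ∀ i, Convex ℝ (F i)) (hne : ∀ i, (F i).Nonempty)
    (hagree : ∀ P : Finset (Fin n), P.card = p →
      ∃ Q ⊆ P, Q.card = q ∧ (⋂ i ∈ Q, F i).Nonempty) :
    ∃ x : Fin d → ℝ,
      (1 - (1 - (Nat.choose q (d + 1) : ℝ) / (Nat.choose p (d + 1) : ℝ)) ^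
          ((1 : ℝ) / ((d : ℝ) + 1))) * (n : ℝ) ≤
        (Set.ncard {i : Fin n | x ∈ F i} : ℝ) := by
  classical
  rcases Nat.lt_or_ge q (d + 1) with hqd | hqd
  · refine ⟨0, ?_⟩
    rw [Nat.choose_eq_zero_of_lt hqd]
    simp
  -- a point of maximal depth
  obtain ⟨G, hG, hmax⟩ := Finset.exists_max_image
    (Finset.univ.filter fun G : Finset (Fin n) => ∃ x, ∀ i ∈ G, x ∈ F i) Finset.card
    ⟨∅, by simp⟩
  obtain ⟨x, hx⟩ := (Finset.mem_filter.1 hG).2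
  have hmax' : ∀ G' : Finset (Fin n), (∃ x, ∀ i ∈ G', x ∈ F i) → G'.card ≤ G.card :=
    fun G' h => hmax G' (by simpa using h)
  have hGn : G.card ≤ n := by simpa using Finset.card_le_univ G
  have hqG : q ≤ G.card := by
    obtain ⟨P, -, hP⟩ := Finset.exists_subset_card_eq
      (s := (Finset.univ : Finset (Fin n))) (n := p) (by simpa using hn)
    obtain ⟨Q, -, hQ, y, hy⟩ := hagree P hP
    rw [← hQ]
    exact hmax' Q ⟨y, by simpa using hy⟩
  set m := G.card with hm
  let I : Finset (Fin n) → Prop := fun S => ∃ x, ∀ i ∈ S, x ∈ F i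
  have hdc := double_count (q := q) (k := d + 1) (hqd.trans hpq) hn I (by
    intro P hP
    obtain ⟨Q, hQP, hQ, y, hy⟩ := hagree P hP
    simp only [Set.mem_iInter] at hy
    exact ⟨Q, hQP, hQ, fun S hS => ⟨y, fun i hi => hy i (hS hi)⟩⟩)
  set SS := ((Finset.univ : Finset (Fin n)).powersetCard (d + 1)).filter I with hSS
  let F' : Fin n → Set (EuclideanSpace ℝ (Fin d)) := fun i =>
    (WithLp.linearEquiv 2 ℝ (Fin d → ℝ)).toLinearMap ⁻¹' F i
  have htr : ∀ S : Finset (Fin n), (∃ x, ∀ i ∈ S, x ∈ F' i) ↔ I S := by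
    intro S
    constructor
    · rintro ⟨x, hx⟩
      exact ⟨WithLp.ofLp x, hx⟩
    · rintro ⟨x, hx⟩
      exact ⟨WithLp.toLp 2 x, hx⟩
  have hub := convex_upper_bound (r := m - d) (by omega) F'
    (fun i => (hconv i).linear_preimage _)
    (fun i => by
      obtain ⟨y, hy⟩ := hne i
      exact ⟨WithLp.toLp 2 y, hy⟩)
    (fun G' h => (hmax' G' ((htr G').1 h)).trans (by omega)) SS
    (fun S hS => by
      rw [hSS, Finset.mem_filter, Finset.mem_powersetCard] at hS
      exact ⟨hS.1.2, (htr S).2 hS.2⟩)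
  have hsum := sum_choose_eq n d (m - d) (by omega)
  have hpow := pow_mul_choose_le n (n - m) d
  rw [show n - (m - d) = n - m + d by omega] at hsum
  have hle : SS.card + (n - m + d).choose (d + 1) ≤ n.choose (d + 1) := by omega
  refine ⟨x, ?_⟩
  have hdep : (m : ℝ) ≤ (Set.ncard {i : Fin n | x ∈ F i} : ℝ) := by
    rw [hm, ← Set.ncard_coe_finset]
    exact_mod_cast Set.ncard_le_ncard (fun i hi => hx i hi) (Set.toFinite _)
  refine le_trans ?_ hdep
  have hcn : (0 : ℝ) < n.choose (d + 1) := by exact_mod_cast Nat.choose_pos (by omega)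
  have hcp : (0 : ℝ) < p.choose (d + 1) := by exact_mod_cast Nat.choose_pos (by omega)
  have hn0 : (0 : ℝ) < n := by exact_mod_cast (by omega : 0 < n)
  have hdcR : (q.choose (d + 1) : ℝ) * n.choose (d + 1) ≤ SS.card * p.choose (d + 1) := by
    exact_mod_cast hdc
  have hleR : (SS.card : ℝ) + (n - m + d).choose (d + 1) ≤ n.choose (d + 1) := by
    exact_mod_cast hle
  have hpowR : ((n : ℝ) - m) ^ (d + 1) * n.choose (d + 1) ≤
      (n : ℝ) ^ (d + 1) * (n - m + d).choose (d + 1) := by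
    rw [← Nat.cast_sub hGn]
    exact_mod_cast hpow
  set α : ℝ := (q.choose (d + 1) : ℝ) / p.choose (d + 1) with hα
  have hαle : α * n.choose (d + 1) ≤ SS.card := by
    rw [hα, div_mul_eq_mul_div, div_le_iff₀ hcp]
    exact hdcR
  have hkn : 0 ≤ ((n : ℝ) - m) / n :=
    div_nonneg (sub_nonneg.2 (by exact_mod_cast hGn)) hn0.le
  have hfin : (((n : ℝ) - m) / n) ^ (d + 1) ≤ 1 - α := by
    rw [div_pow, div_le_iff₀ (by positivity)]
    have hnp : (0 : ℝ) < (n : ℝ) ^ (d + 1) := by positivity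
    refine le_of_mul_le_mul_right ?_ hcn
    calc _ ≤ _ := hpowR
      _ ≤ (n : ℝ) ^ (d + 1) * ((1 - α) * n.choose (d + 1)) := by
        apply mul_le_mul_of_nonneg_left _ hnp.le
        linarith
      _ = _ := by ring
  have hroot : ((n : ℝ) - m) / n ≤ (1 - α) ^ ((1 : ℝ) / ((d : ℝ) + 1)) := by
    have h1 := Real.pow_rpow_inv_natCast hkn (n := d + 1) (by omega)
    rw [← h1, one_div]
    push_cast
    exact Real.rpow_le_rpow (by positivity) hfin (by positivity)
  have h2 : 1 - (1 - α) ^ ((1 : ℝ) / ((d : ℝ) + 1)) ≤ m / n := by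
    have : ((n : ℝ) - m) / n = 1 - m / n := by field_simp
    linarith
  calc _ ≤ (m : ℝ) / n * n := mul_le_mul_of_nonneg_right h2 hn0.le
    _ = m := by field_simp
end
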